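/- Assume R is unmixed of dimension d ≥ 2. Suppose there exist a C-system of parameters x = x_1,…,x_d of R and an integer t ≥ 1 such that the set Ω_{x,1}^t(R) = { e_1((x_1^n,…,x_d^n) :_R m, R) : n ≥ t } is finite. Let h = max{ |X| : X ∈ Ω_{x,1}^t(R) } + N(R). Then m^h · H^i_m(R) = 0 for all i ≠ d; in particular R is generalized Cohen-Macaulay. -/

import Mathlib

/-! Preliminary definitions: lengths, dimensions, (C-)systems of parameters, Hilbert
coefficients, irreducible multiplicities, local cohomology invariants, stable values,
unmixedness, the unmixed component, and the g-invariant. -/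

open CategoryTheory CategoryTheory.Limits Opposite IsLocalRing

universe u

noncomputable section

section Definitions

variable (R : Type u) [CommRing R]

/-- The length of an `R`-module, defined as the Krull dimension of its submodule lattice. -/
def moduleLength (M : Type u) [AddCommGroup M] [Module R M] : WithBot ℕ∞ :=
  Order.krullDim (Submodule R M)

/-- The Krull dimension of an `R`-module `M`, i.e. `dim (R / Ann M)`. -/
def moduleDim (M : Type u) [AddCommGroup M] [Module R M] : WithBot ℕ∞ :=
  ringKrullDim (R ⧸ Module.annihilator R M)

/-- The colon submodule `(N :_M I) = {x : M | I • x ⊆ N}`. -/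
def modColon {M : Type u} [AddCommGroup M] [Module R M] (N : Submodule R M) (I : Ideal R) :
    Submodule R M where
  carrier := {x | ∀ r ∈ I, r • x ∈ N}
  add_mem' := by
    intro a b ha hb r hr
    simpa [smul_add] using N.add_mem (ha r hr) (hb r hr)
  zero_mem' := by
    intro r hr
    simpa using N.zero_mem
  smul_mem' := by
    intro c a ha r hr
    rw [smul_comm]
    exact N.smul_mem c (ha r hr)

/-- `x : Fin s → R` is a system of parameters of the module `M`:
`s = dim M`, the `x i` are nonunits, and `M/(x)M` has finite length. -/
def IsSOP (M : Type u) [AddCommGroup M] [Module R M] {s : ℕ} (x : Fin s → R) : Prop :=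
  moduleDim R M = (s : WithBot ℕ∞) ∧ (∀ i, x i ∈ nonunits R) ∧
    IsFiniteLength R (M ⧸ (Ideal.span (Set.range x) • (⊤ : Submodule R M)))

/-- The ideal `b(M)`: the intersection, over all systems of parameters `x` of `M` and all `i`,
of `Ann_R ((0) :_{M/(x_1,...,x_{i-1})M} x_i)`. -/
def bIdeal (M : Type u) [AddCommGroup M] [Module R M] : Ideal R :=
  ⨅ (s : ℕ) (x : Fin s → R) (_ : IsSOP R M x) (i : Fin s),
    (Submodule.torsionBy R
      (M ⧸ (Ideal.span (x '' {j | j < i}) • (⊤ : Submodule R M))) (x i)).annihilator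

/-- `x` is a C-system of parameters of `M`: a system of parameters such that
`x i ∈ b(M/(x_{i+1},...,x_s)M)^3` for every `i` (for `i = s` the quotient is `M` itself). -/
def IsCSOP (M : Type u) [AddCommGroup M] [Module R M] {s : ℕ} (x : Fin s → R) : Prop :=
  IsSOP R M x ∧ ∀ i : Fin s,
    x i ∈ (bIdeal R (M ⧸ (Ideal.span (x '' {j | i < j}) • (⊤ : Submodule R M)))) ^ 3

/-- A parameter ideal of `R`. -/
def IsParamIdeal (q : Ideal R) : Prop :=
  ∃ (s : ℕ) (x : Fin s → R), IsSOP R R x ∧ q = Ideal.span (Set.range x)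

/-- A C-parameter ideal of `R`: an ideal generated by a C-system of parameters of `R`. -/
def IsCParamIdeal (q : Ideal R) : Prop :=
  ∃ (s : ℕ) (x : Fin s → R), IsCSOP R R x ∧ q = Ideal.span (Set.range x)

/-- A C-parameter ideal of a module `M`. -/
def IsCParamIdealMod (M : Type u) [AddCommGroup M] [Module R M] (q : Ideal R) : Prop :=
  ∃ (s : ℕ) (x : Fin s → R), IsCSOP R M x ∧ q = Ideal.span (Set.range x)

/-- `e` is the family of Hilbert coefficients of `M` (of dimension `s`) with respect to `I`:
`ℓ(M/I^{n+1}M) = ∑_{i=0}^{s} (-1)^i (e i) binom(n+s-i, s-i)` for all large `n`. -/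
def IsHilbCoeffMod (I : Ideal R) (M : Type u) [AddCommGroup M] [Module R M] (s : ℕ)
    (e : ℕ → ℤ) : Prop :=
  ∃ N : ℕ, ∀ n ≥ N, ∃ L : ℕ,
    moduleLength R (M ⧸ (I ^ (n + 1) • (⊤ : Submodule R M))) = (L : WithBot ℕ∞) ∧
    (L : ℤ) = ∑ i ∈ Finset.range (s + 1),
      (-1) ^ i * e i * ((n + s - i).choose (s - i) : ℤ)

/-- `e` is the family of Hilbert coefficients of `R` (of dimension `d`) with respect to `I`;
`e 1` is the Chern number of `I`. -/
def IsHilbCoeff (I : Ideal R) (d : ℕ) (e : ℕ → ℤ) : Prop :=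
  IsHilbCoeffMod R I R d e

variable [IsLocalRing R]

/-- The colon ideal `(q :_R m)`. -/
def colonIdeal (q : Ideal R) : Ideal R :=
  modColon R q (maximalIdeal R)

/-- The index of reducibility `ir_M(q) = ℓ((qM :_M m)/qM)`. -/
def irMod (M : Type u) [AddCommGroup M] [Module R M] (q : Ideal R) : WithBot ℕ∞ :=
  moduleLength R
    ↥(Submodule.map (q • (⊤ : Submodule R M)).mkQ
      (modColon R (q • (⊤ : Submodule R M)) (maximalIdeal R)))

/-- `NN` is the stable value `𝒩(M)` of `M`: the common index of reducibility of all
C-parameter ideals of `M`. -/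
def IsStableValueMod (M : Type u) [AddCommGroup M] [Module R M] (NN : ℕ) : Prop :=
  ∀ q : Ideal R, IsCParamIdealMod R M q → irMod R M q = (NN : WithBot ℕ∞)

/-- `NN` is the stable value `𝒩(R)` of `R`. -/
def IsStableValue (NN : ℕ) : Prop :=
  ∀ q : Ideal R, IsCParamIdeal R q → irMod R R q = (NN : WithBot ℕ∞)

/-- `f` is the family of coefficients of the polynomial giving the index of reducibility,
`ir_M(I^{n+1}) = ℓ((I^{n+1}M :_M m)/I^{n+1}M) = ∑_{i=0}^{s-1} (-1)^i (f i) binom(n+s-1-i, s-1-i)`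
for all large `n`; `f 0` is the irreducible multiplicity of `M` with respect to `I`. -/
def IsIrrCoeffMod (I : Ideal R) (M : Type u) [AddCommGroup M] [Module R M] (s : ℕ)
    (f : ℕ → ℤ) : Prop :=
  ∃ N : ℕ, ∀ n ≥ N, ∃ L : ℕ,
    irMod R M (I ^ (n + 1)) = (L : WithBot ℕ∞) ∧
    (L : ℤ) = ∑ i ∈ Finset.range s,
      (-1) ^ i * f i * ((n + s - 1 - i).choose (s - 1 - i) : ℤ)

/-- Ring version of `IsIrrCoeffMod`. -/
def IsIrrCoeff (I : Ideal R) (d : ℕ) (f : ℕ → ℤ) : Prop :=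
  IsIrrCoeffMod R I R d f

/-- The local cohomology module `H^i_m(M)`. -/
def Hmod (M : Type u) [AddCommGroup M] [Module R M] (i : ℕ) : ModuleCat.{u} R :=
  (localCohomology (maximalIdeal R) i).obj (ModuleCat.of R M)

/-- `r_i(M) = ℓ((0) :_{H^i_m(M)} m)`, the length of the socle of `H^i_m(M)`. -/
def rLengthMod (M : Type u) [AddCommGroup M] [Module R M] (i : ℕ) : WithBot ℕ∞ :=
  moduleLength R ↥(Submodule.torsionBySet R ↥(Hmod R M i) ((maximalIdeal R : Ideal R) : Set R))

/-- `r_i(R)`. -/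
def rLength (i : ℕ) : WithBot ℕ∞ := rLengthMod R R i

/-- `M` is a Cohen-Macaulay `R`-module: `H^i_m(M) = 0` for all `i < dim M`. -/
def IsCMMod (M : Type u) [AddCommGroup M] [Module R M] : Prop :=
  ∀ i : ℕ, (i : WithBot ℕ∞) < moduleDim R M → Subsingleton ↥(Hmod R M i)

/-- `R` is a Cohen-Macaulay local ring: `H^i_m(R) = 0` for all `i < dim R`. -/
def IsCMLocal : Prop :=
  ∀ i : ℕ, (i : WithBot ℕ∞) < ringKrullDim R → Subsingleton ↥(Hmod R R i)

/-- `R` is a generalized Cohen-Macaulay local ring: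
`H^i_m(R)` has finite length for all `i < dim R`. -/
def IsGeneralizedCM : Prop :=
  ∀ i : ℕ, (i : WithBot ℕ∞) < ringKrullDim R → IsFiniteLength R ↥(Hmod R R i)

/-- `R` is a Gorenstein local ring: Cohen-Macaulay of type `r_d(R) = 1`, `d = dim R`. -/
def IsGorensteinLocal : Prop :=
  IsCMLocal R ∧ ∀ d : ℕ, ringKrullDim R = (d : WithBot ℕ∞) → rLength R d = (1 : WithBot ℕ∞)

/-- `R` is unmixed: `dim R̂/p = dim R̂` for every associated prime `p` of the
`m`-adic completion `R̂` of `R`. -/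
def IsUnmixedRing : Prop :=
  ∀ p ∈ associatedPrimes (AdicCompletion (maximalIdeal R) R) (AdicCompletion (maximalIdeal R) R),
    ringKrullDim ((AdicCompletion (maximalIdeal R) R) ⧸ p) =
      ringKrullDim (AdicCompletion (maximalIdeal R) R)

/-- `M` is unmixed: `dim R̂/p = dim M̂` for every associated prime `p` of the
`m`-adic completion `M̂` of `M`, viewed over `R̂`. -/
def IsUnmixedMod (M : Type u) [AddCommGroup M] [Module R M] : Prop :=
  ∀ p ∈ associatedPrimes (AdicCompletion (maximalIdeal R) R) (AdicCompletion (maximalIdeal R) M),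
    ringKrullDim ((AdicCompletion (maximalIdeal R) R) ⧸ p) =
      moduleDim (AdicCompletion (maximalIdeal R) R) (AdicCompletion (maximalIdeal R) M)

/-- `H^0_m(M)`, described as the submodule of elements killed by a power of `m`. -/
def H0Sub (M : Type u) [AddCommGroup M] [Module R M] : Submodule R M :=
  ⨆ n : ℕ, Submodule.torsionBySet R M (((maximalIdeal R) ^ n : Ideal R) : Set R)

/-- The unmixed component `u = U_R(0)` of `R`: the largest ideal of dimension `< dim R`. -/
def unmixedComponent : Ideal R := sSup {J : Ideal R | moduleDim R ↥J < ringKrullDim R}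

end Definitions

section CMImage

/-- `R` is a homomorphic image of a Cohen-Macaulay (Noetherian) local ring. -/
def IsHomImageOfCM (R : Type u) [CommRing R] : Prop :=
  ∃ (A : Type u) (_ : CommRing A) (_ : IsLocalRing A) (_ : IsNoetherianRing A),
    IsCMLocal A ∧ ∃ f : A →+* R, Function.Surjective f

end CMImage

section GInvariant

variable (R : Type u) [CommRing R] [IsLocalRing R] [IsNoetherianRing R]

/-- The canonical homomorphism from `Ext^p(R/q, R)` (the term of the directed system indexed by
the ideal `q` with `J ≤ rad q`) into the local cohomology module `H^p_J(R)`, given by the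
structure of `H^p_J(R)` as an inductive limit. -/
def canonicalToLocalCohomology (J q : Ideal R) (h : J ≤ q.radical) (p : ℕ) :
    ((localCohomology.diagram (localCohomology.selfLERadicalDiagram J) p).obj
        (op (⟨q, h⟩ : localCohomology.SelfLERadical J))).obj (ModuleCat.of R R) ⟶
      (localCohomology J p).obj (ModuleCat.of R R) :=
  haveI := localCohomology.hasColimitDiagram.{u, u} (localCohomology.selfLERadicalDiagram J) p
  (colimit.ι (localCohomology.diagram (localCohomology.selfLERadicalDiagram J) p)
      (op (⟨q, h⟩ : localCohomology.SelfLERadical J))).app (ModuleCat.of R R) ≫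
    (localCohomology.isoSelfLERadical J p).hom.app (ModuleCat.of R R)

/-- A map of `R`-modules is surjective on socles. -/
def SurjectiveOnSocles {A B : ModuleCat.{u} R} (φ : A ⟶ B) : Prop :=
  ∀ y ∈ Submodule.torsionBySet R ↥B ((maximalIdeal R : Ideal R) : Set R),
    ∃ z ∈ Submodule.torsionBySet R ↥A ((maximalIdeal R : Ideal R) : Set R), φ z = y

/-- The defining property of the g-invariant: for every system of parameters `x` of `R`
contained in `m^(n₀)` and every `p`, the canonical homomorphism into the local cohomology
module `H^p_m(R)` is surjective on the socles. -/
def GProperty (n₀ : ℕ) : Prop :=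
  ∀ (s : ℕ) (x : Fin s → R), IsSOP R R x → (∀ i, x i ∈ maximalIdeal R ^ n₀) →
    ∀ (h : maximalIdeal R ≤ (Ideal.span (Set.range x)).radical) (p : ℕ),
      SurjectiveOnSocles R
        (canonicalToLocalCohomology R (maximalIdeal R) (Ideal.span (Set.range x)) h p)

/-- The g-invariant `g(R)`: the least `n₀` satisfying `GProperty`. -/
def gInvariant : ℕ := sInf {n₀ : ℕ | GProperty R n₀}

end GInvariant

end

section ParameterPowers

variable {R : Type u} [CommRing R]

/-- The ideal generated by the powers `x i ^ a i` with `i ∈ A`. -/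
def powIdeal (x : ℕ → R) (a : ℕ → ℕ) (A : Set ℕ) : Ideal R :=
  Ideal.span ((fun i => x i ^ a i) '' A)

theorem powIdeal_mono (x : ℕ → R) (a : ℕ → ℕ) {A B : Set ℕ} (h : A ⊆ B) :
    powIdeal x a A ≤ powIdeal x a B :=
  Ideal.span_mono (Set.image_mono h)

theorem powIdeal_congr (x : ℕ → R) {a b : ℕ → ℕ} {A : Set ℕ} (h : ∀ i ∈ A, a i = b i) :
    powIdeal x a A = powIdeal x b A := by
  unfold powIdeal
  congr 1
  exact Set.image_congr fun i hi => by simp [h i hi]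

theorem powIdeal_insert (x : ℕ → R) (a : ℕ → ℕ) (i : ℕ) (A : Set ℕ) :
    powIdeal x a (insert i A) = Ideal.span {x i ^ a i} ⊔ powIdeal x a A := by
  rw [powIdeal, Set.image_insert_eq, Ideal.span_insert, powIdeal]

theorem pow_mem_powIdeal (x : ℕ → R) (a : ℕ → ℕ) {i : ℕ} {A : Set ℕ} (h : i ∈ A) :
    x i ^ a i ∈ powIdeal x a A :=
  Ideal.subset_span ⟨i, h, rfl⟩

theorem mem_powIdeal_insert {x : ℕ → R} {a : ℕ → ℕ} {i : ℕ} {A : Set ℕ} {u : R} :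
    u ∈ powIdeal x a (insert i A) ↔ ∃ v, ∃ p ∈ powIdeal x a A, u = p + x i ^ a i * v := by
  rw [powIdeal_insert, Submodule.mem_sup]
  constructor
  · rintro ⟨y, hy, p, hp, rfl⟩
    obtain ⟨v, rfl⟩ := Ideal.mem_span_singleton.1 hy
    exact ⟨v, p, hp, by ring⟩
  · rintro ⟨v, p, hp, rfl⟩
    exact ⟨_, Ideal.mem_span_singleton.2 ⟨v, rfl⟩, p, hp, by ring⟩

theorem Iio_succ_eq_insert (j : ℕ) : Set.Iio (j + 1) = insert j (Set.Iio j) := by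
  ext i
  simp only [Set.mem_Iio, Set.mem_insert_iff]
  omega

theorem mem_powIdeal_succ {x : ℕ → R} {a : ℕ → ℕ} {j : ℕ} {u : R} :
    u ∈ powIdeal x a (Set.Iio (j + 1)) ↔
      ∃ v, ∃ p ∈ powIdeal x a (Set.Iio j), u = p + x j ^ a j * v := by
  rw [Iio_succ_eq_insert, mem_powIdeal_insert]

theorem powIdeal_succ (x : ℕ → R) (a : ℕ → ℕ) (j : ℕ) :
    powIdeal x a (Set.Iio (j + 1)) = powIdeal x a (Set.Iio j) ⊔ Ideal.span {x j ^ a j} := by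
  rw [Iio_succ_eq_insert, powIdeal_insert, sup_comm]

theorem powIdeal_zero (x : ℕ → R) (a : ℕ → ℕ) : powIdeal x a (Set.Iio 0) = ⊥ := by
  have : Set.Iio (0 : ℕ) = ∅ := by ext; simp
  rw [powIdeal, this, Set.image_empty, Ideal.span_empty]

variable [IsLocalRing R]

/-- The saturation `J : m^∞`. -/
def satIdeal (J : Ideal R) : Ideal R where
  carrier := {u | ∃ k : ℕ, ∀ c ∈ maximalIdeal R ^ k, c * u ∈ J}
  zero_mem' := ⟨0, fun c _ => by simp⟩
  add_mem' := by
    rintro u v ⟨k, hk⟩ ⟨l, hl⟩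
    refine ⟨k + l, fun c hc => ?_⟩
    rw [mul_add]
    exact J.add_mem (hk c (Ideal.pow_le_pow_right (Nat.le_add_right k l) hc))
      (hl c (Ideal.pow_le_pow_right (Nat.le_add_left l k) hc))
  smul_mem' := by
    rintro r u ⟨k, hk⟩
    refine ⟨k, fun c hc => ?_⟩
    rw [smul_eq_mul, mul_left_comm]
    exact J.mul_mem_left r (hk c hc)

theorem mem_satIdeal {J : Ideal R} {u : R} :
    u ∈ satIdeal J ↔ ∃ k : ℕ, ∀ c ∈ maximalIdeal R ^ k, c * u ∈ J := Iff.rfl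

theorem le_satIdeal (J : Ideal R) : J ≤ satIdeal J :=
  fun _ hu => ⟨0, fun c _ => J.mul_mem_left c hu⟩

theorem satIdeal_mono {J K : Ideal R} (h : J ≤ K) : satIdeal J ≤ satIdeal K :=
  fun _ ⟨k, hk⟩ => ⟨k, fun c hc => h (hk c hc)⟩

theorem exists_pow_mul_satIdeal_le [IsNoetherianRing R] (J : Ideal R) :
    ∃ k : ℕ, ∀ c ∈ maximalIdeal R ^ k, ∀ u ∈ satIdeal J, c * u ∈ J := by
  obtain ⟨s, hs⟩ := (isNoetherianRing_iff_ideal_fg R).1 inferInstance (satIdeal J)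
  have hmem : ∀ u ∈ s, ∃ k : ℕ, ∀ c ∈ maximalIdeal R ^ k, c * u ∈ J := fun u hu =>
    mem_satIdeal.1 (hs ▸ Ideal.subset_span hu)
  choose! k hk using hmem
  refine ⟨s.sup k, fun c hc u hu => ?_⟩
  rw [← hs] at hu
  induction hu using Submodule.span_induction with
  | mem u hu => exact hk u hu c (Ideal.pow_le_pow_right (Finset.le_sup hu) hc)
  | zero => simp
  | add u v _ _ hu hv => rw [mul_add]; exact J.add_mem hu hv
  | smul r u _ hu => rw [smul_eq_mul, mul_left_comm]; exact J.mul_mem_left r hu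

theorem satIdeal_satIdeal [IsNoetherianRing R] (J : Ideal R) :
    satIdeal (satIdeal J) = satIdeal J := by
  refine le_antisymm (fun u ⟨k, hk⟩ => ?_) (le_satIdeal _)
  obtain ⟨l, hl⟩ := exists_pow_mul_satIdeal_le J
  refine ⟨l + k, fun c hc => ?_⟩
  rw [pow_add] at hc
  induction hc using Submodule.mul_induction_on' with
  | mem_mul_mem b hb c hc => rw [mul_assoc]; exact hl b hb _ (hk c hc)
  | add a _ b _ ha hb => rw [add_mul]; exact J.add_mem ha hb

/-- Elements `x 0, …, x (d-1)` satisfying the colon identities of a C-system of parameters and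
which are nonzerodivisors. -/
structure IsColonSeq (d : ℕ) (x : ℕ → R) : Prop where
  mem : ∀ i < d, x i ∈ maximalIdeal R
  primary : ∀ a : ℕ → ℕ, ∃ k : ℕ, maximalIdeal R ^ k ≤ powIdeal x a (Set.Iio d)
  nzd : ∀ i < d, ∀ u, x i * u = 0 → u = 0
  colon : ∀ (A : Set ℕ) (a : ℕ → ℕ), A ⊆ Set.Iio d → (∀ i, 1 ≤ a i) → ∀ p l, p ≤ l → l < d →
    p ∉ A → l ∉ A → ∀ N u, x p ^ N * u ∈ powIdeal x a A → x l * u ∈ powIdeal x a A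

namespace IsColonSeq

variable {d : ℕ} {x : ℕ → R} (H : IsColonSeq d x)
include H

theorem colon_Iio {a : ℕ → ℕ} (ha : ∀ i, 1 ≤ a i) {j p l : ℕ} (hj : j ≤ p) (hpl : p ≤ l)
    (hl : l < d) {N : ℕ} {u : R} (hu : x p ^ N * u ∈ powIdeal x a (Set.Iio j)) :
    x l * u ∈ powIdeal x a (Set.Iio j) :=
  H.colon (Set.Iio j) a (fun i hi => by simp only [Set.mem_Iio] at *; omega) ha p l hpl hl
    (by simp; omega) (by simp; omega) N u hu

theorem nzd_pow {i : ℕ} (hi : i < d) (N : ℕ) {u : R} (hu : x i ^ N * u = 0) : u = 0 := by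
  induction N with
  | zero => simpa using hu
  | succ N ih => exact ih (H.nzd i hi _ (by rw [← hu]; ring))

theorem mul_mem_of_mem_sat {a : ℕ → ℕ} (ha : ∀ i, 1 ≤ a i) {j l : ℕ} (hj : j ≤ l) (hl : l < d)
    {u : R} (hu : u ∈ satIdeal (powIdeal x a (Set.Iio j))) :
    x l * u ∈ powIdeal x a (Set.Iio j) := by
  obtain ⟨k, hk⟩ := hu
  exact H.colon_Iio ha hj le_rfl hl (hk _ (Ideal.pow_mem_pow (H.mem l hl) k))

theorem exists_pow_le_sup {a : ℕ → ℕ} (j : ℕ) {I : Ideal R} {N : ℕ}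
    (hI : ∀ l, j ≤ l → l < d → x l ^ N ∈ I) :
    ∃ k, maximalIdeal R ^ k ≤ powIdeal x a (Set.Iio j) ⊔ I := by
  obtain ⟨k, hk⟩ := H.primary (fun i => if i < j then a i else N)
  refine ⟨k, hk.trans (Ideal.span_le.2 ?_)⟩
  rintro _ ⟨i, hi, rfl⟩
  by_cases hij : i < j
  · simp only [hij, if_true]
    exact Ideal.mem_sup_left (pow_mem_powIdeal x a hij)
  · simp only [hij, if_false]
    exact Ideal.mem_sup_right (hI i (not_lt.1 hij) hi)

theorem exists_pow_mul_mem {a : ℕ → ℕ} {j : ℕ} {I : Ideal R}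
    (hI' : powIdeal x a (Set.Iio j) ≤ I) {N : ℕ} {v : R}
    (hI : ∀ l, j ≤ l → l < d → x l ^ N * v ∈ I) :
    ∃ k, ∀ c ∈ maximalIdeal R ^ k, c * v ∈ I := by
  obtain ⟨k, hk⟩ := H.exists_pow_le_sup (a := a) j (N := N)
    (I := Submodule.comap (LinearMap.mulRight R v) I)
    (fun l hl hl' => by simpa using hI l hl hl')
  refine ⟨k, fun c hc => ?_⟩
  have h2 : powIdeal x a (Set.Iio j) ≤ Submodule.comap (LinearMap.mulRight R v) I := fun p hp => by
    simpa using I.mul_mem_right v (hI' hp)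
  simpa using (sup_le h2 le_rfl) (hk hc)

/-- Filter regularity of the sequence. -/
theorem mem_sat_of_pow_mul_mem [IsNoetherianRing R] {a : ℕ → ℕ} (ha : ∀ i, 1 ≤ a i) {j : ℕ} :
    ∀ {k : ℕ}, j ≤ k → k < d → ∀ {N : ℕ} {u : R},
    x k ^ N * u ∈ powIdeal x a (Set.Iio j) → u ∈ satIdeal (powIdeal x a (Set.Iio j)) := by
  induction j with
  | zero =>
    intro k _ hk N u hu
    rw [powIdeal_zero] at hu ⊢
    have := H.nzd_pow hk N (u := u) (by simpa using hu)
    exact this ▸ zero_mem _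
  | succ j ih =>
    intro k hjk hk N u hu
    rcases Nat.eq_zero_or_pos N with rfl | hN
    · exact le_satIdeal _ (by simpa using hu)
    obtain ⟨v, p, hp, huv⟩ := mem_powIdeal_succ.1 hu
    set Q := powIdeal x a (Set.Iio j) with hQ
    set b := Function.update a k N with hb
    have hbk : b k = N := by simp [hb]
    have hbQ : powIdeal x b (Set.Iio j) = Q := powIdeal_congr x fun i hi => by
      simp only [Set.mem_Iio] at hi
      rw [hb, Function.update_of_ne (by omega)]
    have hb1 : ∀ i, 1 ≤ b i := fun i => by
      rw [hb, Function.update_apply]; split_ifs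
      · exact hN
      · exact ha i
    have hv : x j ^ a j * v ∈ powIdeal x b (insert k (Set.Iio j)) := by
      refine mem_powIdeal_insert.2 ⟨u, -p, by rw [hbQ]; exact neg_mem hp, ?_⟩
      rw [hbk, huv]; ring
    have hvl : ∀ l, j ≤ l → l < d → x l ^ N * v ∈ powIdeal x b (insert k (Set.Iio j)) := by
      intro l hl hld
      by_cases hlk : l = k
      · subst hlk
        exact Ideal.mul_mem_right _ _ (hbk ▸ pow_mem_powIdeal x b (Set.mem_insert _ _))
      · have := H.colon (insert k (Set.Iio j)) b (by
          intro i hi; simp only [Set.mem_insert_iff, Set.mem_Iio] at *; omega) hb1 j l hl hld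
          (by simp; omega) (by simp; omega) _ _ hv
        obtain ⟨N', rfl⟩ : ∃ N', N = N' + 1 := ⟨N - 1, by omega⟩
        rw [pow_succ, mul_assoc]
        exact Ideal.mul_mem_left _ _ this
    obtain ⟨e, he⟩ := H.exists_pow_mul_mem (a := b) (j := j)
      (powIdeal_mono x b (Set.subset_insert _ _)) hvl
    have key : ∀ c ∈ maximalIdeal R ^ e, c * u ∈ satIdeal (powIdeal x a (Set.Iio (j + 1))) := by
      intro c hc
      obtain ⟨w, q, hq, hw⟩ := mem_powIdeal_insert.1 (he c hc)
      rw [hbQ] at hq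
      rw [hbk] at hw
      have h1 : c * u - x j ^ a j * w ∈ satIdeal Q := by
        refine ih (k := k) (by omega) hk (N := N) ?_
        have : x k ^ N * (c * u - x j ^ a j * w) = c * p + x j ^ a j * q := by
          linear_combination c * huv + x j ^ a j * hw
        rw [this]
        exact add_mem (Ideal.mul_mem_left _ _ hp) (Ideal.mul_mem_left _ _ hq)
      have h2 := satIdeal_mono (powIdeal_mono x a (Set.Iio_subset_Iio (Nat.le_succ j))) h1
      have h3 : x j ^ a j * w ∈ satIdeal (powIdeal x a (Set.Iio (j + 1))) :=
        le_satIdeal _ (Ideal.mul_mem_right _ _ (pow_mem_powIdeal x a (by simp)))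
      simpa using add_mem h2 h3
    rw [← satIdeal_satIdeal]
    exact ⟨e, key⟩

theorem mem_of_mem_sat_of_mem {a : ℕ → ℕ} (ha : ∀ i, 1 ≤ a i) {j : ℕ} (hj : j ≤ d) {u : R}
    (hu : u ∈ satIdeal (powIdeal x a (Set.Iio j))) (hu' : u ∈ powIdeal x a (Set.Iio d)) :
    u ∈ powIdeal x a (Set.Iio j) := by
  refine Nat.decreasingInduction' (P := fun l => u ∈ powIdeal x a (Set.Iio l)) ?_ hj hu'
  intro l hl hjl ih
  obtain ⟨c, p, hp, rfl⟩ := mem_powIdeal_succ.1 ih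
  refine add_mem hp ?_
  have h1 : x l * (p + x l ^ a l * c) ∈ powIdeal x a (Set.Iio l) :=
    powIdeal_mono x a (Set.Iio_subset_Iio hjl) (H.mul_mem_of_mem_sat ha hjl hl hu)
  have h2 : x l ^ (a l + 1) * c ∈ powIdeal x a (Set.Iio l) := by
    have := sub_mem h1 (Ideal.mul_mem_left _ (x l) hp)
    convert this using 1
    ring
  have h3 := H.colon_Iio ha le_rfl le_rfl hl h2
  obtain ⟨b, hb⟩ := Nat.exists_eq_add_of_le (ha l)
  rw [hb, pow_add, pow_one, mul_comm (x l), mul_assoc]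
  exact Ideal.mul_mem_left _ _ h3

theorem mem_sat_of_pow_mul_mem_sat [IsNoetherianRing R] {a : ℕ → ℕ} (ha : ∀ i, 1 ≤ a i) {j k : ℕ}
    (hjk : j ≤ k) (hk : k < d) {N : ℕ} {u : R}
    (hu : x k ^ N * u ∈ satIdeal (powIdeal x a (Set.Iio j))) :
    u ∈ satIdeal (powIdeal x a (Set.Iio j)) := by
  obtain ⟨e, he⟩ := hu
  refine H.mem_sat_of_pow_mul_mem ha hjk hk (N := e + N) ?_
  rw [pow_add, mul_assoc]
  exact he _ (Ideal.pow_mem_pow (H.mem k hk) e)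

theorem mul_mem_sat_sup [IsNoetherianRing R] {a : ℕ → ℕ} (ha : ∀ i, 1 ≤ a i) {j : ℕ}
    (hj : j + 1 < d) {u : R} (hu : u ∈ satIdeal (powIdeal x a (Set.Iio (j + 1)))) :
    ∃ w, x j * u - x j ^ a j * w ∈ satIdeal (powIdeal x a (Set.Iio j)) := by
  obtain ⟨v, q₀, hq₀, hv⟩ := mem_powIdeal_succ.1 (H.mul_mem_of_mem_sat ha le_rfl hj hu)
  obtain ⟨k, hk⟩ := hu
  set b := Function.update a (j + 1) 1 with hb
  have hbk : b (j + 1) = 1 := by simp [hb]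
  have hbQ : powIdeal x b (Set.Iio j) = powIdeal x a (Set.Iio j) := powIdeal_congr x fun i hi => by
    simp only [Set.mem_Iio] at hi
    rw [hb, Function.update_of_ne (by omega)]
  have hb1 : ∀ i, 1 ≤ b i := fun i => by
    rw [hb, Function.update_apply]; split_ifs
    · exact le_rfl
    · exact ha i
  have hmem : ∀ c ∈ maximalIdeal R ^ k, c * (x j * v) ∈ powIdeal x b (insert (j + 1) (Set.Iio j)) := by
    intro c hc
    obtain ⟨w, q₁, hq₁, hw⟩ := mem_powIdeal_succ.1 (hk c hc)
    have h1 : x j ^ a j * (c * v - x (j + 1) * w) ∈ powIdeal x a (Set.Iio j) := by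
      have : x j ^ a j * (c * v - x (j + 1) * w) = x (j + 1) * q₁ - c * q₀ := by
        linear_combination x (j + 1) * hw - c * hv
      rw [this]
      exact sub_mem (Ideal.mul_mem_left _ _ hq₁) (Ideal.mul_mem_left _ _ hq₀)
    have h2 := H.colon_Iio ha le_rfl le_rfl (by omega) h1
    refine mem_powIdeal_insert.2 ⟨x j * w, _, hbQ ▸ h2, ?_⟩
    rw [hbk]; ring
  have h3 : x j * v ∈ powIdeal x b (insert (j + 1) (Set.Iio j)) := by
    refine H.colon _ b (by intro i hi; simp only [Set.mem_insert_iff, Set.mem_Iio] at *; omega)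
      hb1 j j le_rfl (by omega) (by simp) (by simp) (k + 1) _ ?_
    rw [pow_succ, mul_assoc]
    exact hmem _ (Ideal.pow_mem_pow (H.mem j (by omega)) k)
  obtain ⟨w', q₂, hq₂, hw'⟩ := mem_powIdeal_insert.1 h3
  rw [hbQ] at hq₂
  rw [hbk, pow_one] at hw'
  refine ⟨w', H.mem_sat_of_pow_mul_mem ha (Nat.le_succ j) hj (N := 1) ?_⟩
  have : x (j + 1) ^ 1 * (x j * u - x j ^ a j * w') = x j * q₀ + x j ^ a j * q₂ := by
    linear_combination x j * hv + x j ^ a j * hw'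
  rw [this]
  exact add_mem (Ideal.mul_mem_left _ _ hq₀) (Ideal.mul_mem_left _ _ hq₂)

theorem exists_sub_mem_sat [IsNoetherianRing R] {a : ℕ → ℕ} (ha : ∀ i, 1 ≤ a i) {j : ℕ}
    (hj : j + 1 < d) {u : R} (hu : u ∈ satIdeal (powIdeal x a (Set.Iio (j + 1)))) :
    ∃ w, u - x j ^ (a j - 1) * w ∈ satIdeal (powIdeal x a (Set.Iio j)) := by
  obtain ⟨w, hw⟩ := H.mul_mem_sat_sup ha hj hu
  refine ⟨w, H.mem_sat_of_pow_mul_mem_sat ha le_rfl (by omega) (N := 1) ?_⟩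
  obtain ⟨b, hb⟩ := Nat.exists_eq_add_of_le' (ha j)
  rw [hb] at hw ⊢
  convert hw using 1
  simp only [Nat.add_sub_cancel]
  ring

theorem sat_eq_top {a : ℕ → ℕ} : satIdeal (powIdeal x a (Set.Iio d)) = ⊤ := by
  obtain ⟨k, hk⟩ := H.primary a
  exact (Ideal.eq_top_iff_one _).2 ⟨k, fun c hc => by simpa using hk hc⟩

end IsColonSeq
end ParameterPowers

section SocleIdeal

section

variable {R : Type u} [CommRing R]

/-- The ideal generated by `x 0 ^ n, …, x (j - 1) ^ n`. -/
def cpow (x : ℕ → R) (n j : ℕ) : Ideal R := powIdeal x (fun _ => n) (Set.Iio j)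

variable (x : ℕ → R) (n : ℕ)

theorem cpow_mono {i j : ℕ} (h : i ≤ j) : cpow x n i ≤ cpow x n j :=
  powIdeal_mono x _ (Set.Iio_subset_Iio h)

theorem cpow_zero : cpow x n 0 = ⊥ := powIdeal_zero x _

theorem cpow_succ (j : ℕ) : cpow x n (j + 1) = cpow x n j ⊔ Ideal.span {x j ^ n} :=
  powIdeal_succ x _ j

theorem pow_mem_cpow {i j : ℕ} (h : i < j) : x i ^ n ∈ cpow x n j :=
  pow_mem_powIdeal x (fun _ => n) h

theorem cpow_le_iff {j : ℕ} {J : Ideal R} : cpow x n j ≤ J ↔ ∀ i < j, x i ^ n ∈ J := by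
  rw [cpow, powIdeal, Ideal.span_le, Set.image_subset_iff]
  rfl

variable {x n}

theorem mem_cpow_succ {j : ℕ} {u : R} :
    u ∈ cpow x n (j + 1) ↔ ∃ v, ∃ p ∈ cpow x n j, u = p + x j ^ n * v :=
  mem_powIdeal_succ

end

variable {R : Type u} [CommRing R] [IsLocalRing R]

namespace IsColonSeq

variable {d : ℕ} {x : ℕ → R} (H : IsColonSeq d x) {n : ℕ} (hn : 1 ≤ n)
include H

theorem sat_cpow_eq_top : satIdeal (cpow x n d) = ⊤ := H.sat_eq_top

include hn

theorem mul_mem_cpow {j l : ℕ} (hj : j ≤ l) (hl : l < d) {u : R}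
    (hu : u ∈ satIdeal (cpow x n j)) : x l * u ∈ cpow x n j :=
  H.mul_mem_of_mem_sat (fun _ => hn) hj hl hu

theorem mem_cpow_of_mem_sat {j : ℕ} (hj : j ≤ d) {u : R}
    (hu : u ∈ satIdeal (cpow x n j)) (hu' : u ∈ cpow x n d) : u ∈ cpow x n j :=
  H.mem_of_mem_sat_of_mem (fun _ => hn) hj hu hu'

variable [IsNoetherianRing R]

theorem mem_sat_cpow {j k : ℕ} (hjk : j ≤ k) (hk : k < d) {N : ℕ} {u : R}
    (hu : x k ^ N * u ∈ cpow x n j) : u ∈ satIdeal (cpow x n j) :=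
  H.mem_sat_of_pow_mul_mem (fun _ => hn) hjk hk hu

theorem mem_sat_cpow_of_sat {j k : ℕ} (hjk : j ≤ k) (hk : k < d) {N : ℕ} {u : R}
    (hu : x k ^ N * u ∈ satIdeal (cpow x n j)) : u ∈ satIdeal (cpow x n j) :=
  H.mem_sat_of_pow_mul_mem_sat (fun _ => hn) hjk hk hu

theorem exists_sub_mem_sat_cpow {j : ℕ} (hj : j + 1 < d) {u : R}
    (hu : u ∈ satIdeal (cpow x n (j + 1))) :
    ∃ w, u - x j ^ (n - 1) * w ∈ satIdeal (cpow x n j) :=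
  H.exists_sub_mem_sat (fun _ => hn) hj hu

end IsColonSeq

theorem mem_colonIdeal {q : Ideal R} {a : R} :
    a ∈ colonIdeal R q ↔ ∀ r ∈ maximalIdeal R, r * a ∈ q := Iff.rfl

theorem le_colonIdeal (q : Ideal R) : q ≤ colonIdeal R q :=
  fun _ ha _ _ => q.mul_mem_left _ ha

namespace IsColonSeq

variable [IsNoetherianRing R] {d : ℕ} {x : ℕ → R} (H : IsColonSeq d x) {n : ℕ} (hn : 2 ≤ n)
include H hn

theorem mem_colon_sup_sat {j : ℕ} (hj : j ≤ d) {c : R}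
    (hc : ∀ r ∈ maximalIdeal R, r * c ∈ cpow x n d ⊔
      satIdeal (cpow x n j)) :
    c ∈ colonIdeal R (cpow x n d) ⊔
      satIdeal (cpow x n j) := by
  have ha : 1 ≤ n := by omega
  revert c
  refine Nat.decreasingInduction' (P := fun j => ∀ {c : R},
    (∀ r ∈ maximalIdeal R, r * c ∈ cpow x n d ⊔
      satIdeal (cpow x n j)) →
    c ∈ colonIdeal R (cpow x n d) ⊔
      satIdeal (cpow x n j)) ?_ hj ?_
  · intro l hl hjl ih c hc
    set q := cpow x n d with hq
    have hmono : satIdeal (cpow x n l) ≤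
        satIdeal (cpow x n (l + 1)) :=
      satIdeal_mono (cpow_mono x n (Nat.le_succ l))
    obtain ⟨i, hi, c₀, hc₀, rfl⟩ := Submodule.mem_sup.1
      (ih (c := c) fun r hr => sup_le_sup_left hmono q (hc r hr))
    refine add_mem (Ideal.mem_sup_left hi) ?_
    have hc' : ∀ r ∈ maximalIdeal R, r * c₀ ∈ q ⊔
        satIdeal (cpow x n l) := fun r hr => by
      have := sub_mem (hc r hr) (Ideal.mem_sup_left (mem_colonIdeal.1 hi r hr))
      rwa [mul_add, add_sub_cancel_left] at this
    have hw : ∃ w, c₀ - x l ^ (n - 1) * w ∈ satIdeal (cpow x n l) := by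
      rcases Nat.lt_or_ge (l + 1) d with hld | hld
      · exact H.exists_sub_mem_sat_cpow ha hld hc₀
      · obtain rfl : d = l + 1 := by omega
        have := hc' _ (H.mem l (by omega))
        rw [hq, cpow_succ] at this
        obtain ⟨y, hy, s, hs, hys⟩ := Submodule.mem_sup.1 this
        obtain ⟨p, hp, z, hz, rfl⟩ := Submodule.mem_sup.1 hy
        obtain ⟨w, rfl⟩ := Ideal.mem_span_singleton.1 hz
        refine ⟨w, H.mem_sat_cpow_of_sat ha le_rfl (by omega) (N := 1) ?_⟩
        have : x l ^ 1 * (c₀ - x l ^ (n - 1) * w) = p + s := by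
          obtain ⟨b, rfl⟩ := Nat.exists_eq_add_of_le' (show 1 ≤ n by omega)
          simp only [Nat.add_sub_cancel]
          linear_combination -hys
        rw [this]
        exact add_mem (le_satIdeal _ hp) hs
    obtain ⟨w, hw⟩ := hw
    have hsplit : c₀ = x l ^ (n - 1) * w + (c₀ - x l ^ (n - 1) * w) := by ring
    rw [hsplit]
    refine add_mem (Ideal.mem_sup_left ?_) (Ideal.mem_sup_right hw)
    intro r hr
    have h1 : r * (x l ^ (n - 1) * w) ∈ q ⊔ satIdeal (cpow x n l) := by
      have := sub_mem (hc' r hr) (Ideal.mem_sup_right (Ideal.mul_mem_left _ r hw))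
      convert this using 1
      ring
    obtain ⟨p, hp, s, hs, hps⟩ := Submodule.mem_sup.1 h1
    set b := Function.update (fun _ : ℕ => n) l (n - 1) with hb
    have hb1 : ∀ i, 1 ≤ b i := fun i => by
      rw [hb, Function.update_apply]; split_ifs <;> omega
    have hbQ : powIdeal x b (Set.Iio l) = cpow x n l :=
      powIdeal_congr x fun i hi => by
        simp only [Set.mem_Iio] at hi
        rw [hb, Function.update_of_ne (by omega)]
    have hqb : q ≤ powIdeal x b (Set.Iio d) := by
      refine Ideal.span_le.2 ?_
      rintro _ ⟨i, hi, rfl⟩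
      change x i ^ n ∈ _
      refine Ideal.mem_of_dvd _ (pow_dvd_pow (x i) ?_) (pow_mem_powIdeal x b hi)
      rw [hb, Function.update_apply]; split_ifs <;> omega
    have hs' : s ∈ powIdeal x b (Set.Iio d) := by
      have : s = r * w * x l ^ b l - p := by
        rw [hb, Function.update_self]; linear_combination hps
      rw [this]
      exact sub_mem (Ideal.mul_mem_left _ _ (pow_mem_powIdeal x b (by simpa using hl))) (hqb hp)
    have hs'' := H.mem_of_mem_sat_of_mem hb1 hl.le (hbQ.symm ▸ hs) hs'
    rw [hbQ] at hs''
    rw [smul_eq_mul, ← hps]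
    exact add_mem hp (cpow_mono x n hl.le hs'')
  · intro c _
    rw [H.sat_cpow_eq_top]
    simp

theorem mem_colon_mul {j : ℕ} (hj : j ≤ d) {w : R} (hw : w ∈ cpow x n j)
    (hmw : ∀ r ∈ maximalIdeal R, r * w ∈ cpow x n d *
      cpow x n j) :
    w ∈ colonIdeal R (cpow x n d) *
      cpow x n j := by
  have ha : 1 ≤ n := by omega
  induction j generalizing w with
  | zero =>
    rw [cpow_zero] at hw ⊢
    simpa using hw
  | succ j ih =>
    set q := cpow x n d with hq
    set Q := cpow x n j with hQ
    obtain ⟨c, w₀, hw₀, rfl⟩ := mem_cpow_succ.1 hw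
    have hdec : ∀ r ∈ maximalIdeal R, ∃ γ ∈ q, ∃ g ∈ q * Q,
        r * (w₀ + x j ^ n * c) = g + x j ^ n * γ := by
      intro r hr
      have := hmw r hr
      rw [cpow_succ, Ideal.mul_sup] at this
      obtain ⟨g, hg, z, hz, hgz⟩ := Submodule.mem_sup.1 this
      obtain ⟨γ, hγ, rfl⟩ := Ideal.mem_mul_span_singleton.1 hz
      exact ⟨γ, hγ, g, hg, by rw [← hgz]; ring⟩
    have hc : ∀ r ∈ maximalIdeal R, r * c ∈ q ⊔ satIdeal Q := by
      intro r hr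
      obtain ⟨γ, hγ, g, hg, hrg⟩ := hdec r hr
      have h1 : r * c - γ ∈ satIdeal Q := by
        refine H.mem_sat_cpow ha le_rfl (by omega : j < d) (N := n) ?_
        have : x j ^ n * (r * c - γ) = g - r * w₀ := by linear_combination hrg
        rw [this]
        exact sub_mem (Ideal.mul_le_right hg) (Ideal.mul_mem_left _ _ hw₀)
      rw [show r * c = γ + (r * c - γ) by ring]
      exact add_mem (Ideal.mem_sup_left hγ) (Ideal.mem_sup_right h1)
    obtain ⟨i, hi, s, hs, rfl⟩ := Submodule.mem_sup.1 (H.mem_colon_sup_sat hn (by omega) hc)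
    have hys : x j ^ n * s ∈ Q := by
      obtain ⟨b, hb⟩ := Nat.exists_eq_add_of_le' (show 1 ≤ n by omega)
      rw [hb, pow_succ, mul_assoc]
      exact Ideal.mul_mem_left _ _ (H.mul_mem_cpow ha le_rfl (by omega) hs)
    have hmain : w₀ + x j ^ n * s ∈ colonIdeal R q * Q := by
      refine ih (by omega) (add_mem hw₀ hys) fun r hr => ?_
      obtain ⟨γ, hγ, g, hg, hrg⟩ := hdec r hr
      set γ' := γ - r * i with hγ'
      have hγq : γ' ∈ q := sub_mem hγ (hi r hr)
      have heq : r * (w₀ + x j ^ n * s) = g + x j ^ n * γ' := by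
        rw [hγ']; linear_combination hrg
      have hγQ : x j ^ n * γ' ∈ Q := by
        have : x j ^ n * γ' = r * (w₀ + x j ^ n * s) - g := by rw [heq]; ring
        rw [this]
        exact sub_mem (Ideal.mul_mem_left _ _ (add_mem hw₀ hys)) (Ideal.mul_le_right hg)
      have h2 : γ' ∈ Q := H.mem_cpow_of_mem_sat ha (by omega)
        (H.mem_sat_cpow ha le_rfl (by omega) hγQ) hγq
      rw [heq]
      exact add_mem hg (Ideal.mul_mem_mul (pow_mem_cpow x n (by omega)) h2)
    rw [cpow_succ, Ideal.mul_sup]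
    have : w₀ + x j ^ n * (i + s) = (w₀ + x j ^ n * s) + i * x j ^ n := by ring
    rw [this]
    exact add_mem (Ideal.mem_sup_left hmain) (Ideal.mem_sup_right
      (Ideal.mul_mem_mul hi (Ideal.mem_span_singleton_self _)))

theorem mem_mul_pow_mul_colon {k : ℕ} : ∀ {j : ℕ}, j ≤ d → ∀ {u : R},
    u ∈ cpow x n d ^ (k + 1) *
      colonIdeal R (cpow x n d) →
    u ∈ cpow x n j →
    u ∈ cpow x n j * (cpow x n d ^ k *
      colonIdeal R (cpow x n d)) := by
  have ha : 1 ≤ n := by omega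
  set q := cpow x n d with hq
  set I := colonIdeal R q with hI
  induction k with
  | zero =>
    intro j hj
    refine Nat.decreasingInduction' (P := fun j => ∀ {u : R}, u ∈ q ^ (0 + 1) * I →
      u ∈ cpow x n j →
      u ∈ cpow x n j * (q ^ 0 * I)) ?_ hj ?_
    · intro l hl hjl ih u hu hul
      have h1 := ih hu (cpow_mono x n (Nat.le_succ l) hul)
      rw [cpow_succ, Ideal.sup_mul] at h1
      obtain ⟨w, hw, z, hz, rfl⟩ := Submodule.mem_sup.1 h1
      obtain ⟨v, hv, rfl⟩ := Ideal.mem_span_singleton_mul.1 hz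
      refine add_mem hw ?_
      have hxv : x l ^ n * v ∈ cpow x n l := by
        simpa using sub_mem hul (Ideal.mul_le_left hw)
      have hvs := H.mem_sat_cpow ha le_rfl hl hxv
      have := H.mem_colon_mul hn hl.le hxv fun r hr => by
        have hrv : r * v ∈ cpow x n l :=
          H.mem_cpow_of_mem_sat ha hl.le (Ideal.mul_mem_left _ r hvs)
            (by simp only [pow_zero, Ideal.one_eq_top, Ideal.top_mul] at hv; exact hv r hr)
        rw [mul_left_comm]
        exact Ideal.mul_mem_mul (pow_mem_cpow x n hl) hrv
      rwa [pow_zero, Ideal.one_eq_top, Ideal.top_mul, mul_comm]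
    · intro u hu _
      simpa using hu
  | succ k ihk =>
    intro j hj
    refine Nat.decreasingInduction' (P := fun j => ∀ {u : R}, u ∈ q ^ (k + 1 + 1) * I →
      u ∈ cpow x n j →
      u ∈ cpow x n j * (q ^ (k + 1) * I)) ?_ hj ?_
    · intro l hl hjl ih u hu hul
      have h1 := ih hu (cpow_mono x n (Nat.le_succ l) hul)
      rw [cpow_succ, Ideal.sup_mul] at h1
      obtain ⟨w, hw, z, hz, rfl⟩ := Submodule.mem_sup.1 h1
      obtain ⟨v, hv, rfl⟩ := Ideal.mem_span_singleton_mul.1 hz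
      refine add_mem hw ?_
      have hxv : x l ^ n * v ∈ cpow x n l := by
        simpa using sub_mem hul (Ideal.mul_le_left hw)
      have hvs := H.mem_sat_cpow ha le_rfl hl hxv
      have hvq : v ∈ q := by
        rw [pow_succ, mul_assoc] at hv
        exact Ideal.mul_le_left (Ideal.mul_le_right hv)
      have hv' := ihk hl.le hv (H.mem_cpow_of_mem_sat ha hl.le hvs hvq)
      rw [pow_succ', mul_assoc, mul_left_comm]
      exact Ideal.mul_mem_mul (pow_mem_cpow x n hl) hv'
    · intro u hu _
      rwa [pow_succ', mul_assoc] at hu 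

end IsColonSeq
end SocleIdeal

section MulColon

variable {R : Type u} [CommRing R]

theorem exists_sum_of_mem_cpow {x : ℕ → R} {n j : ℕ} {u : R} (hu : u ∈ cpow x n j) :
    ∃ α : ℕ → R, ∑ i ∈ Finset.range j, α i * x i ^ n = u := by
  induction j generalizing u with
  | zero => exact ⟨0, by simpa [cpow_zero, eq_comm] using hu⟩
  | succ j ih =>
    obtain ⟨v, p, hp, rfl⟩ := mem_cpow_succ.1 hu
    obtain ⟨α, rfl⟩ := ih hp
    refine ⟨Function.update α j v, ?_⟩
    rw [Finset.sum_range_succ, Function.update_self, mul_comm v]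
    congr 1
    refine Finset.sum_congr rfl fun i hi => ?_
    rw [Function.update_of_ne (Finset.mem_range.1 hi).ne]

variable [IsLocalRing R] [IsNoetherianRing R]

theorem exists_mem_sq_of_mul_mem_pow {y : R} (hy : ∀ u, y * u = 0 → u = 0) :
    ∃ n₀, ∀ n ≥ n₀, ∀ c, c * y ∈ maximalIdeal R ^ n → c ∈ maximalIdeal R ^ 2 := by
  obtain ⟨k, hk⟩ := Ideal.exists_pow_inf_eq_pow_smul (M := R) (maximalIdeal R) (Ideal.span {y})
  refine ⟨k + 2, fun n hn c hc => ?_⟩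
  have h1 : c * y ∈ maximalIdeal R ^ n • (⊤ : Ideal R) ⊓ Ideal.span {y} :=
    ⟨by simpa using hc, Ideal.mul_mem_left _ _ (Ideal.mem_span_singleton_self y)⟩
  rw [hk n (by omega)] at h1
  have h2 : maximalIdeal R ^ (n - k) • (maximalIdeal R ^ k • (⊤ : Ideal R) ⊓ Ideal.span {y}) ≤
      maximalIdeal R ^ 2 * Ideal.span {y} :=
    Ideal.mul_mono (Ideal.pow_le_pow_right (by omega)) inf_le_right
  obtain ⟨e, he, hec⟩ := Ideal.mem_mul_span_singleton.1 (h2 h1)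
  have : c - e = 0 := hy _ (by linear_combination -hec)
  rwa [sub_eq_zero.1 this]

theorem ringKrullDim_le_one_of_maximalIdeal_le {r : R} (hr : r ∈ maximalIdeal R)
    (h : maximalIdeal R ≤ Ideal.span {r} ⊔ maximalIdeal R ^ 2) : ringKrullDim R ≤ 1 := by
  have h1 : maximalIdeal R ≤ Ideal.span {r} :=
    Submodule.le_of_le_smul_of_le_jacobson_bot (I := maximalIdeal R)
      ((isNoetherianRing_iff_ideal_fg R).1 inferInstance _)
      (IsLocalRing.jacobson_eq_maximalIdeal ⊥ bot_ne_top).ge (by simpa [pow_two] using h)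
  have h2 : maximalIdeal R = Ideal.span {r} :=
    le_antisymm h1 ((Ideal.span_singleton_le_iff_mem _).2 hr)
  rw [← IsLocalRing.maximalIdeal_height_eq_ringKrullDim]
  have : (maximalIdeal R).IsPrincipal := ⟨r, h2⟩
  exact_mod_cast Ideal.height_le_one_of_isPrincipal_of_mem_minimalPrimes (maximalIdeal R)
    (maximalIdeal R) (by rw [Ideal.minimalPrimes_eq_subsingleton_self]; rfl)

namespace IsColonSeq

variable {d : ℕ} {x : ℕ → R} (H : IsColonSeq d x)
include H

theorem exists_colon_mul_le (hd : 2 ≤ d) (hdim : ringKrullDim R = d) :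
    ∃ n₀, ∀ n ≥ n₀, ∀ r ∈ maximalIdeal R, ∀ a ∈ colonIdeal R (cpow x n d),
      r * a ∈ maximalIdeal R * cpow x n d := by
  have h1 : ∀ l, ∃ n₀, l < d → ∀ n ≥ n₀, ∀ c, c * x l ∈ maximalIdeal R ^ n →
      c ∈ maximalIdeal R ^ 2 := fun l => by
    by_cases hl : l < d
    · obtain ⟨n₀, hn₀⟩ := exists_mem_sq_of_mul_mem_pow (H.nzd l hl)
      exact ⟨n₀, fun _ => hn₀⟩
    · exact ⟨0, fun h => absurd h hl⟩
  choose f hf using h1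
  refine ⟨(Finset.range d).sup f + 1, fun n hn r hr a ha => ?_⟩
  have hra : r * a ∈ cpow x n d := ha r hr
  obtain ⟨α, hα⟩ := exists_sum_of_mem_cpow hra
  by_cases hall : ∀ i ∈ Finset.range d, α i ∈ maximalIdeal R
  · rw [← hα]
    exact sum_mem fun i hi => Ideal.mul_mem_mul (hall i hi) (pow_mem_cpow x n (by simpa using hi))
  exfalso
  push Not at hall
  obtain ⟨l, hl, hαl⟩ := hall
  have hld : l < d := by simpa using hl
  obtain ⟨β, hβ⟩ := (IsLocalRing.notMem_maximalIdeal.1 hαl).exists_left_inv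
  set Q := powIdeal x (fun _ => n) (Set.Iio d \ {l}) with hQ
  have hsum : ∑ i ∈ (Finset.range d).erase l, α i * x i ^ n ∈ Q :=
    sum_mem fun i hi => Ideal.mul_mem_left _ _ (pow_mem_powIdeal x (fun _ => n) (by
      simp only [Finset.mem_erase, Finset.mem_range] at hi
      simp [hi.1, hi.2]))
  rw [← Finset.add_sum_erase _ _ hl] at hα
  have hxl : ∃ p ∈ Q, x l ^ n = β * (r * a) + p := by
    refine ⟨-β * _, Ideal.mul_mem_left _ _ hsum, ?_⟩
    linear_combination (- x l ^ n) * hβ + β * hα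
  obtain ⟨p, hp, hxp⟩ := hxl
  have hQle : Q ≤ maximalIdeal R ^ n := by
    refine Ideal.span_le.2 ?_
    rintro _ ⟨i, hi, rfl⟩
    exact Ideal.pow_mem_pow (H.mem i hi.1) n
  have hkill : ∀ b, b * a ∈ Q → b ∈ maximalIdeal R ^ 2 := by
    intro b hb
    refine hf l hld n ?_ b (hQle ?_)
    · exact (Finset.le_sup (f := f) (Finset.mem_range.2 hld)).trans (by omega)
    · rw [mul_comm]
      refine H.colon _ (fun _ => n) Set.sdiff_subset (fun _ => by omega) l l le_rfl hld
        (by simp) (by simp) n b ?_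
      have : x l ^ n * b = β * r * (b * a) + b * p := by rw [hxp]; ring
      rw [this]
      exact add_mem (Ideal.mul_mem_left _ _ hb) (Ideal.mul_mem_left _ _ hp)
  have hle : maximalIdeal R ≤ Ideal.span {r} ⊔ maximalIdeal R ^ 2 := by
    intro c hc
    have hca := ha c hc
    have h2 : ∃ s, ∃ p ∈ Q, c * a = p + x l ^ n * s := by
      have : Set.Iio d = insert l (Set.Iio d \ {l}) := by
        rw [Set.insert_sdiff_singleton, Set.insert_eq_of_mem (by simpa using hld)]
      rw [smul_eq_mul, cpow, this] at hca
      obtain ⟨v, p, hp, h⟩ := mem_powIdeal_insert.1 hca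
      exact ⟨v, p, hp, h⟩
    obtain ⟨s, p', hp', hcs⟩ := h2
    have h3 : c - s * β * r ∈ maximalIdeal R ^ 2 := by
      refine hkill _ ?_
      have : (c - s * β * r) * a = p' + s * p := by linear_combination hcs + s * hxp
      rw [this]
      exact add_mem hp' (Ideal.mul_mem_left _ _ hp)
    have : c = s * β * r + (c - s * β * r) := by ring
    rw [this]
    exact add_mem (Ideal.mem_sup_left (Ideal.mul_mem_left _ _ (Ideal.mem_span_singleton_self r)))
      (Ideal.mem_sup_right h3)
  have := ringKrullDim_le_one_of_maximalIdeal_le hr hle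
  rw [hdim] at this
  have : (d : WithBot ℕ∞) ≤ (1 : ℕ) := by exact_mod_cast this
  have : d ≤ 1 := by exact_mod_cast this
  omega

theorem colonIdeal_le_maximalIdeal {n : ℕ} (hn : 2 ≤ n) (hd : 1 ≤ d) :
    colonIdeal R (cpow x n d) ≤ maximalIdeal R := by
  intro a ha
  by_contra hau
  obtain ⟨b, hb⟩ := (IsLocalRing.notMem_maximalIdeal.1 hau).exists_left_inv
  have h1 : maximalIdeal R ≤ maximalIdeal R ^ 2 := by
    intro r hr
    have : cpow x n d ≤ maximalIdeal R ^ 2 := (cpow_le_iff x n).2 fun i hi =>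
      Ideal.pow_le_pow_right hn (Ideal.pow_mem_pow (H.mem i hi) n)
    have h2 := this (Ideal.mul_mem_left _ b (ha r hr))
    rwa [smul_eq_mul, mul_left_comm, hb, mul_one] at h2
  have h2 : maximalIdeal R ≤ ⊥ :=
    Submodule.le_of_le_smul_of_le_jacobson_bot (I := maximalIdeal R)
      ((isNoetherianRing_iff_ideal_fg R).1 inferInstance _)
      (IsLocalRing.jacobson_eq_maximalIdeal ⊥ bot_ne_top).ge (by simpa [pow_two] using h1)
  have h3 := H.nzd 0 hd 1 (by simpa using h2 (H.mem 0 hd))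
  exact one_ne_zero h3

theorem colon_sq {n : ℕ} (hn : 2 ≤ n) (hI : colonIdeal R (cpow x n d) ≤ maximalIdeal R)
    (hM : ∀ r ∈ maximalIdeal R, ∀ a ∈ colonIdeal R (cpow x n d),
      r * a ∈ maximalIdeal R * cpow x n d) :
    colonIdeal R (cpow x n d) * colonIdeal R (cpow x n d) =
      cpow x n d * colonIdeal R (cpow x n d) := by
  refine le_antisymm (Ideal.mul_le.2 fun a ha b hb => ?_)
    (Ideal.mul_mono_left (le_colonIdeal _))
  rw [mul_comm (cpow x n d)]
  refine H.mem_colon_mul hn le_rfl (hb a (hI ha)) fun r hr => ?_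
  have h1 : maximalIdeal R * cpow x n d * Ideal.span {b} ≤ cpow x n d * cpow x n d := by
    rw [mul_right_comm]
    refine Ideal.mul_mono_left (Ideal.mul_le.2 fun c hc e he => ?_)
    obtain ⟨f, rfl⟩ := Ideal.mem_span_singleton.1 he
    rw [← mul_assoc]
    exact Ideal.mul_mem_right _ _ (hb c hc)
  rw [← mul_assoc]
  exact h1 (Ideal.mul_mem_mul (hM r hr a ha) (Ideal.mem_span_singleton_self b))

omit H [IsNoetherianRing R] in
theorem colon_pow {n : ℕ} (hI : colonIdeal R (cpow x n d) * colonIdeal R (cpow x n d) =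
    cpow x n d * colonIdeal R (cpow x n d)) (k : ℕ) :
    colonIdeal R (cpow x n d) ^ (k + 1) = cpow x n d ^ k * colonIdeal R (cpow x n d) := by
  induction k with
  | zero => simp
  | succ k ih => rw [pow_succ, ih, mul_assoc, hI, pow_succ, mul_assoc]

end IsColonSeq
end MulColon

section RelativeLength

theorem moduleLength_eq_length (R : Type u) [CommRing R] (M : Type u) [AddCommGroup M]
    [Module R M] : moduleLength R M = (Module.length R M : WithBot ℕ∞) :=
  (Module.coe_length R M).symm

variable {R : Type u} [CommRing R]

/-- The length of `(J + K) / J`. -/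
noncomputable def relLength (J K : Ideal R) : ℕ∞ := Module.length R ↥(Submodule.map J.mkQ K)

theorem relLength_eq_quotient (J K : Ideal R) :
    relLength J K = Module.length R (K ⧸ Submodule.comap K.subtype J) := by
  have h : LinearMap.ker (J.mkQ.comp K.subtype) = Submodule.comap K.subtype J := by
    rw [LinearMap.ker_comp, Submodule.ker_mkQ]
  have h' : LinearMap.range (J.mkQ.comp K.subtype) = Submodule.map J.mkQ K := by
    rw [LinearMap.range_comp, Submodule.range_subtype]
  rw [relLength, ← h, ← h']
  exact (LinearMap.quotKerEquivRange _).length_eq.symm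

theorem relLength_congr {J J' K : Ideal R} (h : J ⊓ K = J' ⊓ K) :
    relLength J K = relLength J' K := by
  rw [relLength_eq_quotient, relLength_eq_quotient]
  have : Submodule.comap K.subtype J = Submodule.comap K.subtype J' := by
    ext u
    have := SetLike.ext_iff.1 h (u : R)
    simpa [Submodule.mem_inf] using this
  rw [this]

theorem relLength_sup_left {J K L : Ideal R} (h : L ≤ J) : relLength J (L ⊔ K) = relLength J K := by
  have : Submodule.map J.mkQ L = ⊥ := by
    rw [eq_bot_iff, Submodule.map_le_iff_le_comap, Submodule.comap_bot, Submodule.ker_mkQ]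
    exact h
  rw [relLength, relLength, Submodule.map_sup, this, bot_sup_eq]

theorem length_quotient_eq_add {J K : Ideal R} (h : J ≤ K) :
    Module.length R (R ⧸ J) = relLength J K + Module.length R (R ⧸ K) := by
  refine Module.length_eq_add_of_exact (Submodule.map J.mkQ K).subtype (Submodule.factor h)
    (Submodule.subtype_injective _) (Submodule.factor_surjective h) ?_
  rw [LinearMap.exact_iff, Submodule.range_subtype]
  exact Submodule.ker_mapQ _ _ _ _

theorem relLength_add {J K L : Ideal R} (hJK : J ≤ K) (hKL : K ≤ L) :
    relLength J L = relLength J K + relLength K L := by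
  have hmap : ∀ u ∈ Submodule.map J.mkQ L, Submodule.factor hJK u ∈ Submodule.map K.mkQ L := by
    rintro _ ⟨u, hu, rfl⟩
    exact ⟨u, hu, rfl⟩
  refine Module.length_eq_add_of_exact
    (Submodule.inclusion (Submodule.map_mono hKL))
    ((Submodule.factor hJK).restrict hmap) (Submodule.inclusion_injective _) ?_ ?_
  · rintro ⟨_, u, hu, rfl⟩
    exact ⟨⟨_, u, hu, rfl⟩, rfl⟩
  · rintro ⟨_, u, hu, rfl⟩
    constructor
    · intro h
      have : u ∈ K := by
        rw [← Submodule.Quotient.mk_eq_zero]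
        exact congrArg Subtype.val h
      exact ⟨⟨_, u, this, rfl⟩, rfl⟩
    · rintro ⟨⟨_, v, hv, rfl⟩, h⟩
      have h1 : J.mkQ v = J.mkQ u := congrArg Subtype.val h
      refine Subtype.ext ?_
      change K.mkQ u = 0
      have h2 : u - v ∈ J := (Submodule.Quotient.eq J).1 h1.symm
      have : u ∈ K := by simpa using K.add_mem (hJK h2) hv
      exact (Submodule.Quotient.mk_eq_zero K).2 this

theorem relLength_anti {J J' K : Ideal R} (h : J ≤ J') : relLength J' K ≤ relLength J K := by
  rw [relLength_eq_quotient, relLength_eq_quotient]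
  exact Module.length_le_of_surjective (Submodule.factor (Submodule.comap_mono h))
    (Submodule.factor_surjective _)

theorem length_quotient_eq_colon_add (J : Ideal R) (y : R) :
    Module.length R (R ⧸ J) =
      Module.length R (R ⧸ Submodule.comap (LinearMap.mulLeft R y) J) +
      Module.length R (R ⧸ (J ⊔ Ideal.span {y})) := by
  rw [length_quotient_eq_add (le_sup_left : J ≤ J ⊔ Ideal.span {y})]
  congr 1
  have h : LinearMap.ker (J.mkQ.comp (LinearMap.mulLeft R y)) =
      Submodule.comap (LinearMap.mulLeft R y) J := by
    rw [LinearMap.ker_comp, Submodule.ker_mkQ]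
  have h' : LinearMap.range (J.mkQ.comp (LinearMap.mulLeft R y)) =
      Submodule.map J.mkQ (J ⊔ Ideal.span {y}) := by
    rw [LinearMap.range_comp, Submodule.map_sup, J.mkQ_map_self, bot_sup_eq]
    congr 1
    ext z
    simp only [LinearMap.mem_range, LinearMap.mulLeft_apply, Ideal.mem_span_singleton', mul_comm]
  rw [relLength, ← h, ← h']
  exact (LinearMap.quotKerEquivRange _).length_eq.symm

variable [IsLocalRing R]

theorem length_quotient_ne_top [IsNoetherianRing R] {J : Ideal R} {k : ℕ}
    (h : maximalIdeal R ^ k ≤ J) : Module.length R (R ⧸ J) ≠ ⊤ := by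
  by_cases hJ : J = ⊤
  · have : Subsingleton (R ⧸ J) := by rw [hJ]; infer_instance
    simp [Module.length_eq_zero]
  have : Nontrivial (R ⧸ J) := Ideal.Quotient.nontrivial_iff.2 hJ
  have : IsLocalRing (R ⧸ J) := .of_surjective' _ Ideal.Quotient.mk_surjective
  have : IsArtinianRing (R ⧸ J) := by
    rw [isArtinianRing_iff_isNilpotent_maximalIdeal]
    have h1 : maximalIdeal (R ⧸ J) ≤ (maximalIdeal R).map (Ideal.Quotient.mk J) := by
      intro a ha
      obtain ⟨a, rfl⟩ := Ideal.Quotient.mk_surjective a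
      refine Ideal.mem_map_of_mem _ fun hu => ha ?_
      exact hu.map (Ideal.Quotient.mk J)
    refine ⟨k, le_bot_iff.1 ((Ideal.pow_right_mono h1 k).trans ?_)⟩
    rw [← Ideal.map_pow, Ideal.map_le_iff_le_comap, ← RingHom.ker, Ideal.mk_ker]
    exact h
  rw [Module.length_ne_top_iff, isFiniteLength_iff_isNoetherian_isArtinian]
  exact ⟨inferInstance, isArtinian_of_surjective_algebraMap
    (Ideal.Quotient.mk_surjective (I := J))⟩

/-- A module of length at most `h` is killed by `m ^ h`. -/
theorem pow_smul_eq_zero_of_length_le {h : ℕ} {M : Type*} [AddCommGroup M] [Module R M]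
    (hM : Module.length R M ≤ h) : ∀ c ∈ maximalIdeal R ^ h, ∀ y : M, c • y = 0 := by
  induction h generalizing M with
  | zero =>
    intro c _ y
    have : Subsingleton M := Module.length_eq_zero_iff.1 (le_antisymm (by simpa using hM) bot_le)
    exact Subsingleton.elim _ _
  | succ h ih =>
    have hfl : IsFiniteLength R M := Module.length_ne_top_iff.1 (ne_top_of_le_ne_top (by simp) hM)
    obtain ⟨_, _⟩ := isFiniteLength_iff_isNoetherian_isArtinian.1 hfl
    by_cases hN : maximalIdeal R • (⊤ : Submodule R M) = ⊤
    · have : (⊤ : Submodule R M) ≤ ⊥ := Submodule.le_of_le_smul_of_le_jacobson_bot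
        (I := maximalIdeal R) (IsNoetherian.noetherian _)
        (IsLocalRing.jacobson_eq_maximalIdeal ⊥ bot_ne_top).ge (by rw [hN]; simp)
      intro c _ y
      have := this (Submodule.mem_top : c • y ∈ ⊤)
      simpa using this
    · have hlt : Module.length R ↥(maximalIdeal R • (⊤ : Submodule R M)) < h + 1 :=
        lt_of_lt_of_le (Submodule.length_lt hN) (by exact_mod_cast hM)
      have hle := Order.le_of_lt_add_one hlt
      intro c hc y
      rw [pow_succ] at hc
      induction hc using Submodule.mul_induction_on' with
      | mem_mul_mem a ha b hb =>
        have := ih hle a ha ⟨b • y, Submodule.smul_mem_smul hb trivial⟩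
        rw [mul_smul]
        exact congrArg Subtype.val this
      | add a _ b _ ha hb => rw [add_smul, ha, hb, add_zero]

end RelativeLength

/-- A sequence of functions whose iterated differences are constant is given by the
polynomials of Hilbert type, with control on the second coefficient. -/
theorem exists_hilbert_coefficients (d : ℕ) (hd : 2 ≤ d) (G : ℕ → ℕ → ℤ) (h : ℕ → ℤ) (l ν : ℤ)
    (h0 : ∀ k, 1 ≤ k → G 0 k = l)
    (h1 : G 1 1 = 2 * l - h 1 - ν)
    (hrec : ∀ D k, D < d → 1 ≤ k → G (D + 1) (k + 1) = G D (k + 1) + G (D + 1) k - h (D + 1)) :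
    ∃ e : ℕ → ℤ, e 1 = ν - h 1 + h 2 ∧ ∀ k, 1 ≤ k →
      G d k = ∑ i ∈ Finset.range (d + 1), (-1) ^ i * e i * ((k + d - i).choose (d - i) : ℤ) := by
  have key : ∀ D, D + 1 ≤ d → ∃ e : ℕ → ℤ, (e 1 = if D = 0 then ν - h 1 else ν - h 1 + h 2) ∧
      ∀ k, 1 ≤ k → G (D + 1) k = ∑ i ∈ Finset.range (D + 1 + 1),
        (-1) ^ i * e i * ((k + (D + 1) - i).choose (D + 1 - i) : ℤ) := by
    intro D
    induction D with
    | zero =>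
      intro _
      refine ⟨fun i => if i = 0 then l - h 1 else ν - h 1, by simp, fun k hk => ?_⟩
      induction k, hk using Nat.le_induction with
      | base => simp [Finset.sum_range_succ, h1]; ring
      | succ k hk ih =>
        rw [hrec 0 k (by omega) hk, h0 _ (by omega), ih]
        simp [Finset.sum_range_succ]
        ring
    | succ D ih =>
      intro hD
      obtain ⟨e, he1, he⟩ := ih (by omega)
      set e' : ℕ → ℤ := fun i => if i = D + 1 then e i - (-1) ^ (D + 1) * h (D + 2) else e i with he'
      set c := G (D + 2) 1 - ∑ i ∈ Finset.range (D + 2),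
        (-1) ^ i * e' i * ((1 + (D + 2) - i).choose (D + 2 - i) : ℤ) with hc
      set e'' : ℕ → ℤ := fun i => if i = D + 2 then (-1) ^ (D + 2) * c else e' i with he''
      have hlast : ∀ k : ℕ, ∑ i ∈ Finset.range (D + 2 + 1),
          (-1) ^ i * e'' i * ((k + (D + 2) - i).choose (D + 2 - i) : ℤ) =
          ∑ i ∈ Finset.range (D + 2),
            (-1) ^ i * e' i * ((k + (D + 2) - i).choose (D + 2 - i) : ℤ) + c := by
        intro k
        rw [Finset.sum_range_succ]
        congr 1
        · refine Finset.sum_congr rfl fun i hi => ?_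
          have : i ≠ D + 2 := (Finset.mem_range.1 hi).ne
          simp [he'', this]
        · simp only [he'', if_true, Nat.sub_self, Nat.choose_zero_right, Nat.cast_one, mul_one]
          rw [← mul_assoc, ← pow_add, Even.neg_one_pow ⟨_, rfl⟩, one_mul]
      have hpascal : ∀ k : ℕ, ∑ i ∈ Finset.range (D + 2),
            (-1) ^ i * e' i * ((k + 1 + (D + 2) - i).choose (D + 2 - i) : ℤ) =
          ∑ i ∈ Finset.range (D + 2),
            (-1) ^ i * e' i * ((k + 1 + (D + 1) - i).choose (D + 1 - i) : ℤ) +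
          ∑ i ∈ Finset.range (D + 2),
            (-1) ^ i * e' i * ((k + (D + 2) - i).choose (D + 2 - i) : ℤ) := by
        intro k
        rw [← Finset.sum_add_distrib]
        refine Finset.sum_congr rfl fun i hi => ?_
        have hi := Finset.mem_range.1 hi
        obtain ⟨f, hf⟩ := Nat.exists_eq_add_of_le (Nat.le_of_lt_succ hi)
        rw [show k + 1 + (D + 2) - i = k + f + 1 + 1 by omega, show D + 2 - i = f + 1 by omega,
          show k + 1 + (D + 1) - i = k + f + 1 by omega, show D + 1 - i = f by omega,
          show k + (D + 2) - i = k + f + 1 by omega, Nat.choose_succ_succ]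
        push_cast
        ring
      have hG : ∀ k : ℕ, 1 ≤ k → ∑ i ∈ Finset.range (D + 2),
            (-1) ^ i * e' i * ((k + (D + 1) - i).choose (D + 1 - i) : ℤ) =
          G (D + 1) k - h (D + 2) := by
        intro k hk
        rw [he k hk, Finset.sum_range_succ _ (D + 1), Finset.sum_range_succ _ (D + 1), add_sub_assoc]
        congr 1
        · refine Finset.sum_congr rfl fun i hi => ?_
          have : i ≠ D + 1 := (Finset.mem_range.1 hi).ne
          simp [he', this]
        · simp only [he', if_true, Nat.sub_self, Nat.choose_zero_right, Nat.cast_one, mul_one]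
          rw [mul_sub, ← mul_assoc, ← pow_add, Even.neg_one_pow ⟨_, rfl⟩, one_mul]
      refine ⟨e'', ?_, fun k hk => ?_⟩
      · by_cases hD0 : D = 0
        · subst hD0
          simp [he'', he', he1]
        · simp [he'', he', he1, hD0]
      · change G (D + 2) k = ∑ i ∈ Finset.range (D + 2 + 1), (-1) ^ i * e'' i *
          ((k + (D + 2) - i).choose (D + 2 - i) : ℤ)
        rw [hlast]
        induction k, hk using Nat.le_induction with
        | base => rw [hc]; ring
        | succ k hk ih =>
          rw [hrec (D + 1) k (by omega) hk, hpascal, hG _ (by omega), ih]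
          ring
  obtain ⟨D, rfl⟩ := Nat.exists_eq_add_of_le' (show 1 ≤ d by omega)
  obtain ⟨e, he1, he⟩ := key D le_rfl
  exact ⟨e, by rw [he1, if_neg (by omega)], he⟩

section ChernNumber

variable {R : Type u} [CommRing R] [IsLocalRing R] [IsNoetherianRing R]

namespace IsColonSeq

variable {d : ℕ} {x : ℕ → R} (H : IsColonSeq d x) {n : ℕ} (hn : 2 ≤ n)
include H

omit [IsNoetherianRing R] in
theorem exists_pow_le_pow_mul_colon (k : ℕ) :
    ∃ e, maximalIdeal R ^ e ≤ cpow x n d ^ k * colonIdeal R (cpow x n d) := by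
  obtain ⟨e, he⟩ := H.primary fun _ => n
  refine ⟨e * k + e, ?_⟩
  rw [pow_add, pow_mul]
  exact Ideal.mul_mono (Ideal.pow_right_mono he k) (he.trans (le_colonIdeal _))

include hn

omit [IsNoetherianRing R] in
theorem relLength_sat {j : ℕ} (hj : j ≤ d) {J : Ideal R} (hJ : J ≤ cpow x n d)
    (hQJ : cpow x n j ≤ J) :
    relLength J (satIdeal (cpow x n j)) = relLength (cpow x n j) (satIdeal (cpow x n j)) := by
  refine relLength_congr (le_antisymm (fun u hu => ?_) (inf_le_inf_right _ hQJ))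
  exact ⟨H.mem_cpow_of_mem_sat (by omega) hj hu.2 (hJ hu.1), hu.2⟩

theorem comap_mulLeft_pow_mul_sup {j : ℕ} (hj : j < d) (k : ℕ) :
    Submodule.comap (LinearMap.mulLeft R (x j ^ n))
      (cpow x n d ^ (k + 1) * colonIdeal R (cpow x n d) ⊔ cpow x n j) =
    cpow x n d ^ k * colonIdeal R (cpow x n d) ⊔ satIdeal (cpow x n j) := by
  have ha : 1 ≤ n := by omega
  set q := cpow x n d with hq
  set I := colonIdeal R q
  apply le_antisymm
  · intro v hv
    obtain ⟨u, hu, p, hp, hup⟩ := Submodule.mem_sup.1 hv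
    rw [LinearMap.mulLeft_apply] at hup
    have hu' : u ∈ cpow x n (j + 1) := mem_cpow_succ.2 ⟨v, -p, neg_mem hp, by rw [← hup]; ring⟩
    have h1 := H.mem_mul_pow_mul_colon hn hj hu hu'
    rw [cpow_succ, Ideal.sup_mul] at h1
    obtain ⟨w, hw, z, hz, rfl⟩ := Submodule.mem_sup.1 h1
    obtain ⟨v', hv', rfl⟩ := Ideal.mem_span_singleton_mul.1 hz
    have h2 : v - v' ∈ satIdeal (cpow x n j) := by
      refine H.mem_sat_cpow ha le_rfl hj (N := n) ?_
      have : x j ^ n * (v - v') = w + p := by linear_combination -hup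
      rw [this]
      exact add_mem (Ideal.mul_le_left hw) hp
    rw [show v = v' + (v - v') by ring]
    exact add_mem (Ideal.mem_sup_left hv') (Ideal.mem_sup_right h2)
  · refine sup_le (fun v hv => Ideal.mem_sup_left ?_) (fun v hv => Ideal.mem_sup_right ?_)
    · rw [pow_succ', mul_assoc]
      exact Ideal.mul_mem_mul (pow_mem_cpow x n hj) hv
    · rw [LinearMap.mulLeft_apply]
      obtain ⟨b, rfl⟩ := Nat.exists_eq_add_of_le' ha
      rw [pow_succ, mul_assoc]
      exact Ideal.mul_mem_left _ _ (H.mul_mem_cpow ha le_rfl hj hv)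

theorem length_recursion {j : ℕ} (hj : j < d) (k : ℕ) :
    Module.length R (R ⧸ (cpow x n d ^ (k + 1) * colonIdeal R (cpow x n d) ⊔ cpow x n j)) =
      Module.length R (R ⧸ (cpow x n d ^ k * colonIdeal R (cpow x n d) ⊔
        satIdeal (cpow x n j))) +
      Module.length R (R ⧸ (cpow x n d ^ (k + 1) * colonIdeal R (cpow x n d) ⊔
        cpow x n (j + 1))) := by
  rw [length_quotient_eq_colon_add _ (x j ^ n), H.comap_mulLeft_pow_mul_sup hn hj, sup_assoc,
    cpow_succ]

omit [IsNoetherianRing R] in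
theorem length_sup_sat {j : ℕ} (hj : j ≤ d) {J : Ideal R} (hJ : J ≤ cpow x n d) :
    Module.length R (R ⧸ (J ⊔ cpow x n j)) =
      relLength (cpow x n j) (satIdeal (cpow x n j)) +
      Module.length R (R ⧸ (J ⊔ satIdeal (cpow x n j))) := by
  rw [length_quotient_eq_add (sup_le_sup_left (le_satIdeal (cpow x n j)) J),
    relLength_sup_left le_sup_left, H.relLength_sat hn hj (sup_le hJ (cpow_mono x n hj))
    le_sup_right]

theorem relLength_ne_top {j : ℕ} (hj : j ≤ d) :
    relLength (cpow x n j) (satIdeal (cpow x n j)) ≠ ⊤ := by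
  obtain ⟨e, he⟩ := H.primary fun _ => n
  have h1 := length_quotient_ne_top (he.trans (le_sup_left : cpow x n d ≤ _ ⊔ cpow x n j))
  rw [H.length_sup_sat hn hj le_rfl] at h1
  exact fun h => h1 (by rw [h, top_add])

omit [IsNoetherianRing R] in
theorem relLength_sat_succ {j : ℕ} (hj : j + 1 ≤ d) :
    relLength (cpow x n (j + 1)) (satIdeal (cpow x n (j + 1))) =
      relLength (cpow x n j) (satIdeal (cpow x n j)) +
      relLength (satIdeal (cpow x n j) ⊔ cpow x n (j + 1)) (satIdeal (cpow x n (j + 1))) := by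
  rw [relLength_add (K := satIdeal (cpow x n j) ⊔ cpow x n (j + 1)) le_sup_right
    (sup_le (satIdeal_mono (cpow_mono x n (Nat.le_succ j))) (le_satIdeal _))]
  congr 1
  rw [sup_comm, relLength_sup_left le_rfl, H.relLength_sat hn (by omega) (cpow_mono x n hj)
    (cpow_mono x n (Nat.le_succ j))]

/-- The Hilbert coefficients of the socle ideal `q : m` exist, with an explicit Chern number. -/
theorem exists_isHilbCoeff (hd : 2 ≤ d)
    (hI : colonIdeal R (cpow x n d) * colonIdeal R (cpow x n d) =
      cpow x n d * colonIdeal R (cpow x n d)) :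
    ∃ e : ℕ → ℤ, IsHilbCoeff R (colonIdeal R (cpow x n d)) d e ∧
      relLength (satIdeal (cpow x n (d - 2)) ⊔ cpow x n (d - 1)) (satIdeal (cpow x n (d - 1))) ≤
        relLength (cpow x n d) (colonIdeal R (cpow x n d)) + (e 1).natAbs := by
  set q := cpow x n d with hq
  set I := colonIdeal R q with hIdef
  have hfinI : ∀ (k : ℕ) (J : Ideal R), Module.length R (R ⧸ (q ^ k * I ⊔ J)) ≠ ⊤ := fun k J => by
    obtain ⟨e, he⟩ := H.exists_pow_le_pow_mul_colon (n := n) k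
    exact length_quotient_ne_top (he.trans le_sup_left)
  have hfinq : ∀ J : Ideal R, Module.length R (R ⧸ (q ⊔ J)) ≠ ⊤ := fun J => by
    obtain ⟨e, he⟩ := H.primary fun _ => n
    exact length_quotient_ne_top (he.trans (le_sup_left : q ≤ q ⊔ J))
  have hqI : ∀ k, q ^ (k + 1) * I ≤ q := fun k => by
    rw [pow_succ, mul_assoc]
    exact Ideal.mul_le_right.trans Ideal.mul_le_left
  choose! G hG using fun (k : ℕ) (j : ℕ) => ENat.ne_top_iff_exists.1 (hfinI k (cpow x n j))
  choose! S hS using fun (k : ℕ) (j : ℕ) => ENat.ne_top_iff_exists.1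
    (hfinI k (satIdeal (cpow x n j)))
  have hh' : ∀ j, ∃ m : ℕ, j ≤ d →
      (m : ℕ∞) = relLength (cpow x n j) (satIdeal (cpow x n j)) := fun j => by
    by_cases hj : j ≤ d
    · obtain ⟨m, hm⟩ := ENat.ne_top_iff_exists.1 (H.relLength_ne_top hn hj)
      exact ⟨m, fun _ => hm⟩
    · exact ⟨0, fun h => absurd h hj⟩
  choose h hh using hh'
  obtain ⟨l, hl⟩ := ENat.ne_top_iff_exists.1 (hfinq ⊥)
  rw [sup_bot_eq] at hl
  have hrec : ∀ j < d, ∀ k, G (k + 1) j = S k j + G (k + 1) (j + 1) := fun j hj k => by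
    have := H.length_recursion hn hj k
    rw [← hG, ← hS, ← hG] at this
    exact_mod_cast this
  have hsat : ∀ j ≤ d, ∀ k, G (k + 1) j = h j + S (k + 1) j := fun j hj k => by
    have := H.length_sup_sat hn hj (hqI k)
    rw [← hG, ← hS, ← hh j hj] at this
    exact_mod_cast this
  have htop : ∀ k, G (k + 1) d = l := fun k => by
    have : q ^ (k + 1) * I ⊔ cpow x n d = q := sup_eq_right.2 (hqI k)
    have h1 := hG (k + 1) d
    rw [this, ← hl] at h1
    exact_mod_cast h1
  obtain ⟨c, rfl⟩ := Nat.exists_eq_add_of_le' hd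
  obtain ⟨T, hT⟩ := ENat.ne_top_iff_exists.1 (hfinq (satIdeal (cpow x n (c + 1))))
  have hlT : l = h (c + 1) + T := by
    have := H.length_sup_sat (j := c + 1) hn (by omega) le_rfl
    rw [sup_eq_left.2 (cpow_mono x n (by omega)), ← hl, ← hh _ (by omega), ← hT] at this
    exact_mod_cast this
  obtain ⟨ν, hν, hTS⟩ : ∃ ν : ℕ, (ν : ℕ∞) ≤ relLength q I ∧ T = ν + S 0 (c + 1) := by
    have h1 := length_quotient_eq_add
      (sup_le_sup_right (le_colonIdeal q) (satIdeal (cpow x n (c + 1))))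
    have h2 : relLength (q ⊔ satIdeal (cpow x n (c + 1))) (I ⊔ satIdeal (cpow x n (c + 1))) =
        relLength (q ⊔ satIdeal (cpow x n (c + 1))) I := by
      rw [sup_comm I, relLength_sup_left le_sup_right]
    have h3 := hS 0 (c + 1)
    rw [pow_zero, Ideal.one_eq_top, Ideal.top_mul] at h3
    rw [h2, ← hT, ← h3] at h1
    have h4 : relLength (q ⊔ satIdeal (cpow x n (c + 1))) I ≠ ⊤ := fun h => by
      rw [h, top_add] at h1; simp at h1
    obtain ⟨ν, hν⟩ := ENat.ne_top_iff_exists.1 h4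
    refine ⟨ν, hν ▸ relLength_anti le_sup_left, ?_⟩
    rw [← hν] at h1
    exact_mod_cast h1
  obtain ⟨e, he1, he⟩ := exists_hilbert_coefficients (c + 2) (by omega)
    (fun D k => G k (c + 2 - D)) (fun D => h (c + 2 - D)) l ν
    (fun k hk => by
      obtain ⟨k, rfl⟩ := Nat.exists_eq_add_of_le' hk
      simp [htop])
    (by
      have h1 := hrec (c + 1) (by omega) 0
      have h2 := htop 0
      simp only [show c + 2 - 1 = c + 1 by omega]
      simp only [zero_add] at h1 h2
      rw [h1, h2]
      push_cast
      omega)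
    (fun D k hD hk => by
      obtain ⟨k, rfl⟩ := Nat.exists_eq_add_of_le' hk
      have h1 := hrec (c + 2 - (D + 1)) (by omega) (k + 1)
      have h2 := hsat (c + 2 - (D + 1)) (by omega) k
      rw [show c + 2 - (D + 1) + 1 = c + 2 - D by omega] at h1
      omega)
  refine ⟨e, ⟨1, fun k hk => ⟨G k 0, ?_, ?_⟩⟩, ?_⟩
  · rw [moduleLength_eq_length]
    have : I ^ (k + 1) • (⊤ : Submodule R R) = q ^ k * I ⊔ cpow x n 0 := by
      rw [cpow_zero, sup_bot_eq, smul_eq_mul, Ideal.mul_top]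
      exact colon_pow hI k
    rw [this, ← hG]
    rfl
  · have := he k hk
    simpa using this
  · have h1 := H.relLength_sat_succ (j := c) hn (by omega)
    rw [← hh _ (by omega), ← hh _ (by omega)] at h1
    simp only [show c + 2 - 1 = c + 1 by omega, Nat.add_sub_cancel] at *
    have h4 : relLength (satIdeal (cpow x n c) ⊔ cpow x n (c + 1))
      (satIdeal (cpow x n (c + 1))) ≠ ⊤ := fun h => by
      rw [h, add_top] at h1; simp at h1
    obtain ⟨r, hr⟩ := ENat.ne_top_iff_exists.1 h4
    rw [← hr] at h1 ⊢
    have h5 : h (c + 1) = h c + r := by exact_mod_cast h1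
    refine le_trans ?_ (add_le_add_left hν _)
    have : r ≤ ν + (e 1).natAbs := by omega
    exact_mod_cast this

end IsColonSeq
end ChernNumber

section Descent

variable {R : Type u} [CommRing R] [IsLocalRing R] [IsNoetherianRing R]

namespace IsColonSeq

variable {d : ℕ} {x : ℕ → R} (H : IsColonSeq d x) {n : ℕ} (hn : 2 ≤ n)
include H hn

theorem mul_mem_sat_sup_span {j : ℕ} (hj : j + 1 < d) {r : R}
    (hr : ∀ u ∈ satIdeal (cpow x n (j + 2)),
      r * u ∈ satIdeal (cpow x n (j + 1)) ⊔ cpow x n (j + 2))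
    {u : R} (hu : u ∈ satIdeal (cpow x n j ⊔ Ideal.span {x j})) :
    r * u ∈ satIdeal (cpow x n j) ⊔ Ideal.span {x j} := by
  have hn1 : 1 ≤ n := by omega
  have hpow : ∀ e, powIdeal x (Function.update (fun _ => n) j e) (Set.Iio (j + 1)) =
      cpow x n j ⊔ Ideal.span {x j ^ e} := fun e => by
    rw [powIdeal_succ, cpow, Function.update_self]
    congr 1
    exact powIdeal_congr x fun i hi => Function.update_of_ne (ne_of_lt hi) _ _
  have hupd : ∀ e, 1 ≤ e → ∀ i, 1 ≤ Function.update (fun _ => n) j e i := fun e he i => by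
    by_cases h : i = j
    · subst h; simpa using he
    · simpa [Function.update_of_ne h] using hn1
  obtain ⟨b, hb⟩ := Nat.exists_eq_add_of_le' hn
  have hz : x (j + 1) ^ n * u ∈ cpow x n j ⊔ Ideal.span {x j} := by
    have h1 := hpow 1
    rw [pow_one] at h1
    rw [← h1] at hu ⊢
    rw [show n = b + 1 + 1 by omega, pow_succ _ (b + 1), mul_assoc, ← show n = b + 1 + 1 by omega]
    exact Ideal.mul_mem_left _ _ (H.mul_mem_of_mem_sat (hupd 1 le_rfl) le_rfl hj hu)
  obtain ⟨p, hp, q, hq, hpq⟩ := Submodule.mem_sup.1 hz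
  obtain ⟨v, rfl⟩ := Ideal.mem_span_singleton.1 hq
  have hv : v ∈ satIdeal (cpow x n (j + 2)) := by
    have hle : powIdeal x (fun _ => n) (insert (j + 1) (Set.Iio j)) ≤ cpow x n (j + 2) := by
      refine powIdeal_mono x _ fun i hi => ?_
      simp only [Set.mem_insert_iff, Set.mem_Iio] at *
      omega
    have hxv : x j * v ∈ powIdeal x (fun _ => n) (insert (j + 1) (Set.Iio j)) :=
      mem_powIdeal_insert.2 ⟨u, -p, neg_mem hp, by linear_combination hpq⟩
    obtain ⟨k, hk⟩ := H.exists_pow_mul_mem (a := fun _ => n) (j := j) (N := n) (v := v)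
      (I := powIdeal x (fun _ => n) (insert (j + 1) (Set.Iio j)))
      (powIdeal_mono x _ (Set.subset_insert _ _)) fun l hl hld => by
        by_cases hlj : l = j + 1
        · subst hlj
          exact Ideal.mul_mem_right _ _ (pow_mem_powIdeal x (fun _ => n) (Set.mem_insert _ _))
        · rw [show n = b + 1 + 1 by omega, pow_succ _ (b + 1), mul_assoc,
            ← show n = b + 1 + 1 by omega]
          refine Ideal.mul_mem_left _ _ (H.colon _ _ ?_ (fun _ => hn1) j l hl hld ?_ ?_ 1 v
            (by simpa using hxv))
          · intro i hi
            simp only [Set.mem_insert_iff, Set.mem_Iio] at *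
            omega
          · simp
          · simp only [Set.mem_insert_iff, Set.mem_Iio]
            omega
    exact ⟨k, fun c hc => hle (hk c hc)⟩
  have hrv : r * v ∈ satIdeal (cpow x n (j + 1)) ⊔ Ideal.span {x (j + 1) ^ n} := by
    have h1 : cpow x n (j + 2) ≤ satIdeal (cpow x n (j + 1)) ⊔ Ideal.span {x (j + 1) ^ n} :=
      (cpow_succ x n (j + 1)).le.trans (sup_le_sup_right (le_satIdeal _) _)
    exact sup_le le_sup_left h1 (hr v hv)
  obtain ⟨w, hw, q, hq, hwq⟩ := Submodule.mem_sup.1 hrv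
  obtain ⟨c, rfl⟩ := Ideal.mem_span_singleton.1 hq
  obtain ⟨g, hg⟩ := H.mul_mem_sat_sup (fun _ => hn1) hj hw
  have h2 : x j * (r * u - x j * c) ∈
      satIdeal (powIdeal x (Function.update (fun _ => n) j (n + 1)) (Set.Iio (j + 1))) := by
    refine H.mem_sat_of_pow_mul_mem_sat (hupd _ (by omega)) le_rfl hj (N := n) ?_
    rw [hpow]
    have h3 : x (j + 1) ^ n * (x j * (r * u - x j * c)) =
        x j * (r * p) + x j * (x j * w - x j ^ n * g) + x j ^ (n + 1) * g := by
      linear_combination -x j * x j * hwq - x j * r * hpq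
    rw [h3]
    refine add_mem (add_mem ?_ ?_) ?_
    · exact le_satIdeal _ (Ideal.mem_sup_left (Ideal.mul_mem_left _ _ (Ideal.mul_mem_left _ _ hp)))
    · exact Ideal.mul_mem_left _ _ (satIdeal_mono le_sup_left hg)
    · exact le_satIdeal _ (Ideal.mem_sup_right
        (Ideal.mul_mem_right _ _ (Ideal.mem_span_singleton_self _)))
  obtain ⟨w', hw'⟩ := H.mul_mem_sat_sup (hupd _ (by omega)) hj h2
  have h4 : powIdeal x (Function.update (fun _ => n) j (n + 1)) (Set.Iio j) = cpow x n j :=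
    powIdeal_congr x fun i hi => Function.update_of_ne (ne_of_lt hi) _ _
  rw [h4, Function.update_self] at hw'
  have h5 : r * u - x j * c - x j ^ (n - 1) * w' ∈ satIdeal (cpow x n j) := by
    refine H.mem_sat_cpow_of_sat hn1 le_rfl (by omega) (N := 2) ?_
    have : x j ^ 2 * (r * u - x j * c - x j ^ (n - 1) * w') =
        x j * (x j * (r * u - x j * c)) - x j ^ (n + 1) * w' := by
      rw [hb, show b + 2 - 1 = b + 1 by omega]; ring
    rw [this]
    exact hw'
  rw [show r * u = (r * u - x j * c - x j ^ (n - 1) * w') + x j * (c + x j ^ b * w') by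
    rw [hb, show b + 2 - 1 = b + 1 by omega]; ring]
  exact add_mem (Ideal.mem_sup_left h5) (Ideal.mem_sup_right
    (Ideal.mul_mem_right _ _ (Ideal.mem_span_singleton_self _)))

theorem mul_mem_sat_sup_of_succ {j : ℕ} (hj : j + 1 < d) {r : R}
    (hr : ∀ u ∈ satIdeal (cpow x n (j + 2)),
      r * u ∈ satIdeal (cpow x n (j + 1)) ⊔ cpow x n (j + 2))
    {u : R} (hu : u ∈ satIdeal (cpow x n (j + 1))) :
    r * u ∈ satIdeal (cpow x n j) ⊔ cpow x n (j + 1) := by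
  have hn1 : 1 ≤ n := by omega
  obtain ⟨m, hm⟩ := Nat.exists_eq_add_of_le' hn1
  obtain ⟨b, hb⟩ := H.exists_sub_mem_sat_cpow hn1 hj hu
  rw [show n - 1 = m by omega] at hb
  have hb1 : b ∈ satIdeal (cpow x n j ⊔ Ideal.span {x j}) := by
    have h1 : x j ^ m * b ∈ satIdeal (cpow x n (j + 1)) := by
      rw [show x j ^ m * b = u - (u - x j ^ m * b) by ring]
      exact sub_mem hu (satIdeal_mono (cpow_mono x n (Nat.le_succ j)) hb)
    obtain ⟨k, hk⟩ := h1
    rw [← satIdeal_satIdeal]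
    refine ⟨k, fun c hc => ?_⟩
    obtain ⟨g, q, hq, hg⟩ := mem_cpow_succ.1 (hk c hc)
    have h2 : c * b - x j * g ∈ satIdeal (cpow x n j) := by
      refine H.mem_sat_cpow hn1 le_rfl (by omega) (N := m) ?_
      rw [show x j ^ m * (c * b - x j * g) = q by rw [hm] at hg; linear_combination hg]
      exact hq
    rw [show c * b = (c * b - x j * g) + x j * g by ring]
    exact add_mem (satIdeal_mono le_sup_left h2) (le_satIdeal _ (Ideal.mem_sup_right
      (Ideal.mul_mem_right _ _ (Ideal.mem_span_singleton_self _))))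
  obtain ⟨s, hs, q, hq, hsq⟩ := Submodule.mem_sup.1 (H.mul_mem_sat_sup_span hn hj hr hb1)
  obtain ⟨g, rfl⟩ := Ideal.mem_span_singleton.1 hq
  rw [show r * u = r * (u - x j ^ m * b) + x j ^ m * s + x j ^ n * g by
    rw [hm]; linear_combination -x j ^ m * hsq]
  exact add_mem (Ideal.mem_sup_left (add_mem (Ideal.mul_mem_left _ _ hb)
    (Ideal.mul_mem_left _ _ hs))) (Ideal.mem_sup_right
    (Ideal.mul_mem_right _ _ (pow_mem_cpow x n (Nat.lt_succ_self j))))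

/-- A bound on the length of `sat Q_{d-1} / (sat Q_{d-2} + Q_{d-1})` annihilates all the
corresponding quotients of lower index. -/
theorem mul_mem_sat_sup_of_relLength_le (hd : 2 ≤ d) {h : ℕ}
    (hlen : relLength (satIdeal (cpow x n (d - 2)) ⊔ cpow x n (d - 1))
      (satIdeal (cpow x n (d - 1))) ≤ h) {r : R} (hr : r ∈ maximalIdeal R ^ h) {j : ℕ}
    (hj : j + 2 ≤ d) : ∀ u ∈ satIdeal (cpow x n (j + 1)),
      r * u ∈ satIdeal (cpow x n j) ⊔ cpow x n (j + 1) := by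
  refine Nat.decreasingInduction' (n := d - 2) (m := j) (P := fun j =>
    ∀ u ∈ satIdeal (cpow x n (j + 1)), r * u ∈ satIdeal (cpow x n j) ⊔ cpow x n (j + 1)) ?_
    (by omega) ?_
  · intro l hl _ ih u hu
    exact H.mul_mem_sat_sup_of_succ hn (by omega) ih hu
  · intro u hu
    rw [show d - 2 + 1 = d - 1 by omega] at hu ⊢
    have h1 := pow_smul_eq_zero_of_length_le hlen r hr
      ⟨Submodule.mkQ _ u, Submodule.mem_map_of_mem hu⟩
    have h2 := congrArg Subtype.val h1
    simp only [SetLike.mk_smul_mk, ← map_smul, ZeroMemClass.coe_zero, smul_eq_mul] at h2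
    change Ideal.Quotient.mk _ (r * u) = 0 at h2
    rwa [Ideal.Quotient.eq_zero_iff_mem] at h2

end IsColonSeq
end Descent

section ExtSequence

variable {R : Type u} [CommRing R]

namespace LocalCohomologySequence

/-- `Hom(-, M)` as a covariant functor to the opposite category. -/
noncomputable abbrev homOp (M : ModuleCat.{u} R) : ModuleCat.{u} R ⥤ (ModuleCat.{u} R)ᵒᵖ :=
  ((linearYoneda R (ModuleCat.{u} R)).obj M).rightOp

noncomputable abbrev homOpMap {M N : ModuleCat.{u} R} (g : M ⟶ N) : homOp N ⟶ homOp M :=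
  NatTrans.rightOp ((linearYoneda R (ModuleCat.{u} R)).map g)

noncomputable abbrev homComplexMap {M N : ModuleCat.{u} R} (g : M ⟶ N)
    (P : ChainComplex (ModuleCat.{u} R) ℕ) :
    ((homOp N).mapHomologicalComplex (ComplexShape.down ℕ)).obj P ⟶
      ((homOp M).mapHomologicalComplex (ComplexShape.down ℕ)).obj P :=
  (NatTrans.mapHomologicalComplex (homOpMap g) _).app P

/-- The sequence of complexes `Hom(P, C) → Hom(P, B) → Hom(P, A)` in the opposite category. -/
@[simps]
noncomputable def homSequence (S : ShortComplex (ModuleCat.{u} R))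
    (P : ChainComplex (ModuleCat.{u} R) ℕ) :
    ShortComplex (ChainComplex (ModuleCat.{u} R)ᵒᵖ ℕ) where
  X₁ := ((homOp S.X₃).mapHomologicalComplex (ComplexShape.down ℕ)).obj P
  X₂ := ((homOp S.X₂).mapHomologicalComplex (ComplexShape.down ℕ)).obj P
  X₃ := ((homOp S.X₁).mapHomologicalComplex (ComplexShape.down ℕ)).obj P
  f := homComplexMap S.g P
  g := homComplexMap S.f P
  zero := by
    ext i
    apply Quiver.Hom.unop_inj
    ext f
    have h : ∀ f : P.X i ⟶ S.X₁, (f ≫ S.f) ≫ S.g = 0 := by simp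
    exact h f

@[simps]
noncomputable def homSequenceMap (S : ShortComplex (ModuleCat.{u} R))
    {P Q : ChainComplex (ModuleCat.{u} R) ℕ} (φ : P ⟶ Q) :
    homSequence S P ⟶ homSequence S Q where
  τ₁ := ((homOp S.X₃).mapHomologicalComplex (ComplexShape.down ℕ)).map φ
  τ₂ := ((homOp S.X₂).mapHomologicalComplex (ComplexShape.down ℕ)).map φ
  τ₃ := ((homOp S.X₁).mapHomologicalComplex (ComplexShape.down ℕ)).map φ
  comm₁₂ := ((NatTrans.mapHomologicalComplex (homOpMap S.g) _).naturality φ)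
  comm₂₃ := ((NatTrans.mapHomologicalComplex (homOpMap S.f) _).naturality φ)

theorem homSequence_shortExact {S : ShortComplex (ModuleCat.{u} R)} (hS : S.ShortExact)
    (P : ChainComplex (ModuleCat.{u} R) ℕ) [∀ i, Projective (P.X i)] :
    (homSequence S P).ShortExact := by
  refine HomologicalComplex.shortExact_of_degreewise_shortExact _ fun i => ?_
  have : ((homSequence S P).map (HomologicalComplex.eval _ _ i)) =
      (S.map ((linearCoyoneda R (ModuleCat.{u} R)).obj (op (P.X i)))).op := rfl
  rw [this]
  have hm := hS.mono_f
  have he := hS.epi_g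
  refine ShortComplex.ShortExact.op (ShortComplex.ShortExact.mk' ?_ ?_ ?_)
  · rw [ShortComplex.moduleCat_exact_iff]
    intro (f : P.X i ⟶ S.X₂) hf
    exact ⟨hS.exact.lift f hf, hS.exact.lift_f f hf⟩
  · rw [ModuleCat.mono_iff_injective]
    intro (f : P.X i ⟶ S.X₁) (g : P.X i ⟶ S.X₁) (h : f ≫ S.f = g ≫ S.f)
    exact (cancel_mono S.f).1 h
  · rw [ModuleCat.epi_iff_surjective]
    intro (f : P.X i ⟶ S.X₃)
    exact ⟨Projective.factorThru f S.g, Projective.factorThru_comp f S.g⟩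

/-! ### The long exact sequence of `Ext` -/

noncomputable abbrev extObj (n : ℕ) (X M : ModuleCat.{u} R) : ModuleCat.{u} R :=
  ((Ext R (ModuleCat.{u} R) n).obj (op X)).obj M

noncomputable abbrev res (X : ModuleCat.{u} R) : ChainComplex (ModuleCat.{u} R) ℕ :=
  (projectiveResolution X).complex

noncomputable abbrev homHomology (n : ℕ) (X M : ModuleCat.{u} R) : (ModuleCat.{u} R)ᵒᵖ :=
  (((homOp M).mapHomologicalComplex (ComplexShape.down ℕ)).obj (res X)).homology n

noncomputable def extIso (n : ℕ) (X M : ModuleCat.{u} R) : op (extObj n X M) ≅ homHomology n X M :=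
  (projectiveResolution X).isoLeftDerivedObj (homOp M) n

theorem extIso_naturality {n : ℕ} {M N : ModuleCat.{u} R} (g : M ⟶ N) :
    (((Ext R (ModuleCat.{u} R) n).obj (op X)).map g).op ≫ (extIso n X M).hom =
      (extIso n X N).hom ≫ HomologicalComplex.homologyMap (homComplexMap g (res X)) n := by
  have := ProjectiveResolution.leftDerived_app_eq (homOpMap g) (projectiveResolution X) n
  rw [← Iso.eq_comp_inv, Category.assoc]
  exact this

theorem extIso_naturality_left {n : ℕ} {X Y : ModuleCat.{u} R} (f : X ⟶ Y) (M : ModuleCat.{u} R) :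
    (((Ext R (ModuleCat.{u} R) n).map f.op).app M).op ≫ (extIso n Y M).hom =
      (extIso n X M).hom ≫ HomologicalComplex.homologyMap
        (((homOp M).mapHomologicalComplex _).map
          (ProjectiveResolution.lift f (projectiveResolution X) (projectiveResolution Y))) n :=
  ProjectiveResolution.isoLeftDerivedObj_hom_naturality f _ _ _
    (ProjectiveResolution.lift_commutes_zero _ _ _) (homOp M) n


section Delta

variable {S : ShortComplex (ModuleCat.{u} R)} (hS : S.ShortExact) (n : ℕ)

noncomputable def homδ (X : ModuleCat.{u} R) :
    homHomology (n + 1) X S.X₁ ⟶ homHomology n X S.X₃ :=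
  (homSequence_shortExact hS (res X)).δ (n + 1) n (by simp)

theorem homδ_naturality {X Y : ModuleCat.{u} R} (f : X ⟶ Y) :
    homδ hS n X ≫ HomologicalComplex.homologyMap
        (((homOp S.X₃).mapHomologicalComplex _).map
          (ProjectiveResolution.lift f (projectiveResolution X) (projectiveResolution Y))) n =
      HomologicalComplex.homologyMap
        (((homOp S.X₁).mapHomologicalComplex _).map
          (ProjectiveResolution.lift f (projectiveResolution X) (projectiveResolution Y))) (n + 1) ≫
      homδ hS n Y :=
  HomologicalComplex.HomologySequence.δ_naturality (homSequenceMap S _)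
    (homSequence_shortExact hS (res X)) (homSequence_shortExact hS (res Y)) (n + 1) n (by simp)

/-- The connecting homomorphism of `Ext` in the second variable. -/
noncomputable def extδ (X : ModuleCat.{u} R) : extObj n X S.X₃ ⟶ extObj (n + 1) X S.X₁ :=
  ((extIso (n + 1) X S.X₁).hom ≫ homδ hS n X ≫ (extIso n X S.X₃).inv).unop

theorem extδ_op (X : ModuleCat.{u} R) : (extδ hS n X).op ≫ (extIso n X S.X₃).hom =
    (extIso (n + 1) X S.X₁).hom ≫ homδ hS n X := by
  rw [extδ, Quiver.Hom.op_unop, Category.assoc, Category.assoc, Iso.inv_hom_id, Category.comp_id]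

theorem extδ_naturality {X Y : ModuleCat.{u} R} (f : X ⟶ Y) :
    ((Ext R (ModuleCat.{u} R) n).map f.op).app S.X₃ ≫ extδ hS n X =
      extδ hS n Y ≫ ((Ext R (ModuleCat.{u} R) (n + 1)).map f.op).app S.X₁ := by
  apply Quiver.Hom.op_inj
  rw [op_comp, op_comp, ← cancel_mono (extIso n Y S.X₃).hom, Category.assoc, Category.assoc,
    extIso_naturality_left, extδ_op, ← Category.assoc, extδ_op, Category.assoc, homδ_naturality,
    ← Category.assoc, ← Category.assoc, extIso_naturality_left]

theorem exact_of_homHomology {A B C : ModuleCat.{u} R} {A' B' C' : (ModuleCat.{u} R)ᵒᵖ}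
    {f : A ⟶ B} {g : B ⟶ C} {f' : B' ⟶ A'} {g' : C' ⟶ B'} (w : g' ≫ f' = 0)
    (hex : (ShortComplex.mk g' f' w).Exact) (a : op A ≅ A') (b : op B ≅ B') (c : op C ≅ C')
    (hf : f.op ≫ a.hom = b.hom ≫ f') (hg : g.op ≫ b.hom = c.hom ≫ g') :
    Function.Exact f.hom g.hom := by
  have w' : f ≫ g = 0 := by
    apply Quiver.Hom.op_inj
    rw [op_comp, ← cancel_mono a.hom, Category.assoc, hf, reassoc_of% hg, w]
    simp
  have h1 : (ShortComplex.mk f g w').Exact := by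
    apply ShortComplex.Exact.unop (S := (ShortComplex.mk f g w').op)
    refine (ShortComplex.exact_iff_of_iso ?_).2 hex
    exact ShortComplex.isoMk c b a hg.symm hf.symm
  exact (ShortComplex.ShortExact.moduleCat_exact_iff_function_exact _).1 h1

include hS

theorem ext_exact₂ (X : ModuleCat.{u} R) :
    Function.Exact (((Ext R (ModuleCat.{u} R) n).obj (op X)).map S.f).hom
      (((Ext R (ModuleCat.{u} R) n).obj (op X)).map S.g).hom :=
  exact_of_homHomology _ ((homSequence_shortExact hS (res X)).homology_exact₂ n)
    (extIso n X _) (extIso n X _) (extIso n X _) (extIso_naturality S.f) (extIso_naturality S.g)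

theorem ext_exact₃ (X : ModuleCat.{u} R) :
    Function.Exact (((Ext R (ModuleCat.{u} R) n).obj (op X)).map S.g).hom (extδ hS n X).hom :=
  exact_of_homHomology _ ((homSequence_shortExact hS (res X)).homology_exact₁ (n + 1) n (by simp))
    (extIso n X _) (extIso n X _) (extIso (n + 1) X _) (extIso_naturality S.g) (extδ_op hS n X)

theorem ext_exact₁ (X : ModuleCat.{u} R) :
    Function.Exact (extδ hS n X).hom
      (((Ext R (ModuleCat.{u} R) (n + 1)).obj (op X)).map S.f).hom :=
  exact_of_homHomology _ ((homSequence_shortExact hS (res X)).homology_exact₃ (n + 1) n (by simp))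
    (extIso n X _) (extIso (n + 1) X _) (extIso (n + 1) X _) (extδ_op hS n X)
    (extIso_naturality S.f)

end Delta

end LocalCohomologySequence
end ExtSequence

section ColimitElements

variable {R : Type u} [CommRing R] (J : Ideal R)

namespace LocalCohomologySequence

noncomputable abbrev powQuot (k : ℕ) : ModuleCat.{u} R := ModuleCat.of R (R ⧸ J ^ k)

noncomputable abbrev powQuotMap {k l : ℕ} (h : k ≤ l) : powQuot J l ⟶ powQuot J k :=
  ModuleCat.ofHom <| Submodule.mapQ _ _ LinearMap.id (Ideal.pow_le_pow_right h)

/-- The transition maps `Ext^i(R/J^k, M) → Ext^i(R/J^l, M)`. -/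
noncomputable abbrev extTrans (i : ℕ) {k l : ℕ} (h : k ≤ l) (M : ModuleCat.{u} R) :
    extObj i (powQuot J k) M ⟶ extObj i (powQuot J l) M :=
  ((Ext R (ModuleCat.{u} R) i).map (powQuotMap J h).op).app M

noncomputable abbrev lcDiagram (i : ℕ) : ℕᵒᵖᵒᵖ ⥤ ModuleCat.{u} R ⥤ ModuleCat.{u} R :=
  localCohomology.diagram (localCohomology.idealPowersDiagram J) i

instance (i : ℕ) : HasColimit (lcDiagram J i) :=
  localCohomology.hasColimitDiagram.{u, 0} (localCohomology.idealPowersDiagram J) i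

noncomputable abbrev lcCocone (i : ℕ) (M : ModuleCat.{u} R) :
    Cocone (lcDiagram J i ⋙ (evaluation (ModuleCat.{u} R) (ModuleCat.{u} R)).obj M) :=
  ((evaluation (ModuleCat.{u} R) (ModuleCat.{u} R)).obj M).mapCocone
    (colimit.cocone (lcDiagram J i))

noncomputable def isColimitEval (i : ℕ) (M : ModuleCat.{u} R) : IsColimit (lcCocone J i M) :=
  isColimitOfPreserves ((evaluation (ModuleCat.{u} R) (ModuleCat.{u} R)).obj M)
    (colimit.isColimit (lcDiagram J i))

/-- The canonical map `Ext^i(R/J^k, M) → H^i_J(M)`. -/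
noncomputable def extι (i k : ℕ) (M : ModuleCat.{u} R) :
    extObj i (powQuot J k) M ⟶ (localCohomology J i).obj M :=
  (colimit.ι (lcDiagram J i)
    (op (op k))).app M

instance : PreservesFilteredColimitsOfSize.{0, 0} (forget (ModuleCat.{u} R)) :=
  preservesFilteredColimitsOfSize_shrink.{0, u, 0, u} _

theorem exists_extι_eq {i : ℕ} {M : ModuleCat.{u} R} (z : (localCohomology J i).obj M) :
    ∃ k, ∃ e : extObj i (powQuot J k) M, (extι J i k M).hom e = z := by
  obtain ⟨j, y, hy⟩ := Concrete.isColimit_exists_rep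
    (lcDiagram J i ⋙ (evaluation _ _).obj M) (isColimitEval J i M) z
  exact ⟨j.unop.unop, y, hy⟩

theorem extι_trans {i k l : ℕ} (h : k ≤ l) (M : ModuleCat.{u} R) :
    extTrans J i h M ≫ extι J i l M = extι J i k M :=
  NatTrans.congr_app
    (colimit.w (lcDiagram J i)
      (show op (op k) ⟶ op (op l) from (homOfLE h).op.op)) M

theorem exists_extTrans_eq_zero {i k : ℕ} {M : ModuleCat.{u} R} {e : extObj i (powQuot J k) M}
    (he : (extι J i k M).hom e = 0) : ∃ l, ∃ h : k ≤ l, (extTrans J i h M).hom e = 0 := by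
  obtain ⟨j, f, g, hfg⟩ := Concrete.isColimit_exists_of_rep_eq.{u}
    (lcDiagram J i ⋙ (evaluation _ _).obj M) (isColimitEval J i M) (i := op (op k))
    (j := op (op k)) e 0 (he.trans (map_zero (extι J i k M).hom).symm)
  refine ⟨j.unop.unop, f.unop.unop.down.down, ?_⟩
  exact hfg.trans (map_zero (ModuleCat.Hom.hom _))

theorem extι_naturality {i k : ℕ} {M N : ModuleCat.{u} R} (g : M ⟶ N) :
    ((Ext R (ModuleCat.{u} R) i).obj (op (powQuot J k))).map g ≫ extι J i k N =
      extι J i k M ≫ (localCohomology J i).map g :=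
  (colimit.ι (lcDiagram J i)
    (op (op k))).naturality g

theorem extTrans_naturality {i k l : ℕ} (h : k ≤ l) {M N : ModuleCat.{u} R} (g : M ⟶ N) :
    ((Ext R (ModuleCat.{u} R) i).obj (op (powQuot J k))).map g ≫ extTrans J i h N =
      extTrans J i h M ≫ ((Ext R (ModuleCat.{u} R) i).obj (op (powQuot J l))).map g :=
  ((Ext R (ModuleCat.{u} R) i).map (powQuotMap J h).op).naturality g

variable {S : ShortComplex (ModuleCat.{u} R)} (n : ℕ) (hS : S.ShortExact)

/-- The connecting homomorphism of local cohomology. -/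
noncomputable def lcδ :
    (localCohomology J n).obj S.X₃ ⟶ (localCohomology J (n + 1)).obj S.X₁ :=
  (isColimitEval J n S.X₃).desc
    { pt := (localCohomology J (n + 1)).obj S.X₁
      ι :=
        { app := fun k => extδ hS n (powQuot J k.unop.unop) ≫ extι J (n + 1) k.unop.unop S.X₁
          naturality := by
            intro k l f
            have hkl : k.unop.unop ≤ l.unop.unop := f.unop.unop.down.down
            have h1 := extδ_naturality hS n (powQuotMap J hkl)
            have h2 := extι_trans J (i := n + 1) hkl S.X₁
            change ((Ext R (ModuleCat.{u} R) n).map (powQuotMap J hkl).op).app S.X₃ ≫ _ ≫ _ =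
              (_ ≫ _) ≫ 𝟙 _
            rw [reassoc_of% h1, Category.comp_id, ← h2] } }

theorem extι_lcδ (k : ℕ) : extι J n k S.X₃ ≫ lcδ J n hS =
    extδ hS n (powQuot J k) ≫ extι J (n + 1) k S.X₁ :=
  (isColimitEval J n S.X₃).fac _ (op (op k))

theorem extι_lcδ_apply (k : ℕ) (e) : (lcδ J n hS).hom ((extι J n k S.X₃).hom e) =
    (extι J (n + 1) k S.X₁).hom ((extδ hS n (powQuot J k)).hom e) :=
  congr($(extι_lcδ J n hS k) e)

theorem extι_naturality_apply {i k : ℕ} {M N : ModuleCat.{u} R} (g : M ⟶ N) (e) :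
    ((localCohomology J i).map g).hom ((extι J i k M).hom e) = (extι J i k N).hom
      ((((Ext R (ModuleCat.{u} R) i).obj (op (powQuot J k))).map g).hom e) :=
  congr($(extι_naturality J (i := i) (k := k) g) e).symm

theorem extι_trans_apply {i k l : ℕ} (h : k ≤ l) (M : ModuleCat.{u} R) (e) :
    (extι J i l M).hom ((extTrans J i h M).hom e) = (extι J i k M).hom e :=
  congr($(extι_trans J h M) e)

include hS

theorem lc_exact₂ : Function.Exact ((localCohomology J n).map S.f).hom
    ((localCohomology J n).map S.g).hom := by
  intro z
  constructor
  · intro hz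
    obtain ⟨k, e, rfl⟩ := exists_extι_eq J z
    rw [extι_naturality_apply] at hz
    obtain ⟨l, hkl, hl⟩ := exists_extTrans_eq_zero J hz
    obtain ⟨a, ha⟩ := (ext_exact₂ hS n (powQuot J l) ((extTrans J n hkl S.X₂).hom e)).1
      (congr($(extTrans_naturality J hkl S.g) e).symm.trans hl)
    exact ⟨(extι J n l S.X₁).hom a, by
      rw [extι_naturality_apply, ha, extι_trans_apply]⟩
  · rintro ⟨y, rfl⟩
    obtain ⟨k, e, rfl⟩ := exists_extι_eq J y
    rw [extι_naturality_apply, extι_naturality_apply,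
      (ext_exact₂ hS n (powQuot J k)).apply_apply_eq_zero, map_zero]

theorem lc_exact₃ : Function.Exact ((localCohomology J n).map S.g).hom (lcδ J n hS).hom := by
  intro z
  constructor
  · intro hz
    obtain ⟨k, e, rfl⟩ := exists_extι_eq J z
    rw [extι_lcδ_apply] at hz
    obtain ⟨l, hkl, hl⟩ := exists_extTrans_eq_zero J hz
    obtain ⟨a, ha⟩ := (ext_exact₃ hS n (powQuot J l) ((extTrans J n hkl S.X₃).hom e)).1
      (congr($(extδ_naturality hS n (powQuotMap J hkl)) e).trans hl)
    exact ⟨(extι J n l S.X₂).hom a, by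
      rw [extι_naturality_apply, ha, extι_trans_apply]⟩
  · rintro ⟨y, rfl⟩
    obtain ⟨k, e, rfl⟩ := exists_extι_eq J y
    rw [extι_naturality_apply, extι_lcδ_apply,
      (ext_exact₃ hS n (powQuot J k)).apply_apply_eq_zero, map_zero]

theorem lc_exact₁ : Function.Exact (lcδ J n hS).hom ((localCohomology J (n + 1)).map S.f).hom := by
  intro z
  constructor
  · intro hz
    obtain ⟨k, e, rfl⟩ := exists_extι_eq J z
    rw [extι_naturality_apply] at hz
    obtain ⟨l, hkl, hl⟩ := exists_extTrans_eq_zero J hz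
    obtain ⟨a, ha⟩ := (ext_exact₁ hS n (powQuot J l) ((extTrans J (n + 1) hkl S.X₁).hom e)).1
      (congr($(extTrans_naturality J hkl S.f) e).symm.trans hl)
    exact ⟨(extι J n l S.X₃).hom a, by
      rw [extι_lcδ_apply, ha, extι_trans_apply]⟩
  · rintro ⟨y, rfl⟩
    obtain ⟨k, e, rfl⟩ := exists_extι_eq J y
    rw [extι_lcδ_apply, extι_naturality_apply,
      (ext_exact₁ hS n (powQuot J k)).apply_apply_eq_zero, map_zero]

end LocalCohomologySequence
end ColimitElements

section ExtProperties

variable {R : Type u} [CommRing R]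

namespace LocalCohomologySequence

instance opHomModule (X Y : (ModuleCat.{u} R)ᵒᵖ) : Module R (X ⟶ Y) where
  smul r f := (r • f.unop).op
  one_smul f := Quiver.Hom.unop_inj (one_smul R f.unop)
  mul_smul r s f := Quiver.Hom.unop_inj (mul_smul r s f.unop)
  smul_zero r := Quiver.Hom.unop_inj (smul_zero (A := Y.unop ⟶ X.unop) r)
  smul_add r f g := Quiver.Hom.unop_inj (smul_add r f.unop g.unop)
  add_smul r s f := Quiver.Hom.unop_inj (add_smul r s f.unop)
  zero_smul f := Quiver.Hom.unop_inj (zero_smul R f.unop)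

theorem unop_smul {X Y : (ModuleCat.{u} R)ᵒᵖ} (r : R) (f : X ⟶ Y) :
    (r • f).unop = r • f.unop := rfl

instance : CategoryTheory.Linear R (ModuleCat.{u} R)ᵒᵖ where
  homModule := opHomModule
  smul_comp X Y Z r f g := by
    apply Quiver.Hom.unop_inj
    rw [unop_comp, unop_smul, unop_smul, Linear.comp_smul, unop_comp]
  comp_smul X Y Z f r g := by
    apply Quiver.Hom.unop_inj
    rw [unop_comp, unop_smul, unop_smul, Linear.smul_comp, unop_comp]

theorem homologyMap_smul_id {C : Type*} [Category* C] [Preadditive C]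
    [CategoryTheory.Linear R C] (K : ChainComplex C ℕ) (n : ℕ) [K.HasHomology n] (r : R) :
    HomologicalComplex.homologyMap (r • 𝟙 K) n = r • 𝟙 _ := by
  rw [← HomologicalComplex.homologyMap_id]
  exact ShortComplex.homologyMap_smul (φ := (HomologicalComplex.shortComplexFunctor _ _ n).map (𝟙 K)) r

theorem homComplexMap_smul (M : ModuleCat.{u} R) (P : ChainComplex (ModuleCat.{u} R) ℕ) (r : R) :
    homComplexMap (r • 𝟙 M) P = r • 𝟙 _ := by
  ext i
  rw [HomologicalComplex.smul_f_apply]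
  apply Quiver.Hom.unop_inj
  rw [unop_smul]
  ext f
  have h : ∀ f : P.X i ⟶ M, f ≫ (r • 𝟙 M) = r • f := by simp
  exact h f

theorem ext_map_smul (n : ℕ) (X M : ModuleCat.{u} R) (r : R) :
    ((Ext R (ModuleCat.{u} R) n).obj (op X)).map (r • 𝟙 M) = r • 𝟙 _ := by
  have h1 := extIso_naturality (n := n) (X := X) (r • 𝟙 M)
  rw [homComplexMap_smul, homologyMap_smul_id, Linear.comp_smul, Category.comp_id] at h1
  have h3 : (r • 𝟙 (op (extObj n X M))) ≫ (extIso n X M).hom = r • (extIso n X M).hom := by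
    rw [Linear.smul_comp, Category.id_comp]
  exact Quiver.Hom.op_inj ((cancel_mono (extIso n X M).hom).1 (h1.trans h3.symm))

theorem exact_map_homOp {S : ShortComplex (ModuleCat.{u} R)} (hS : S.Exact) (E : ModuleCat.{u} R)
    [Injective E] : (S.map (homOp E)).Exact := by
  refine ShortComplex.Exact.op (S := (S.map (homOp E)).unop) ?_
  rw [ShortComplex.moduleCat_exact_iff]
  intro (f : S.X₂ ⟶ E) (hf : S.f ≫ f = 0)
  exact ⟨hS.descToInjective f hf, hS.comp_descToInjective f hf⟩

theorem subsingleton_ext (n : ℕ) (X E : ModuleCat.{u} R) [Injective E] :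
    Subsingleton (extObj (n + 1) X E) := by
  have h : ((homOp E).mapHomologicalComplex (ComplexShape.down ℕ) |>.obj (res X)).ExactAt
      (n + 1) := by
    have h1 := (projectiveResolution X).exact_succ n
    rw [HomologicalComplex.exactAt_iff' _ (n + 2) (n + 1) n (by simp) (by simp)]
    exact exact_map_homOp h1 E
  have h2 : IsZero (homHomology (n + 1) X E) := h.isZero_homology
  have h3 := ((h2.of_iso (extIso (n + 1) X E))).unop
  exact ModuleCat.subsingleton_of_isZero h3

instance (M : ModuleCat.{u} R) : PreservesFiniteColimits (homOp M) := by
  have : PreservesLimitsOfSize.{0, 0} ((linearYoneda R (ModuleCat.{u} R)).obj M ⋙ forget _) := 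
    inferInstanceAs (PreservesLimitsOfSize.{0, 0} (yoneda.obj M))
  have : PreservesLimitsOfSize.{0, 0} ((linearYoneda R (ModuleCat.{u} R)).obj M) :=
    preservesLimits_of_reflects_of_preserves _ (forget _)
  apply preservesFiniteColimits_rightOp

/-- The isomorphism `Hom(X, M) ≅ Ext⁰(X, M)`. -/
noncomputable def homToExt (X M : ModuleCat.{u} R) :
    ((linearYoneda R (ModuleCat.{u} R)).obj M).obj (op X) ⟶ extObj 0 X M :=
  ((homOp M).fromLeftDerivedZero.app X).unop

instance (X M : ModuleCat.{u} R) : IsIso (homToExt X M) := by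
  unfold homToExt
  have h : IsIso ((homOp M).fromLeftDerivedZero.app X) :=
    (inferInstance : IsIso ((homOp M).leftDerivedZeroIsoSelf.app X).hom)
  exact isIso_unop _

theorem homToExt_naturality_left {X Y : ModuleCat.{u} R} (f : X ⟶ Y) (M : ModuleCat.{u} R) :
    homToExt Y M ≫ ((Ext R (ModuleCat.{u} R) 0).map f.op).app M =
      ((linearYoneda R (ModuleCat.{u} R)).obj M).map f.op ≫ homToExt X M :=
  Quiver.Hom.op_inj ((homOp M).fromLeftDerivedZero.naturality f)

theorem homComplexMap_fromLeftDerivedZero {M N : ModuleCat.{u} R} (X : ModuleCat.{u} R)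
    (g : M ⟶ N) :
    HomologicalComplex.opcyclesMap (homComplexMap g (res X)) 0 ≫
        (projectiveResolution X).fromLeftDerivedZero' (homOp M) =
      (projectiveResolution X).fromLeftDerivedZero' (homOp N) ≫ (homOpMap g).app X := by
  rw [← cancel_epi (HomologicalComplex.pOpcycles _ _), HomologicalComplex.p_opcyclesMap_assoc,
    ProjectiveResolution.pOpcycles_comp_fromLeftDerivedZero',
    ProjectiveResolution.pOpcycles_comp_fromLeftDerivedZero'_assoc]
  exact ((homOpMap g).naturality _).symm

theorem homToExt_naturality {M N : ModuleCat.{u} R} (X : ModuleCat.{u} R) (g : M ⟶ N) :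
    homToExt X M ≫ ((Ext R (ModuleCat.{u} R) 0).obj (op X)).map g =
      ((linearYoneda R (ModuleCat.{u} R)).map g).app (op X) ≫ homToExt X N := by
  apply Quiver.Hom.op_inj
  have h1 : (homToExt X M).op = (extIso 0 X M).hom ≫ (ChainComplex.isoHomologyι₀ _).hom ≫
      (projectiveResolution X).fromLeftDerivedZero' (homOp M) :=
    ProjectiveResolution.fromLeftDerivedZero_eq (projectiveResolution X) (homOp M)
  have h2 : (homToExt X N).op = (extIso 0 X N).hom ≫ (ChainComplex.isoHomologyι₀ _).hom ≫
      (projectiveResolution X).fromLeftDerivedZero' (homOp N) :=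
    ProjectiveResolution.fromLeftDerivedZero_eq (projectiveResolution X) (homOp N)
  rw [op_comp, op_comp, h1, h2, ← Category.assoc, extIso_naturality, Category.assoc,
    Category.assoc, Category.assoc]
  congr 1
  have h3 := homComplexMap_fromLeftDerivedZero X g
  have h4 := HomologicalComplex.homologyι_naturality (homComplexMap g (res X)) 0
  have h5 : ((homOpMap g).app X) = (((linearYoneda R (ModuleCat.{u} R)).map g).app (op X)).op := rfl
  rw [← h5, ← h3, HomologicalComplex.isoHomologyι_hom,
    HomologicalComplex.isoHomologyι_hom, reassoc_of% h4]

end LocalCohomologySequence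
end ExtProperties

section LCModules

variable {R : Type u} [CommRing R] (J : Ideal R)

/-- The local cohomology module `H^i_J(M)` of an unbundled module. -/
noncomputable abbrev LC (i : ℕ) (M : Type u) [AddCommGroup M] [Module R M] : Type u :=
  (localCohomology J i).obj (ModuleCat.of R M)

variable {A B C M N P : Type u} [AddCommGroup A] [Module R A] [AddCommGroup B] [Module R B]
  [AddCommGroup C] [Module R C] [AddCommGroup M] [Module R M] [AddCommGroup N] [Module R N]
  [AddCommGroup P] [Module R P]

namespace LC

open LocalCohomologySequence

noncomputable def map (i : ℕ) (f : M →ₗ[R] N) : LC J i M →ₗ[R] LC J i N :=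
  ((localCohomology J i).map (ModuleCat.ofHom f)).hom

theorem map_comp (i : ℕ) (f : M →ₗ[R] N) (g : N →ₗ[R] P) :
    map J i (g ∘ₗ f) = map J i g ∘ₗ map J i f := by
  rw [map, ModuleCat.ofHom_comp, Functor.map_comp]; rfl

theorem map_smul_id (i : ℕ) (r : R) (z : LC J i M) :
    map J i (r • (LinearMap.id : M →ₗ[R] M)) z = r • z := by
  obtain ⟨k, e, rfl⟩ := exists_extι_eq J z
  change ((localCohomology J i).map (r • 𝟙 (ModuleCat.of R M))).hom _ = _
  rw [extι_naturality_apply, ext_map_smul]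
  exact map_smul (extι J i k _).hom r e

theorem exists_exact {f : A →ₗ[R] B} {g : B →ₗ[R] C} (hf : Function.Injective f)
    (hg : Function.Surjective g) (hfg : Function.Exact f g) (i : ℕ) :
    ∃ δ : LC J i C →ₗ[R] LC J (i + 1) A,
      Function.Exact (map J i f) (map J i g) ∧ Function.Exact (map J i g) δ ∧
        Function.Exact δ (map J (i + 1) f) := by
  let S : ShortComplex (ModuleCat.{u} R) := ShortComplex.mk (ModuleCat.ofHom f) (ModuleCat.ofHom g)
    (by ext x; exact hfg.apply_apply_eq_zero x)
  have hS : S.ShortExact := ShortComplex.ShortExact.mk'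
    ((ShortComplex.ShortExact.moduleCat_exact_iff_function_exact S).2 hfg)
    ((ModuleCat.mono_iff_injective _).2 hf) ((ModuleCat.epi_iff_surjective _).2 hg)
  exact ⟨(lcδ J i hS).hom, lc_exact₂ J i hS, lc_exact₃ J i hS, lc_exact₁ J i hS⟩

theorem exact_map {f : A →ₗ[R] B} {g : B →ₗ[R] C} (hf : Function.Injective f)
    (hg : Function.Surjective g) (hfg : Function.Exact f g) (i : ℕ) :
    Function.Exact (map J i f) (map J i g) := by
  obtain ⟨δ, h, -⟩ := exists_exact J hf hg hfg i
  exact h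

theorem subsingleton_of_injective (i : ℕ) [Module.Injective R M] :
    Subsingleton (LC J (i + 1) M) := by
  refine subsingleton_of_forall_eq 0 fun z => ?_
  obtain ⟨k, e, rfl⟩ := exists_extι_eq J z
  have : Injective (ModuleCat.of R M) := Module.injective_object_of_injective_module R M
  have := subsingleton_ext i (powQuot J k) (ModuleCat.of R M)
  rw [Subsingleton.elim e 0, map_zero]

/-- The canonical map `Hom(R/J^k, M) → H⁰_J(M)`. -/
noncomputable def ofHom (k : ℕ) : ((R ⧸ J ^ k) →ₗ[R] M) →ₗ[R] LC J 0 M :=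
  (extι J 0 k (ModuleCat.of R M)).hom ∘ₗ (homToExt (powQuot J k) (ModuleCat.of R M)).hom ∘ₗ
    (ModuleCat.homLinearEquiv (S := R) (M := powQuot J k)
      (N := ModuleCat.of R M)).symm.toLinearMap

theorem exists_ofHom_eq (z : LC J 0 M) : ∃ k, ∃ f : (R ⧸ J ^ k) →ₗ[R] M, ofHom J k f = z := by
  obtain ⟨k, e, rfl⟩ := exists_extι_eq J z
  have h : Function.Surjective (homToExt (powQuot J k) (ModuleCat.of R M)).hom :=
    (ModuleCat.epi_iff_surjective _).1 inferInstance
  obtain ⟨f, rfl⟩ := h e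
  exact ⟨k, ModuleCat.Hom.hom f, rfl⟩

theorem map_ofHom (k : ℕ) (f : (R ⧸ J ^ k) →ₗ[R] M) (g : M →ₗ[R] N) :
    map J 0 g (ofHom J k f) = ofHom J k (g ∘ₗ f) := by
  have h1 := extι_naturality_apply J (i := 0) (k := k) (ModuleCat.ofHom g)
    ((homToExt (powQuot J k) (ModuleCat.of R M)).hom (ModuleCat.ofHom f))
  have h2 := congr($(homToExt_naturality (powQuot J k) (ModuleCat.ofHom g)) (ModuleCat.ofHom f))
  exact h1.trans (congrArg (extι J 0 k (ModuleCat.of R N)).hom h2)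

theorem ofHom_comp_factor {k l : ℕ} (h : k ≤ l) (f : (R ⧸ J ^ k) →ₗ[R] M) :
    ofHom J l (f ∘ₗ Submodule.mapQ _ _ LinearMap.id (Ideal.pow_le_pow_right h)) =
      ofHom J k f := by
  have h1 := extι_trans_apply J (i := 0) h (ModuleCat.of R M)
    ((homToExt (powQuot J k) (ModuleCat.of R M)).hom (ModuleCat.ofHom f))
  have h2 := congr($(homToExt_naturality_left (powQuotMap J h) (ModuleCat.of R M))
    (ModuleCat.ofHom f))
  exact ((congrArg (extι J 0 l (ModuleCat.of R M)).hom h2).symm).trans h1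

end LC
end LCModules

section LCTorsion

variable {R : Type u} [CommRing R] (J : Ideal R)

/-- `u` is killed by a power of `J`. -/
def IsPowTorsion {M : Type u} [AddCommGroup M] [Module R M] (u : M) : Prop :=
  ∃ k, ∀ c ∈ J ^ k, c • u = 0

variable {A B C M N P : Type u} [AddCommGroup A] [Module R A] [AddCommGroup B] [Module R B]
  [AddCommGroup C] [Module R C] [AddCommGroup M] [Module R M] [AddCommGroup N] [Module R N]
  [AddCommGroup P] [Module R P]

theorem IsPowTorsion.map {u : M} (hu : IsPowTorsion J u) (f : M →ₗ[R] N) :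
    IsPowTorsion J (f u) := by
  obtain ⟨k, hk⟩ := hu
  exact ⟨k, fun c hc => by rw [← map_smul, hk c hc, map_zero]⟩

theorem isPowTorsion_quotient_pow {k : ℕ} (u : R ⧸ J ^ k) : ∀ c ∈ J ^ k, c • u = 0 := by
  intro c hc
  obtain ⟨a, rfl⟩ := Ideal.Quotient.mk_surjective u
  rw [Algebra.smul_def, Ideal.Quotient.algebraMap_eq, ← map_mul, Ideal.Quotient.eq_zero_iff_mem]
  exact Ideal.mul_mem_right _ _ hc

theorem isPowTorsion_apply_quotient_pow {k : ℕ} (f : (R ⧸ J ^ k) →ₗ[R] M) (u : R ⧸ J ^ k) :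
    IsPowTorsion J (f u) :=
  IsPowTorsion.map J ⟨k, isPowTorsion_quotient_pow J u⟩ f

/-- The submodule of elements killed by a power of `J`. -/
def powTorsion (M : Type u) [AddCommGroup M] [Module R M] : Submodule R M where
  carrier := {u | IsPowTorsion J u}
  zero_mem' := ⟨0, fun c _ => smul_zero c⟩
  add_mem' := by
    rintro a b ⟨k, hk⟩ ⟨l, hl⟩
    refine ⟨k + l, fun c hc => ?_⟩
    rw [smul_add, hk c (Ideal.pow_le_pow_right (by lia) hc),
      hl c (Ideal.pow_le_pow_right (by lia) hc), add_zero]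
  smul_mem' := by
    rintro r a ⟨k, hk⟩
    exact ⟨k, fun c hc => by rw [smul_comm, hk c hc, smul_zero]⟩

theorem mem_powTorsion {u : M} : u ∈ powTorsion J M ↔ IsPowTorsion J u := Iff.rfl

/-- The map `R/J^k → M` sending `1` to `u`. -/
def quotPowLift {k : ℕ} (u : M) (hu : ∀ c ∈ J ^ k, c • u = 0) : (R ⧸ J ^ k) →ₗ[R] M :=
  Submodule.liftQ _ (LinearMap.toSpanSingleton R M u) fun c hc => hu c hc

theorem quotPow_hom_ext {k : ℕ} {f g : (R ⧸ J ^ k) →ₗ[R] M}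
    (h : f (Submodule.Quotient.mk 1) = g (Submodule.Quotient.mk 1)) : f = g := by
  apply Submodule.linearMap_qext
  ext
  exact h

namespace LC

theorem smul_eq_zero_of_powTorsion {r : R} (h : ∀ u : M, IsPowTorsion J u → r • u = 0)
    (z : LC J 0 M) : r • z = 0 := by
  obtain ⟨k, f, rfl⟩ := exists_ofHom_eq J z
  have hf : r • f = 0 := LinearMap.ext fun u => h _ (isPowTorsion_apply_quotient_pow J f u)
  rw [← map_smul, hf, map_zero]

theorem map_zero_surjective {g : M →ₗ[R] N} (hg : Function.Surjective g)
    (hM : ∀ u : M, IsPowTorsion J u) : Function.Surjective (map J 0 g) := by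
  intro z
  obtain ⟨k, f, rfl⟩ := exists_ofHom_eq J z
  obtain ⟨u, hu⟩ := hg (f (Submodule.Quotient.mk 1))
  obtain ⟨l, hl⟩ := hM u
  refine ⟨ofHom J (k + l) (quotPowLift J u
    fun c hc => hl c (Ideal.pow_le_pow_right (Nat.le_add_left l k) hc)), ?_⟩
  rw [map_ofHom, ← ofHom_comp_factor J (Nat.le_add_right k l) f]
  congr 1
  apply quotPow_hom_ext
  change g ((1 : R) • u) = f (Submodule.Quotient.mk 1)
  rw [one_smul, hu]

theorem exists_injective_embedding (M : Type u) [AddCommGroup M] [Module R M] :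
    ∃ (E : Type u) (_ : AddCommGroup E) (_ : Module R E) (_ : Module.Injective R E)
      (f : M →ₗ[R] E), Function.Injective f := by
  let p := (EnoughInjectives.presentation (ModuleCat.of R M)).some
  have : Injective (ModuleCat.of R p.J) := p.injective
  exact ⟨p.J, inferInstance, inferInstance, Module.injective_module_of_injective_object R p.J,
    p.f.hom, (ModuleCat.mono_iff_injective _).1 p.mono⟩

theorem isPowTorsion (i : ℕ) (z : LC J i M) : IsPowTorsion J z := by
  induction i generalizing M with
  | zero =>
    obtain ⟨k, f, rfl⟩ := exists_ofHom_eq J z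
    refine ⟨k, fun c hc => ?_⟩
    have hf : c • f = 0 := LinearMap.ext fun u => by
      rw [LinearMap.smul_apply, ← map_smul, isPowTorsion_quotient_pow J u c hc, map_zero,
        LinearMap.zero_apply]
    rw [← map_smul, hf, map_zero]
  | succ i ih =>
    obtain ⟨E, _, _, _, f, hf⟩ := exists_injective_embedding (R := R) M
    obtain ⟨δ, -, -, h⟩ := exists_exact J hf (Submodule.mkQ_surjective (LinearMap.range f))
      (LinearMap.exact_map_mkQ_range f) i
    have := subsingleton_of_injective J i (M := E)
    obtain ⟨w, rfl⟩ := (h z).1 (Subsingleton.elim _ _)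
    exact (ih w).map J δ

theorem injective_powTorsion [IsNoetherianRing R] (E : Type u) [AddCommGroup E] [Module R E]
    [Module.Injective R E] : Module.Injective R (powTorsion J E) := by
  apply Module.Baer.injective
  intro I φ
  obtain ⟨k, hk⟩ : ∃ k, ∀ c ∈ J ^ k, ∀ a : I, c • φ a = 0 := by
    obtain ⟨s, hs⟩ := (Submodule.fg_top I).2 (IsNoetherian.noetherian I)
    choose k hk using fun a : I => (φ a).2
    refine ⟨s.sup k, fun c hc a => ?_⟩
    have : (⊤ : Submodule R I) ≤ LinearMap.ker (c • φ) := by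
      rw [← hs, Submodule.span_le]
      intro b hb
      exact Subtype.ext (hk b c (Ideal.pow_le_pow_right (Finset.le_sup hb) hc))
    exact this trivial
  obtain ⟨n, hn⟩ := Ideal.exists_pow_inf_eq_pow_smul J I
  let K : Ideal R := J ^ (n + k)
  have hK : Submodule.comap I.subtype K ≤ LinearMap.ker ((powTorsion J E).subtype ∘ₗ φ) := by
    have key : ∀ a ∈ J ^ k • (J ^ n • (⊤ : Ideal R) ⊓ I), ∃ h : a ∈ I, φ ⟨a, h⟩ = 0 := by
      intro a ha
      induction ha using Submodule.smul_induction_on' with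
      | smul c hc b hb =>
        exact ⟨I.smul_mem c hb.2, by
          rw [← hk c hc ⟨b, hb.2⟩, ← map_smul]; rfl⟩
      | add a _ b _ h1 h2 =>
        obtain ⟨ha, ha'⟩ := h1
        obtain ⟨hb, hb'⟩ := h2
        refine ⟨I.add_mem ha hb, ?_⟩
        have := map_add φ ⟨a, ha⟩ ⟨b, hb⟩
        rw [ha', hb', add_zero] at this
        exact this
    rintro ⟨a, haI⟩ (ha : a ∈ J ^ (n + k))
    obtain ⟨h, h0⟩ := key a (by
      have h1 := hn (n + k) (Nat.le_add_right _ _)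
      rw [Nat.add_sub_cancel_left] at h1
      rw [← h1]
      exact ⟨by simpa using ha, haI⟩)
    exact congrArg Subtype.val h0
  let ι : (I ⧸ Submodule.comap I.subtype K) →ₗ[R] R ⧸ K :=
    Submodule.mapQ _ _ I.subtype le_rfl
  have hι : Function.Injective ι := by
    rw [← LinearMap.ker_eq_bot]
    exact Submodule.ker_liftQ_eq_bot _ _ _ (by rw [LinearMap.ker_comp, Submodule.ker_mkQ])
  obtain ⟨ψ, hψ⟩ := Module.Injective.out (R := R) ι hι
    (Submodule.liftQ _ ((powTorsion J E).subtype ∘ₗ φ) hK)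
  refine ⟨LinearMap.codRestrict _ (ψ ∘ₗ K.mkQ) fun c => 
    isPowTorsion_apply_quotient_pow J ψ _, fun a ha => Subtype.ext ?_⟩
  exact hψ (Submodule.Quotient.mk ⟨a, ha⟩)

theorem subsingleton_of_map_surjective [IsNoetherianRing R] (i : ℕ)
    (hM : ∀ u : M, IsPowTorsion J u)
    (h : ∀ (G Q : Type u) [AddCommGroup G] [AddCommGroup Q] [Module R G] [Module R Q]
      (g : G →ₗ[R] Q), Function.Surjective g → (∀ u : G, IsPowTorsion J u) →
        Function.Surjective (map J i g)) : Subsingleton (LC J (i + 1) M) := by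
  obtain ⟨E, _, _, _, f, hf⟩ := exists_injective_embedding (R := R) M
  have hG := injective_powTorsion J E
  let f' : M →ₗ[R] powTorsion J E := LinearMap.codRestrict _ f fun u => (hM u).map J f
  have hf' : Function.Injective f' := fun a b hab => hf (congrArg Subtype.val hab)
  obtain ⟨δ, -, h0, h1⟩ := exists_exact J hf' (Submodule.mkQ_surjective (LinearMap.range f'))
    (LinearMap.exact_map_mkQ_range f') i
  have htG : ∀ u : powTorsion J E, IsPowTorsion J u := fun u => by
    obtain ⟨k, hk⟩ := u.2
    exact ⟨k, fun c hc => Subtype.ext (hk c hc)⟩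
  have := subsingleton_of_injective J i (M := powTorsion J E)
  refine subsingleton_of_forall_eq 0 fun z => ?_
  obtain ⟨w, rfl⟩ := (h1 z).1 (Subsingleton.elim _ _)
  obtain ⟨v, rfl⟩ := h _ _ _ (Submodule.mkQ_surjective _) htG w
  exact h0.apply_apply_eq_zero v

theorem subsingleton_succ_of_isPowTorsion [IsNoetherianRing R] (i : ℕ)
    (hM : ∀ u : M, IsPowTorsion J u) : Subsingleton (LC J (i + 1) M) := by
  induction i generalizing M with
  | zero =>
    refine subsingleton_of_map_surjective J 0 hM fun G Q _ _ _ _ g hg hG => ?_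
    exact map_zero_surjective J hg hG
  | succ i ih =>
    refine subsingleton_of_map_surjective J (i + 1) hM fun G Q _ _ _ _ g hg hG z => ?_
    have := ih (M := Q) fun u => by
      obtain ⟨v, rfl⟩ := hg u
      exact (hG v).map J g
    exact ⟨0, Subsingleton.elim _ _⟩

end LC
end LCTorsion

section LCFinite

variable {R : Type u} [CommRing R] (J : Ideal R)
variable {M L : Type u} [AddCommGroup M] [Module R M] [AddCommGroup L] [Module R L]

namespace LC

theorem map_id (i : ℕ) (z : LC J i M) : map J i (LinearMap.id : M →ₗ[R] M) z = z := by
  have := map_smul_id J i (1 : R) z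
  rwa [one_smul, one_smul] at this

theorem subsingleton_of_bijective {x : R} (hx : x ∈ J)
    (h : Function.Bijective (x • LinearMap.id : L →ₗ[R] L)) (i : ℕ) : Subsingleton (LC J i L) := by
  have hinj (z : LC J i L) (hz : x • z = 0) : z = 0 := by
    have h1 := map_comp J i (x • LinearMap.id : L →ₗ[R] L)
      (LinearEquiv.ofBijective _ h).symm.toLinearMap
    have h2 : (LinearEquiv.ofBijective _ h).symm.toLinearMap ∘ₗ (x • LinearMap.id : L →ₗ[R] L) =
        LinearMap.id :=
      LinearMap.ext fun u => (LinearEquiv.ofBijective _ h).symm_apply_apply u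
    rw [h2] at h1
    rw [← map_id J i z, h1, LinearMap.comp_apply, map_smul_id, hz, map_zero]
  refine subsingleton_of_forall_eq 0 fun z => ?_
  obtain ⟨k, hk⟩ := isPowTorsion J i z
  have := hk _ (Ideal.pow_mem_pow hx k)
  clear hk
  induction k with
  | zero => rwa [pow_zero, one_smul] at this
  | succ k ih => exact ih (hinj _ (by rwa [smul_smul, ← pow_succ']))

theorem injective_map_of_ker [IsNoetherianRing R] {f : M →ₗ[R] L} (hf : Function.Surjective f)
    (hker : ∀ u, f u = 0 → IsPowTorsion J u) (i : ℕ) : Function.Injective (map J (i + 1) f) := by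
  have hK : ∀ u : LinearMap.ker f, IsPowTorsion J u := fun u => by
    obtain ⟨k, hk⟩ := hker u u.2
    exact ⟨k, fun c hc => Subtype.ext (hk c hc)⟩
  have := subsingleton_succ_of_isPowTorsion J i hK
  have hex := exact_map J (LinearMap.ker f).injective_subtype hf
    (LinearMap.exact_subtype_ker_map f) (i + 1)
  rw [injective_iff_map_eq_zero]
  intro z hz
  obtain ⟨w, rfl⟩ := (hex z).1 hz
  rw [Subsingleton.elim w 0, map_zero]

theorem smul_eq_zero_succ [IsNoetherianRing R] (f : M →ₗ[R] L)
    (hker : ∀ u, f u = 0 → IsPowTorsion J u) {x : R} (hx : x ∈ J)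
    (hL : Function.Bijective (x • LinearMap.id : L →ₗ[R] L)) {r : R} {i : ℕ}
    (hr : ∀ z : LC J i (L ⧸ LinearMap.range f), r • z = 0) (z : LC J (i + 1) M) : r • z = 0 := by
  have hinj := injective_map_of_ker J (f := f.rangeRestrict) f.surjective_rangeRestrict
    (fun u hu => hker u (congrArg Subtype.val hu)) i
  apply hinj
  rw [map_smul, map_zero]
  have := subsingleton_of_bijective J hx hL (i + 1)
  obtain ⟨δ, -, -, h⟩ := exists_exact J (LinearMap.range f).injective_subtype
    (Submodule.mkQ_surjective (LinearMap.range f))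
    (LinearMap.exact_subtype_mkQ _) i
  obtain ⟨w, hw⟩ := (h (map J (i + 1) f.rangeRestrict z)).1 (Subsingleton.elim _ _)
  rw [← hw, ← map_smul, hr, map_zero]

end LC

end LCFinite

section LCFiniteLength

variable {R : Type u} [CommRing R] [IsLocalRing R] [IsNoetherianRing R]
variable {M : Type u} [AddCommGroup M] [Module R M]

theorem isFiniteLength_of_pow_smul_eq_zero [Module.Finite R M] {k : ℕ}
    (h : ∀ c ∈ maximalIdeal R ^ k, ∀ u : M, c • u = 0) : IsFiniteLength R M := by
  have hR := isFiniteLength_iff_isNoetherian_isArtinian.1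
    (Module.length_ne_top_iff.1 (length_quotient_ne_top (le_refl (maximalIdeal R ^ k))))
  have := hR.2
  obtain ⟨n, f, hf⟩ := Module.Finite.exists_fin' R M
  let g : (Fin n → R ⧸ maximalIdeal R ^ k) →ₗ[R] M :=
    ∑ i, quotPowLift (maximalIdeal R) (f (Pi.single i 1)) (fun c hc => h c hc _) ∘ₗ
      LinearMap.proj i
  have hg : Function.Surjective g := by
    intro u
    obtain ⟨a, rfl⟩ := hf u
    refine ⟨fun i => Submodule.Quotient.mk (a i), ?_⟩
    conv_rhs => rw [← Finset.univ_sum_single a, map_sum]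
    rw [LinearMap.sum_apply]
    refine Finset.sum_congr rfl fun i _ => ?_
    change a i • f (Pi.single i 1) = _
    rw [← map_smul, ← Pi.single_smul, smul_eq_mul, mul_one]
  exact isFiniteLength_iff_isNoetherian_isArtinian.2
    ⟨inferInstance, isArtinian_of_surjective _ g hg⟩

namespace LC

theorem isFiniteLength_zero [Module.Finite R M] : IsFiniteLength R (LC (maximalIdeal R) 0 M) := by
  let G := powTorsion (maximalIdeal R) M
  obtain ⟨k, hk⟩ : ∃ k, ∀ c ∈ maximalIdeal R ^ k, ∀ u : G, c • u = 0 := by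
    obtain ⟨s, hs⟩ := (Submodule.fg_top G).2 (IsNoetherian.noetherian G)
    choose k hk using fun a : G => a.2
    refine ⟨s.sup k, fun c hc a => ?_⟩
    have : (⊤ : Submodule R G) ≤ LinearMap.ker (c • (LinearMap.id : G →ₗ[R] G)) := by
      rw [← hs, Submodule.span_le]
      intro b hb
      exact Subtype.ext (hk b c (Ideal.pow_le_pow_right (Finset.le_sup hb) hc))
    exact this trivial
  have hG : IsFiniteLength R G := isFiniteLength_of_pow_smul_eq_zero hk
  let Φ : G →ₗ[R] LC (maximalIdeal R) 0 M := ofHom (maximalIdeal R) k ∘ₗ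
    { toFun := fun u => quotPowLift (maximalIdeal R) (u : M)
        fun c hc => congrArg Subtype.val (hk c hc u)
      map_add' := fun u v => quotPow_hom_ext _ (by
        change (1 : R) • ((u + v : G) : M) = (1 : R) • (u : M) + (1 : R) • (v : M)
        simp)
      map_smul' := fun r u => quotPow_hom_ext _ (by
        change (1 : R) • ((r • u : G) : M) = r • (1 : R) • (u : M)
        simp) }
  refine hG.of_surjective (f := Φ) fun z => ?_
  obtain ⟨l, f, rfl⟩ := exists_ofHom_eq (maximalIdeal R) z
  have hu := isPowTorsion_apply_quotient_pow (maximalIdeal R) f (Submodule.Quotient.mk 1)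
  refine ⟨⟨_, hu⟩, ?_⟩
  change ofHom _ k _ = _
  rw [← ofHom_comp_factor _ (Nat.le_add_right k l), ← ofHom_comp_factor _ (Nat.le_add_left l k) f]
  congr 1
  apply quotPow_hom_ext
  change (1 : R) • f (Submodule.Quotient.mk 1) = f (Submodule.Quotient.mk 1)
  rw [one_smul]

omit [IsLocalRing R] in
theorem powTorsion_mkQ_eq_zero (J : Ideal R) (u : M ⧸ powTorsion J M) (h : ∀ c ∈ J, c • u = 0) :
    u = 0 := by
  obtain ⟨v, rfl⟩ := Submodule.mkQ_surjective _ u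
  obtain ⟨s, hs⟩ := IsNoetherian.noetherian J
  have hv : ∀ c ∈ J, IsPowTorsion J (c • v) := fun c hc => by
    rw [← mem_powTorsion, ← Submodule.Quotient.mk_eq_zero]
    exact h c hc
  choose! k hk using hv
  have key : ∀ c ∈ J, ∀ e ∈ J ^ s.sup k, e • c • v = 0 := by
    intro c hc e he
    rw [← hs] at hc
    induction hc using Submodule.span_induction with
    | mem x hx =>
      exact hk x (hs ▸ Submodule.subset_span hx) e (Ideal.pow_le_pow_right (Finset.le_sup hx) he)
    | zero => simp
    | add x y _ _ h1 h2 => rw [add_smul, smul_add, h1, h2, add_zero]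
    | smul a x _ h1 => rw [smul_assoc, smul_comm, h1, smul_zero]
  refine (Submodule.Quotient.mk_eq_zero _).2 ⟨s.sup k + 1, fun c hc => ?_⟩
  rw [pow_succ] at hc
  induction hc using Submodule.mul_induction_on' with
  | mem_mul_mem e he c hc => rw [mul_smul, key c hc e he]
  | add x _ y _ h1 h2 => rw [add_smul, h1, h2, add_zero]

theorem exists_mem_pow_isSMulRegular [Module.Finite R M]
    (h : ∀ u : M, (∀ c ∈ maximalIdeal R, c • u = 0) → u = 0) (a : ℕ) :
    ∃ y ∈ maximalIdeal R ^ a, Function.Injective (y • LinearMap.id : M →ₗ[R] M) := by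
  by_contra! hcon
  have hsub : ((maximalIdeal R ^ a : Ideal R) : Set R) ⊆
      ⋃ p ∈ associatedPrimes R M, (p : Set R) := by
    rw [biUnion_associatedPrimes_eq_zero_divisors]
    intro y hy
    have := hcon y hy
    rw [injective_iff_map_eq_zero] at this
    push Not at this
    obtain ⟨u, h1, h2⟩ := this
    exact ⟨u, h2, h1⟩
  obtain ⟨p, hp, hle⟩ := (Ideal.subset_union_prime_finite (associatedPrimes.finite R M)
    (f := id) ⊥ ⊥ (fun p hp _ _ => hp.isPrime)).1 hsub
  have := hp.isPrime
  have hm := this.le_of_pow_le hle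
  rw [AssociatedPrimes.mem_iff, isAssociatedPrime_iff] at hp
  obtain ⟨-, u, rfl⟩ := hp
  refine this.ne_top ?_
  have h0 : u = 0 := h u fun c hc => by simpa using hm hc
  rw [h0]
  ext
  simp

theorem isFiniteLength [Module.Finite R M] (i a : ℕ)
    (h : ∀ i' ≤ i, ∀ c ∈ maximalIdeal R ^ a, ∀ z : LC (maximalIdeal R) i' M, c • z = 0) :
    IsFiniteLength R (LC (maximalIdeal R) i M) := by
  induction i generalizing M a with
  | zero => exact isFiniteLength_zero
  | succ i ih =>
    let G := powTorsion (maximalIdeal R) M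
    have hG : ∀ u : G, IsPowTorsion (maximalIdeal R) u := fun u => by
      obtain ⟨k, hk⟩ := u.2
      exact ⟨k, fun c hc => Subtype.ext (hk c hc)⟩
    have hinj := injective_map_of_ker (maximalIdeal R) (Submodule.mkQ_surjective G)
      (fun u hu => (Submodule.Quotient.mk_eq_zero G).1 hu) i
    refine IsFiniteLength.of_injective ?_ hinj
    have hQ : ∀ i' ≤ i + 1, ∀ c ∈ maximalIdeal R ^ a,
        ∀ z : LC (maximalIdeal R) i' (M ⧸ G), c • z = 0 := by
      intro i' hi' c hc z
      obtain ⟨δ, -, h1, -⟩ := exists_exact (maximalIdeal R) G.injective_subtype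
        (Submodule.mkQ_surjective G) (LinearMap.exact_subtype_mkQ G) i'
      have := subsingleton_succ_of_isPowTorsion (maximalIdeal R) i' hG
      obtain ⟨w, rfl⟩ := (h1 z).1 (Subsingleton.elim _ _)
      rw [← map_smul, h i' hi' c hc, map_zero]
    obtain ⟨y, hy, hreg⟩ := exists_mem_pow_isSMulRegular
      (fun u hu => powTorsion_mkQ_eq_zero (maximalIdeal R) (M := M) u hu) a
    let f : (M ⧸ G) →ₗ[R] M ⧸ G := y • LinearMap.id
    have hex := fun i' => exists_exact (maximalIdeal R) (f := f) hreg
      (Submodule.mkQ_surjective (LinearMap.range f)) (LinearMap.exact_map_mkQ_range f) i'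
    obtain ⟨δ, -, -, h2⟩ := hex i
    refine IsFiniteLength.of_surjective (ih (M := (M ⧸ G) ⧸ LinearMap.range f) (a + a) ?_) (f := δ)
      fun z => (h2 z).1 ?_
    · intro i' hi' c hc z
      obtain ⟨δ', -, h1, -⟩ := hex i'
      rw [pow_add] at hc
      induction hc using Submodule.mul_induction_on' with
      | mem_mul_mem e he c hc =>
        obtain ⟨w, hw⟩ := (h1 (c • z)).1
          (by rw [map_smul]; exact hQ _ (Nat.succ_le_succ hi') c hc _)
        rw [mul_smul, ← hw, ← map_smul, hQ _ (hi'.trans (Nat.le_succ i)) e he, map_zero]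
      | add x _ y _ h1 h2 => rw [add_smul, h1, h2, add_zero]
    · change map _ _ (y • LinearMap.id) z = 0
      rw [map_smul_id]
      exact hQ _ le_rfl y hy z

end LC
end LCFiniteLength

section TopCech

variable {R : Type u} [CommRing R]

/-- `M` is the top Čech cohomology module of `R` with respect to `x 0, …, x (j - 1)`, and
`sym n a` is the class of the fraction `a / (x 0 ⋯ x (j - 1)) ^ n`. -/
structure IsTopCech (x : ℕ → R) (j : ℕ) {M : Type u} [AddCommGroup M] [Module R M]
    (sym : ℕ → R →ₗ[R] M) : Prop where
  exists_eq : ∀ u, ∃ n a, sym n a = u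
  succ : ∀ n a, sym (n + 1) ((∏ i ∈ Finset.range j, x i) * a) = sym n a
  eq_zero_iff : ∀ n a, sym n a = 0 ↔ ∃ e, (∏ i ∈ Finset.range j, x i) ^ e * a ∈ cpow x (n + e) j

theorem isTopCech_zero (x : ℕ → R) : IsTopCech x 0 (fun _ => (LinearMap.id : R →ₗ[R] R)) where
  exists_eq u := ⟨0, u, rfl⟩
  succ n a := by simp
  eq_zero_iff n a := by simp [cpow_zero]

theorem prod_pow_mul_mem_cpow (x : ℕ → R) {n j : ℕ} (e : ℕ) {a : R} (ha : a ∈ cpow x n j) :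
    (∏ i ∈ Finset.range j, x i) ^ e * a ∈ cpow x (n + e) j := by
  have h : cpow x n j ≤
      Submodule.comap (LinearMap.mulLeft R ((∏ i ∈ Finset.range j, x i) ^ e))
        (cpow x (n + e) j) := by
    rw [cpow_le_iff]
    intro i hi
    change (∏ i ∈ Finset.range j, x i) ^ e * x i ^ n ∈ cpow x (n + e) j
    rw [← Finset.mul_prod_erase _ x (Finset.mem_range.2 hi), mul_pow, mul_right_comm, ← pow_add,
      Nat.add_comm e n]
    exact Ideal.mul_mem_right _ _ (pow_mem_cpow x (n + e) hi)
  exact h ha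

namespace IsTopCech

variable {x : ℕ → R} {j : ℕ} {M : Type u} [AddCommGroup M] [Module R M] {sym : ℕ → R →ₗ[R] M}
  (S : IsTopCech x j sym)
include S

theorem add (n k : ℕ) (a : R) : sym (n + k) ((∏ i ∈ Finset.range j, x i) ^ k * a) = sym n a := by
  induction k with
  | zero => simp
  | succ k ih => rw [← ih, pow_succ', mul_assoc, ← Nat.add_assoc, S.succ]

theorem exists_ge_eq (N : ℕ) (u : M) : ∃ k a, sym (N + k) a = u := by
  obtain ⟨n, a, rfl⟩ := S.exists_eq u
  exact ⟨n, _, by rw [Nat.add_comm]; exact S.add n N a⟩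

theorem eq_zero_of_mem {n : ℕ} {a : R} (ha : a ∈ cpow x n j) : sym n a = 0 :=
  (S.eq_zero_iff n a).2 ⟨0, by simpa using ha⟩

theorem exists_next :
    ∃ (L : Type u) (_ : AddCommGroup L) (_ : Module R L) (f : M →ₗ[R] L)
      (sym' : ℕ → R →ₗ[R] L ⧸ LinearMap.range f),
      Function.Bijective (x j • LinearMap.id : L →ₗ[R] L) ∧
      (∀ u, f u = 0 → ∃ k, x j ^ k • u = 0) ∧ IsTopCech x (j + 1) sym' := by
  let T := Submonoid.powers (x j)
  let L := LocalizedModule T M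
  let f : M →ₗ[R] L := LocalizedModule.mkLinearMap T M
  have hf : ∀ u, f u = 0 ↔ ∃ k, x j ^ k • u = 0 := by
    intro u
    rw [IsLocalizedModule.eq_zero_iff T f]
    constructor
    · rintro ⟨⟨_, k, rfl⟩, h⟩
      exact ⟨k, h⟩
    · rintro ⟨k, h⟩
      exact ⟨⟨_, k, rfl⟩, h⟩
  have hsurj : ∀ l : L, ∃ k u, x j ^ k • l = f u := by
    intro l
    obtain ⟨⟨u, ⟨_, k, rfl⟩⟩, h⟩ := IsLocalizedModule.surj T f l
    exact ⟨k, u, h⟩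
  have hbij : Function.Bijective (x j • LinearMap.id : L →ₗ[R] L) :=
    (Module.End.isUnit_iff _).1 
      (IsLocalizedModule.map_units f (⟨x j, Submonoid.mem_powers _⟩ : T))
  let g : L →ₗ[R] L := (LinearEquiv.ofBijective _ hbij).symm.toLinearMap
  have hxg : ∀ l, x j • g l = l := fun l => (LinearEquiv.ofBijective _ hbij).apply_symm_apply l
  have hxgn : ∀ n l, x j ^ n • (g ^ n) l = l := by
    intro n
    induction n with
    | zero => simp
    | succ n ih =>
      intro l
      rw [pow_succ, mul_smul, pow_succ', Module.End.mul_apply, hxg, ih]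
  have hinj : ∀ n (l l' : L), x j ^ n • l = x j ^ n • l' → l = l' := by
    intro n
    induction n with
    | zero => simp
    | succ n ih =>
      intro l l' h
      rw [pow_succ', mul_smul, mul_smul] at h
      exact ih _ _ (hbij.1 h)
  refine ⟨L, inferInstance, inferInstance, f,
    fun n => (LinearMap.range f).mkQ ∘ₗ (g ^ n) ∘ₗ f ∘ₗ sym n, hbij, fun u => (hf u).1, ?_, ?_, ?_⟩
  · intro v
    obtain ⟨l, rfl⟩ := Submodule.mkQ_surjective _ v
    obtain ⟨k, u, hu⟩ := hsurj l
    obtain ⟨m, a, rfl⟩ := S.exists_ge_eq k u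
    refine ⟨k + m, x j ^ m * a, ?_⟩
    change (LinearMap.range f).mkQ ((g ^ (k + m)) (f (sym (k + m) (x j ^ m • a)))) = _
    congr 1
    apply hinj (k + m)
    rw [hxgn, map_smul, map_smul, ← hu, smul_smul, ← pow_add, Nat.add_comm m k]
  · intro n a
    change (LinearMap.range f).mkQ ((g ^ (n + 1)) (f (sym (n + 1) _))) =
      (LinearMap.range f).mkQ ((g ^ n) (f (sym n a)))
    congr 1
    apply hinj (n + 1)
    rw [hxgn, Finset.prod_range_succ, mul_assoc, S.succ, pow_succ', mul_smul, hxgn, ← smul_eq_mul,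
      map_smul, map_smul]
  · intro n a
    change (LinearMap.range f).mkQ ((g ^ n) (f (sym n a))) = 0 ↔ _
    rw [Submodule.mkQ_apply, Submodule.Quotient.mk_eq_zero]
    have h1 : (g ^ n) (f (sym n a)) ∈ LinearMap.range f ↔
        ∃ b e, x j ^ e • (sym n a - x j ^ n • b) = 0 := by
      constructor
      · rintro ⟨b, hb⟩
        refine ⟨b, (hf _).1 ?_⟩
        rw [map_sub, map_smul, hb, hxgn, sub_self]
      · rintro ⟨b, hb⟩
        refine ⟨b, hinj n _ _ ?_⟩
        have := (hf _).2 hb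
        rw [map_sub, map_smul, sub_eq_zero] at this
        rw [hxgn, this]
    rw [h1, Finset.prod_range_succ]
    constructor
    · rintro ⟨b, e, h⟩
      obtain ⟨k, b, rfl⟩ := S.exists_ge_eq (n + e) b
      rw [Nat.add_assoc, ← S.add n (e + k), ← map_smul, ← map_sub, ← map_smul, S.eq_zero_iff] at h
      obtain ⟨l, hl⟩ := h
      refine ⟨e + k + l, mem_cpow_succ.2 
        ⟨(∏ i ∈ Finset.range j, x i) ^ l * b, _, Ideal.mul_mem_left _ (x j ^ (k + l))
          (by rwa [Nat.add_assoc] at hl), ?_⟩⟩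
      simp only [smul_eq_mul]
      ring
    · rintro ⟨e, h⟩
      obtain ⟨c, q, hq, h⟩ := mem_cpow_succ.1 h
      refine ⟨sym (n + e) c, e, ?_⟩
      rw [← S.add n e, ← map_smul, ← map_sub, ← map_smul]
      convert S.eq_zero_of_mem hq using 2
      simp only [smul_eq_mul]
      rw [mul_pow, pow_add] at h
      linear_combination h

theorem exists_mem_sat [IsLocalRing R] [IsNoetherianRing R] {u : M} (hu : IsPowTorsion (maximalIdeal R) u) (N : ℕ) :
    ∃ n ≥ N, ∃ a ∈ satIdeal (cpow x n j), sym n a = u := by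
  obtain ⟨m, a, rfl⟩ := S.exists_ge_eq N u
  obtain ⟨k, hk⟩ := hu
  obtain ⟨s, hs⟩ := IsNoetherian.noetherian (maximalIdeal R ^ k)
  have hk' : ∀ c ∈ s, ∃ e, (∏ i ∈ Finset.range j, x i) ^ e * (c * a) ∈ cpow x (N + m + e) j := by
    intro c hc
    rw [← S.eq_zero_iff, ← smul_eq_mul, map_smul]
    exact hk c (hs ▸ Submodule.subset_span hc)
  choose! e he using hk'
  refine ⟨N + m + s.sup e, by lia, _, mem_satIdeal.2 ⟨k, ?_⟩, S.add (N + m) (s.sup e) a⟩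
  intro c hc
  rw [← hs] at hc
  induction hc using Submodule.span_induction with
  | mem c hc =>
    have h1 := prod_pow_mul_mem_cpow x (s.sup e - e c) (he c hc)
    rw [← mul_assoc, ← pow_add, Nat.sub_add_cancel (Finset.le_sup hc), Nat.add_assoc,
      Nat.add_sub_cancel' (Finset.le_sup hc)] at h1
    rwa [mul_left_comm]
  | zero => simp
  | add y z _ _ h1 h2 => rw [add_mul]; exact add_mem h1 h2
  | smul b y _ h1 => rw [smul_eq_mul, mul_assoc]; exact Ideal.mul_mem_left _ _ h1

end IsTopCech

end TopCech

section Vanishing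

variable {R : Type u} [CommRing R] [IsLocalRing R] [IsNoetherianRing R]
variable {d : ℕ} {x : ℕ → R} (H : IsColonSeq d x)
include H

namespace IsTopCech

variable {j : ℕ} {M : Type u} [AddCommGroup M] [Module R M] {sym : ℕ → R →ₗ[R] M}
  (S : IsTopCech x j sym)
include S

theorem isPowTorsion_of_pow_smul {u : M} (hj : j < d) {k : ℕ} (hu : x j ^ k • u = 0) :
    IsPowTorsion (maximalIdeal R) u := by
  obtain ⟨m, a, rfl⟩ := S.exists_ge_eq 1 u
  rw [← map_smul, S.eq_zero_iff] at hu
  obtain ⟨e, he⟩ := hu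
  rw [smul_eq_mul, mul_left_comm] at he
  obtain ⟨l, hl⟩ := mem_satIdeal.1 (H.mem_sat_cpow (n := 1 + m + e) (by lia) le_rfl hj he)
  refine ⟨l, fun c hc => ?_⟩
  rw [← S.add _ e, ← map_smul]
  exact S.eq_zero_of_mem (hl c hc)

omit [IsNoetherianRing R] in
theorem isPowTorsion_top (hj : j = d) (u : M) : IsPowTorsion (maximalIdeal R) u := by
  subst hj
  obtain ⟨m, a, rfl⟩ := S.exists_eq u
  obtain ⟨k, hk⟩ := H.primary fun _ => m
  refine ⟨k, fun c hc => ?_⟩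
  rw [← map_smul]
  exact S.eq_zero_of_mem (Ideal.mul_mem_right _ _ (hk hc))

theorem smul_eq_zero_of_isPowTorsion {r : R} {n₀ : ℕ}
    (hr : ∀ n ≥ n₀, ∀ j, j + 2 ≤ d → ∀ u ∈ satIdeal (cpow x n (j + 1)),
      r * u ∈ satIdeal (cpow x n j) ⊔ cpow x n (j + 1)) (hj : j < d) {u : M}
    (hu : IsPowTorsion (maximalIdeal R) u) : r • u = 0 := by
  obtain ⟨n, hn, a, ha, rfl⟩ := S.exists_mem_sat hu (n₀ + 1)
  rcases j with - | j
  · obtain ⟨k, hk⟩ := mem_satIdeal.1 ha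
    have h0 : a = 0 := by
      refine H.nzd_pow hj ?_ (N := k)
      simpa [cpow_zero] using hk _ (Ideal.pow_mem_pow (H.mem _ hj) k)
    rw [h0, map_zero, smul_zero]
  · obtain ⟨s, hs, q, hq, h⟩ := Submodule.mem_sup.1 (hr n (by lia) j hj a ha)
    rw [← map_smul, smul_eq_mul, ← h, map_add, S.eq_zero_of_mem hq, add_zero, ← S.succ,
      Finset.prod_range_succ, mul_assoc]
    apply S.eq_zero_of_mem
    have := prod_pow_mul_mem_cpow x 1 (H.mul_mem_cpow (n := n) (by lia) le_rfl (by lia) hs)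
    rw [pow_one] at this
    exact cpow_mono _ _ (Nat.le_succ j) this

end IsTopCech

theorem IsTopCech.smul_localCohomology_eq_zero {r : R} {n₀ : ℕ}
    (hr : ∀ n ≥ n₀, ∀ j, j + 2 ≤ d → ∀ u ∈ satIdeal (cpow x n (j + 1)),
      r * u ∈ satIdeal (cpow x n j) ⊔ cpow x n (j + 1)) (i : ℕ) {j : ℕ} {M : Type u}
    [AddCommGroup M] [Module R M] {sym : ℕ → R →ₗ[R] M} (S : IsTopCech x j sym)
    (hij : i + j < d) (z : LC (maximalIdeal R) i M) : r • z = 0 := by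
  induction i generalizing j M with
  | zero =>
    exact LC.smul_eq_zero_of_powTorsion _
      (fun u hu => S.smul_eq_zero_of_isPowTorsion H hr (by lia) hu) z
  | succ i ih =>
    obtain ⟨L, _, _, f, sym', hb, hk, S'⟩ := S.exists_next
    refine LC.smul_eq_zero_succ _ f (fun u hu => ?_) (H.mem j (by lia)) hb
      (fun z => ih S' (by lia) z) z
    obtain ⟨k, hk⟩ := hk u hu
    exact S.isPowTorsion_of_pow_smul H (by lia) hk

theorem IsTopCech.localCohomology_eq_zero (k : ℕ) {i j : ℕ} {M : Type u}
    [AddCommGroup M] [Module R M] {sym : ℕ → R →ₗ[R] M} (S : IsTopCech x j sym)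
    (hj : j + k = d) (hi : k < i) (z : LC (maximalIdeal R) i M) : z = 0 := by
  induction k generalizing i j M with
  | zero =>
    obtain ⟨i, rfl⟩ := Nat.exists_eq_succ_of_ne_zero hi.ne'
    have := LC.subsingleton_succ_of_isPowTorsion (maximalIdeal R) i (S.isPowTorsion_top H hj)
    exact Subsingleton.elim _ _
  | succ k ih =>
    obtain ⟨i, rfl⟩ := Nat.exists_eq_succ_of_ne_zero (Nat.ne_zero_of_lt hi)
    obtain ⟨L, _, _, f, sym', hb, hk, S'⟩ := S.exists_next
    rw [← one_smul R z]
    refine LC.smul_eq_zero_succ _ f (fun u hu => ?_) (H.mem j (by lia)) hb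
      (fun z => by rw [one_smul]; exact ih S' (by lia) (by lia) z) z
    obtain ⟨k, hk⟩ := hk u hu
    exact S.isPowTorsion_of_pow_smul H (by lia) hk

end Vanishing

section Annihilation

variable {R : Type u} [CommRing R] [IsLocalRing R]

theorem irMod_eq_relLength (q : Ideal R) :
    irMod R R q = (relLength q (colonIdeal R q) : WithBot ℕ∞) := by
  have h : q • (⊤ : Submodule R R) = q := by simp
  rw [irMod, moduleLength_eq_length, relLength, colonIdeal, h]

theorem IsColonSeq.annihilates [IsNoetherianRing R] {d : ℕ} {x : ℕ → R} (H : IsColonSeq d x)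
    (hd : 2 ≤ d) (hdim : ringKrullDim R = d) {t N h : ℕ}
    (hN : ∀ n, 1 ≤ n → irMod R R (cpow x n d) = (N : WithBot ℕ∞))
    (he : ∀ n ≥ t, ∀ e : ℕ → ℤ, IsHilbCoeff R (colonIdeal R (cpow x n d)) d e →
      N + (e 1).natAbs ≤ h) :
    (∀ i : ℕ, i ≠ d → ∀ c ∈ maximalIdeal R ^ h, ∀ y : ↥(Hmod R R i), c • y = 0) ∧
      IsGeneralizedCM R := by
  obtain ⟨n₀, hn₀⟩ := H.exists_colon_mul_le hd hdim
  have hr : ∀ r ∈ maximalIdeal R ^ h, ∀ n ≥ max n₀ (max t 2), ∀ j, j + 2 ≤ d →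
      ∀ u ∈ satIdeal (cpow x n (j + 1)), r * u ∈ satIdeal (cpow x n j) ⊔ cpow x n (j + 1) := by
    intro r hr n hn j hj
    have hn2 : 2 ≤ n := by lia
    obtain ⟨e, he1, he2⟩ := H.exists_isHilbCoeff hn2 hd
      (H.colon_sq hn2 (H.colonIdeal_le_maximalIdeal hn2 (by lia)) (hn₀ n (by lia)))
    have h1 := hN n (by lia)
    rw [irMod_eq_relLength] at h1
    have h2 : relLength (cpow x n d) (colonIdeal R (cpow x n d)) = (N : ℕ∞) := by
      exact_mod_cast h1
    rw [h2] at he2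
    refine H.mul_mem_sat_sup_of_relLength_le hn2 hd (he2.trans ?_) hr hj
    exact_mod_cast he n (by lia) e he1
  have key : ∀ i : ℕ, i < d → ∀ c ∈ maximalIdeal R ^ h, ∀ y : LC (maximalIdeal R) i R,
      c • y = 0 := fun i hi c hc y =>
    (isTopCech_zero x).smul_localCohomology_eq_zero H (hr c hc) i (by lia) y
  refine ⟨fun i hi c hc y => ?_, fun i hi => ?_⟩
  · rcases lt_or_gt_of_ne hi with hi | hi
    · exact key i hi c hc y
    · have hy : (y : Hmod R R i) = 0 := (isTopCech_zero x).localCohomology_eq_zero H d (by lia) hi y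
      rw [hy, smul_zero]
  · rw [hdim] at hi
    have hi : i < d := by exact_mod_cast hi
    exact LC.isFiniteLength i h fun i' hi' c hc z => key i' (by lia) c hc z

end Annihilation

section CompletionNoetherian

variable {R : Type u} [CommRing R]

/-- If `φ : P → R` maps the ideal of variables of a polynomial ring onto `I`, the completion of
`R` receives a map from the power series ring extending `φ`. -/
theorem exists_mvPowerSeries_map {σ : Type} [Finite σ] (I : Ideal R)
    (φ : MvPolynomial σ R →+* R) (hφ : (MvPolynomial.idealOfVars σ R).map φ ≤ I) :
    ∃ F : MvPowerSeries σ R →+* AdicCompletion I R,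
      ∀ p : MvPolynomial σ R, F (p : MvPowerSeries σ R) = algebraMap R (AdicCompletion I R) (φ p) := by
  let J := MvPolynomial.idealOfVars σ R
  have hle : ∀ n, J ^ n ≤ (I ^ n).comap φ := fun n => by
    rw [← Ideal.map_le_iff_le_comap, Ideal.map_pow]
    exact Ideal.pow_right_mono hφ n
  let f : ∀ n, MvPowerSeries σ R →+* R ⧸ I ^ n := fun n =>
    (Ideal.quotientMap (I ^ n) φ (hle n)).comp (MvPowerSeries.truncTotalAlgHom σ R n).toRingHom
  have hf : ∀ {m n : ℕ} (h : m ≤ n), (Ideal.Quotient.factorPow I h).comp (f n) = f m := by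
    intro m n h
    ext p
    change Ideal.Quotient.mk (I ^ m) (φ (MvPowerSeries.truncTotal n p)) =
      Ideal.Quotient.mk (I ^ m) (φ (MvPowerSeries.truncTotal m p))
    rw [Ideal.Quotient.eq, ← map_sub]
    exact hle m (MvPowerSeries.truncTotal_sub_truncTotal_mem_pow_idealOfVars h le_rfl p)
  refine ⟨AdicCompletion.liftRingHom I f hf, fun p => ?_⟩
  refine AdicCompletion.ext_evalₐ fun n => ?_
  rw [AdicCompletion.evalₐ_liftRingHom, AlgHom.commutes]
  change Ideal.quotientMap (I ^ n) φ (hle n)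
    (MvPowerSeries.truncTotalAlgHom σ R n (algebraMap _ _ p)) = _
  rw [AlgHom.commutes]
  rfl

theorem adicCompletion_isNoetherianRing [IsNoetherianRing R] (I : Ideal R) :
    IsNoetherianRing (AdicCompletion I R) := by
  obtain ⟨n, g, hg⟩ := Submodule.fg_iff_exists_fin_generating_family.mp (IsNoetherian.noetherian I)
  let φ : MvPolynomial (Fin n) R →+* R := (MvPolynomial.aeval (R := R) g).toRingHom
  have hφ : (MvPolynomial.idealOfVars (Fin n) R).map φ = I := by
    rw [MvPolynomial.idealOfVars, Ideal.map_span, ← Set.range_comp, ← hg, Ideal.submodule_span_eq]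
    congr 2
    ext i
    simp [φ]
  obtain ⟨F, hF⟩ := exists_mvPowerSeries_map I φ hφ.le
  let K : Ideal (MvPowerSeries (Fin n) R) := Ideal.span (Set.range MvPowerSeries.X)
  have hK : K.map F = I.map (algebraMap R (AdicCompletion I R)) := by
    refine Eq.trans ?_ (congrArg (Ideal.map (algebraMap R (AdicCompletion I R))) hφ)
    rw [Ideal.map_map, MvPolynomial.idealOfVars, Ideal.map_span, Ideal.map_span,
      ← Set.range_comp, ← Set.range_comp]
    congr 2
    ext1 i
    simp only [Function.comp, RingHom.comp_apply, ← hF, MvPolynomial.coe_X]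
  have hIfg : I.FG := IsNoetherian.noetherian I
  have hc := AdicCompletion.isAdicComplete_self I hIfg
  have : IsHausdorff (K.map F) (AdicCompletion I R) := by rw [hK]; exact hc.toIsHausdorff
  refine isNoetherianRing_of_surjective _ _ F
    (surjective_of_mk_map_comp_surjective (I := K) F fun y => ?_)
  obtain ⟨y, rfl⟩ := Ideal.Quotient.mk_surjective y
  obtain ⟨r, hr⟩ := Ideal.Quotient.mk_surjective (AdicCompletion.evalOneₐ I y)
  refine ⟨((MvPolynomial.C r : MvPolynomial (Fin n) R) : MvPowerSeries (Fin n) R), ?_⟩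
  rw [RingHom.comp_apply, Ideal.Quotient.eq, hK, ← AdicCompletion.ker_evalOneₐ_eq_map I hIfg,
    RingHom.mem_ker, map_sub, hF, sub_eq_zero]
  refine Eq.trans ?_ hr
  simp [φ]

end CompletionNoetherian

section SystemsOfParameters

theorem ringKrullDim_quotient_le_card {A : Type*} [CommRing A] [IsLocalRing A]
    [IsNoetherianRing A] {P : Ideal A} (S : Multiset A) (hS : ∀ z ∈ S, z ∈ maximalIdeal A)
    (h : maximalIdeal A ≤ (P ⊔ Ideal.span {z | z ∈ S}).radical) :
    ringKrullDim (A ⧸ P) ≤ S.card := by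
  classical
  by_cases hP : P = ⊤
  · have : Subsingleton (A ⧸ P) := by rw [hP]; infer_instance
    rw [ringKrullDim_eq_bot_of_subsingleton]
    exact bot_le
  have : Nontrivial (A ⧸ P) := Ideal.Quotient.nontrivial_iff.2 hP
  have : IsLocalRing (A ⧸ P) := .of_surjective' _ Ideal.Quotient.mk_surjective
  let π := Ideal.Quotient.mk P
  have hmax : (maximalIdeal (A ⧸ P)).comap π = maximalIdeal A :=
    ((local_hom_TFAE π).out 0 4).1 (IsLocalHom.of_surjective π Ideal.Quotient.mk_surjective)
  rw [← IsLocalRing.maximalIdeal_height_eq_ringKrullDim]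
  have hcard : (maximalIdeal (A ⧸ P)).height ≤ ((S.map π).toFinset.card : ℕ∞) := by
    refine Ideal.height_le_card_of_mem_minimalPrimes_span_finset
      ⟨⟨inferInstance, Ideal.span_le.2 fun z hz => ?_⟩, fun q hq _ => ?_⟩
    · simp only [Finset.mem_coe, Multiset.mem_toFinset, Multiset.mem_map] at hz
      obtain ⟨w, hw, rfl⟩ := hz
      rw [SetLike.mem_coe, ← Ideal.mem_comap, hmax]
      exact hS w hw
    · have hq1 := hq.1
      have hle : P ⊔ Ideal.span {z | z ∈ S} ≤ q.comap π := by
        refine sup_le (fun z hz => ?_) (Ideal.span_le.2 fun z hz => ?_)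
        · rw [Ideal.mem_comap, Ideal.Quotient.eq_zero_iff_mem.2 hz]
          exact q.zero_mem
        · refine hq.2 (Ideal.subset_span ?_)
          simp only [Finset.mem_coe, Multiset.mem_toFinset]
          exact Multiset.mem_map_of_mem _ hz
      have hm : maximalIdeal A ≤ q.comap π :=
        h.trans ((Ideal.radical_mono hle).trans (Ideal.IsPrime.radical inferInstance).le)
      intro z hz
      obtain ⟨w, rfl⟩ := Ideal.Quotient.mk_surjective z
      exact hm (hmax ▸ Ideal.mem_comap.2 hz)
  refine (WithBot.coe_le_coe.2 hcard).trans ?_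
  have := (Multiset.toFinset_card_le (S.map π)).trans (Multiset.card_map _ _).le
  exact_mod_cast this

variable {R : Type u} [CommRing R]

theorem sup_span_cons (J : Ideal R) (y : R) (S : Multiset R) :
    J ⊔ Ideal.span {z | z ∈ y ::ₘ S} = J ⊔ Ideal.span {y} ⊔ Ideal.span {z | z ∈ S} := by
  rw [sup_assoc, ← Ideal.span_union]
  congr 2
  ext z
  simp

theorem sup_span_add (J : Ideal R) (T S : Multiset R) :
    J ⊔ Ideal.span {z | z ∈ T + S} = J ⊔ Ideal.span {z | z ∈ T} ⊔ Ideal.span {z | z ∈ S} := by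
  rw [sup_assoc, ← Ideal.span_union]
  congr 2
  ext z
  simp

variable [IsLocalRing R]

/-- The multiset `S` is a system of parameters of `R ⧸ J`. -/
structure IsSysParam (J : Ideal R) (S : Multiset R) : Prop where
  mem : ∀ z ∈ S, z ∈ maximalIdeal R
  le_radical : maximalIdeal R ≤ (J ⊔ Ideal.span {z | z ∈ S}).radical
  dim_eq : ringKrullDim (R ⧸ J) = S.card

theorem ringKrullDim_quotient_le_add_one [IsNoetherianRing R] (J : Ideal R) {y : R}
    (hy : y ∈ maximalIdeal R) :
    ringKrullDim (R ⧸ J) ≤ ringKrullDim (R ⧸ (J ⊔ Ideal.span {y})) + 1 := by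
  by_cases hJ : J = ⊤
  · have : Subsingleton (R ⧸ J) := by rw [hJ]; infer_instance
    rw [ringKrullDim_eq_bot_of_subsingleton]
    exact bot_le
  have : Nontrivial (R ⧸ J) := Ideal.Quotient.nontrivial_iff.2 hJ
  have : IsLocalRing (R ⧸ J) := .of_surjective' _ Ideal.Quotient.mk_surjective
  let π := Ideal.Quotient.mk J
  have hmax : (maximalIdeal (R ⧸ J)).comap π = maximalIdeal R :=
    ((local_hom_TFAE π).out 0 4).1 (IsLocalHom.of_surjective π Ideal.Quotient.mk_surjective)
  have h := ringKrullDim_le_ringKrullDim_quotient_add_card (R := R ⧸ J) {π y} (by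
    rw [IsLocalRing.ringJacobson_eq_maximalIdeal]
    simp only [Finset.coe_singleton, Set.singleton_subset_iff, SetLike.mem_coe]
    exact Ideal.mem_comap.1 (hmax ▸ hy))
  refine h.trans (le_of_eq ?_)
  rw [Finset.card_singleton, Nat.cast_one]
  congr 1
  have e : Ideal.span ((({π y} : Finset (R ⧸ J)) : Set (R ⧸ J))) = (Ideal.span {y}).map π := by
    rw [Ideal.map_span, Set.image_singleton, Finset.coe_singleton]
  rw [e]
  exact ringKrullDim_eq_of_ringEquiv (DoubleQuot.quotQuotEquivQuotSup J (Ideal.span {y}))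

namespace IsSysParam

variable {J : Ideal R}

theorem map_pow_cons {y : R} {S : Multiset R} (h : IsSysParam J (y ::ₘ S)) {n : ℕ} (hn : n ≠ 0) :
    IsSysParam J (y ^ n ::ₘ S) where
  mem z hz := by
    rcases Multiset.mem_cons.1 hz with rfl | hz
    · exact Ideal.pow_mem_of_mem _ (h.mem y (Multiset.mem_cons_self _ _)) n (Nat.pos_of_ne_zero hn)
    · exact h.mem z (Multiset.mem_cons_of_mem hz)
  le_radical := by
    refine h.le_radical.trans (Ideal.radical_le_radical_iff.2 ?_)
    refine sup_le (le_sup_left.trans Ideal.le_radical) (Ideal.span_le.2 fun z hz => ?_)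
    rcases Multiset.mem_cons.1 hz with rfl | hz
    · exact ⟨n, Ideal.mem_sup_right (Ideal.subset_span (Multiset.mem_cons_self _ _))⟩
    · exact Ideal.le_radical (Ideal.mem_sup_right (Ideal.subset_span (Multiset.mem_cons_of_mem hz)))
  dim_eq := by rw [h.dim_eq, Multiset.card_cons, Multiset.card_cons]

theorem of_pow_cons {y : R} {S : Multiset R} {n : ℕ} (hn : n ≠ 0)
    (h : IsSysParam J (y ^ n ::ₘ S)) : IsSysParam J (y ::ₘ S) where
  mem z hz := by
    rcases Multiset.mem_cons.1 hz with rfl | hz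
    · exact Ideal.IsPrime.mem_of_pow_mem inferInstance n (h.mem _ (Multiset.mem_cons_self _ _))
    · exact h.mem z (Multiset.mem_cons_of_mem hz)
  le_radical := by
    have hle : Ideal.span {z | z ∈ y ^ n ::ₘ S} ≤ Ideal.span {z | z ∈ y ::ₘ S} := by
      refine Ideal.span_le.2 fun z hz => ?_
      rcases Multiset.mem_cons.1 hz with rfl | hz
      · have hy : y ∈ Ideal.span {z | z ∈ y ::ₘ S} := Ideal.subset_span (Multiset.mem_cons_self y S)
        exact Ideal.pow_mem_of_mem _ hy n (Nat.pos_of_ne_zero hn)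
      · exact Ideal.subset_span (Multiset.mem_cons_of_mem hz)
    exact h.le_radical.trans (Ideal.radical_mono (sup_le_sup_left hle J))
  dim_eq := by rw [h.dim_eq, Multiset.card_cons, Multiset.card_cons]

variable [IsNoetherianRing R]

theorem of_cons {y : R} {S : Multiset R} (h : IsSysParam J (y ::ₘ S)) :
    IsSysParam (J ⊔ Ideal.span {y}) S := by
  have hrad : maximalIdeal R ≤ (J ⊔ Ideal.span {y} ⊔ Ideal.span {z | z ∈ S}).radical := by
    rw [← sup_span_cons]; exact h.le_radical
  have hmem : ∀ z ∈ S, z ∈ maximalIdeal R := fun z hz => h.mem z (Multiset.mem_cons_of_mem hz)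
  refine ⟨hmem, hrad, le_antisymm (ringKrullDim_quotient_le_card S hmem hrad) ?_⟩
  have h1 := ringKrullDim_quotient_le_add_one J (h.mem y (Multiset.mem_cons_self y S))
  rw [h.dim_eq, Multiset.card_cons] at h1
  generalize ringKrullDim (R ⧸ (J ⊔ Ideal.span {y})) = k at h1 ⊢
  induction k with
  | bot => simp at h1
  | coe k =>
    induction k with
    | top => exact le_top
    | coe k => norm_cast at h1 ⊢; omega

theorem of_add {T S : Multiset R} (h : IsSysParam J (T + S)) :
    IsSysParam (J ⊔ Ideal.span {z | z ∈ T}) S := by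
  induction T using Multiset.induction_on generalizing J with
  | empty => simpa using h
  | cons y T ih =>
    rw [sup_span_cons]
    exact ih (of_cons (by simpa using h))

theorem to_add {T S S' : Multiset R} (h : IsSysParam (J ⊔ Ideal.span {z | z ∈ T}) S)
    (h' : IsSysParam J (T + S')) : IsSysParam J (T + S) where
  mem z hz := (Multiset.mem_add.1 hz).elim (fun hz => h'.mem z (Multiset.mem_add.2 (.inl hz)))
    (h.mem z)
  le_radical := by rw [sup_span_add]; exact h.le_radical
  dim_eq := by
    have : (S.card : WithBot ℕ∞) = S'.card := by rw [← h.dim_eq, ← h'.of_add.dim_eq]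
    have : S.card = S'.card := by exact_mod_cast this
    rw [h'.dim_eq, Multiset.card_add, Multiset.card_add, this]

theorem to_cons {y : R} {S S' : Multiset R} (h : IsSysParam (J ⊔ Ideal.span {y}) S)
    (h' : IsSysParam J (y ::ₘ S')) : IsSysParam J (y ::ₘ S) := by
  have := to_add (J := J) (T := {y}) (S := S) (S' := S') (by simpa using h) (by simpa using h')
  simpa using this

end IsSysParam

end SystemsOfParameters

section ParamAnnihilator

variable {R : Type u} [CommRing R] [IsLocalRing R]

/-- The ideal `b(R ⧸ J)`, phrased with multisets of elements of `R`. -/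
def paramAnn (J : Ideal R) : Ideal R where
  carrier := {a | ∀ (Z : Multiset R) (z : R) (W : Multiset R), IsSysParam J (Z + z ::ₘ W) →
    ∀ u, z * u ∈ J ⊔ Ideal.span {w | w ∈ Z} → a * u ∈ J ⊔ Ideal.span {w | w ∈ Z}}
  zero_mem' := fun Z z W _ u _ => by rw [zero_mul]; exact Ideal.zero_mem _
  add_mem' := fun ha hb Z z W h u hu => by
    rw [add_mul]; exact Ideal.add_mem _ (ha Z z W h u hu) (hb Z z W h u hu)
  smul_mem' := fun c a ha Z z W h u hu => by
    rw [smul_eq_mul, mul_assoc]; exact Ideal.mul_mem_left _ _ (ha Z z W h u hu)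

theorem mem_paramAnn {J : Ideal R} {a : R} : a ∈ paramAnn J ↔
    ∀ (Z : Multiset R) (z : R) (W : Multiset R), IsSysParam J (Z + z ::ₘ W) →
      ∀ u, z * u ∈ J ⊔ Ideal.span {w | w ∈ Z} → a * u ∈ J ⊔ Ideal.span {w | w ∈ Z} := Iff.rfl

variable [IsNoetherianRing R]

theorem paramAnn_le_sup {J : Ideal R} {T S : Multiset R} (h : IsSysParam J (T + S)) :
    paramAnn J ≤ paramAnn (J ⊔ Ideal.span {w | w ∈ T}) := by
  intro a ha Z z W hZ u hu
  rw [← sup_span_add] at hu ⊢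
  refine ha (T + Z) z W ?_ u hu
  rw [add_assoc]
  exact hZ.to_add h

theorem paramAnn_sup_le_pow {J : Ideal R} {y : R} {V : Multiset R} (hV : IsSysParam J (y ::ₘ V))
    (hy : y ∈ paramAnn J) {n : ℕ} (hn : n ≠ 0) :
    paramAnn (J ⊔ Ideal.span {y}) ≤ paramAnn (J ⊔ Ideal.span {y ^ n}) := by
  intro b hb Z z W hZ u hu
  have hsop : IsSysParam J (y ^ n ::ₘ (Z + z ::ₘ W)) := hZ.to_cons (hV.map_pow_cons hn)
  have hsop1 : IsSysParam J (y ::ₘ (Z + z ::ₘ W)) := hsop.of_pow_cons hn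
  have hsop' : IsSysParam (J ⊔ Ideal.span {y}) (Z + z ::ₘ W) := hsop1.of_cons
  obtain ⟨m, rfl⟩ : ∃ m, n = m + 1 := ⟨n - 1, by omega⟩
  set N := J ⊔ Ideal.span {w | w ∈ Z} with hN
  have hNe : ∀ c, J ⊔ Ideal.span {c} ⊔ Ideal.span {w | w ∈ Z} = N ⊔ Ideal.span {c} :=
    fun c => sup_right_comm _ _ _
  have hmem : ∀ {c v}, v ∈ N ⊔ Ideal.span {c} ↔ ∃ w, v - c * w ∈ N := by
    intro c v
    rw [Submodule.mem_sup]
    constructor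
    · rintro ⟨p, hp, q, hq, rfl⟩
      obtain ⟨w, rfl⟩ := Ideal.mem_span_singleton'.1 hq
      exact ⟨w, by ring_nf; exact hp⟩
    · rintro ⟨w, hw⟩
      exact ⟨_, hw, c * w, Ideal.mul_mem_right _ _ (Ideal.mem_span_singleton_self c), by ring⟩
  rw [hNe, hmem] at hu ⊢
  obtain ⟨v, hv⟩ := hu
  have hyv : ∃ w, y * v - z * w ∈ N := by
    rw [← hmem, ← hNe, sup_right_comm, ← hN, hN, sup_assoc, ← Ideal.span_union]
    have e : {w | w ∈ Z} ∪ {z} = {w | w ∈ z ::ₘ Z} := by ext; simp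
    rw [e]
    refine hy (z ::ₘ Z) (y ^ (m + 1)) W ?_ v ?_
    · convert hsop using 1
      simp only [← Multiset.singleton_add]
      abel
    · rw [← e, Ideal.span_union, ← sup_assoc, ← hN, hmem]
      exact ⟨u, by rw [← neg_mem_iff]; convert hv using 1; ring⟩
  obtain ⟨w, hw⟩ := hyv
  have hzu : z * (u - y ^ m * w) ∈ N := by
    have := Ideal.add_mem _ hv (Ideal.mul_mem_left _ (y ^ m) hw)
    convert this using 1
    ring
  have hyu : y * (u - y ^ m * w) ∈ N := by
    refine hy Z z (y ::ₘ W) ?_ _ hzu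
    convert hsop1 using 1
    simp only [← Multiset.singleton_add]
    abel
  have hbw : ∃ w', b * w - y * w' ∈ N := by
    rw [← hmem, ← hNe]
    refine hb Z z W hsop' w ?_
    rw [hNe, hmem]
    exact ⟨v, by rw [← neg_mem_iff]; convert hw using 1; ring⟩
  have hbu : ∃ c, b * (u - y ^ m * w) - y * c ∈ N := by
    rw [← hmem, ← hNe]
    refine hb Z z W hsop' _ ?_
    rw [hNe]
    exact Ideal.mem_sup_left hzu
  obtain ⟨w', hw'⟩ := hbw
  obtain ⟨c, hc⟩ := hbu
  have hyc : y * c ∈ N := by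
    refine hy Z (y ^ 2) (z ::ₘ W) ?_ c ?_
    · convert hsop1.map_pow_cons two_ne_zero using 1
      simp only [← Multiset.singleton_add]
      abel
    · have := Ideal.sub_mem _ (Ideal.mul_mem_left _ b hyu) (Ideal.mul_mem_left _ y hc)
      convert this using 1
      ring
  refine ⟨w', ?_⟩
  have := Ideal.add_mem _ (Ideal.add_mem _ hc hyc) (Ideal.mul_mem_left _ (y ^ m) hw')
  convert this using 1
  ring

end ParamAnnihilator

section CyclicModule

variable {R : Type u} [CommRing R] [IsLocalRing R] [IsNoetherianRing R]

theorem isFiniteLength_quotient_iff (K : Ideal R) :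
    IsFiniteLength R (R ⧸ K) ↔ maximalIdeal R ≤ K.radical := by
  rw [← Module.length_ne_top_iff]
  constructor
  · intro h
    obtain ⟨n, hn⟩ := ENat.ne_top_iff_exists.1 h
    refine fun c hc => ⟨n, ?_⟩
    have := pow_smul_eq_zero_of_length_le hn.ge _ (Ideal.pow_mem_pow hc n) (1 : R ⧸ K)
    rwa [Algebra.smul_def, mul_one, Ideal.Quotient.algebraMap_eq,
      Ideal.Quotient.eq_zero_iff_mem] at this
  · intro h
    obtain ⟨k, hk⟩ := Ideal.exists_pow_le_of_le_radical_of_fg h (IsNoetherian.noetherian _)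
    exact length_quotient_ne_top hk

variable {M : Type u} [AddCommGroup M] [Module R M] (π : R →ₗ[R] M)
  (hπ : Function.Surjective π)

include hπ

omit [IsLocalRing R] [IsNoetherianRing R] in
theorem ker_mkQ_comp_eq_sup (I : Ideal R) :
    LinearMap.ker ((I • (⊤ : Submodule R M)).mkQ ∘ₗ π) = LinearMap.ker π ⊔ I := by
  have : I • (⊤ : Submodule R M) = Submodule.map π I := by
    rw [← LinearMap.range_eq_top.2 hπ, LinearMap.range_eq_map, ← Submodule.map_smul'']
    simp
  rw [LinearMap.ker_comp, Submodule.ker_mkQ, this, Submodule.comap_map_eq, sup_comm]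

theorem isSOP_iff_isSysParam {s : ℕ} (x : Fin s → R) :
    IsSOP R M x ↔ IsSysParam (LinearMap.ker π) (Finset.univ.val.map x) := by
  have hann : Module.annihilator R M = LinearMap.ker π := by
    rw [← (π.quotKerEquivOfSurjective hπ).annihilator_eq, Ideal.annihilator_quotient]
  have hset : {z | z ∈ Finset.univ.val.map x} = Set.range x := by
    ext z; simp
  have hfin : IsFiniteLength R (M ⧸ (Ideal.span (Set.range x) • (⊤ : Submodule R M))) ↔
      maximalIdeal R ≤ Ideal.radical (LinearMap.ker π ⊔ Ideal.span (Set.range x)) := by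
    rw [← isFiniteLength_quotient_iff, ← ker_mkQ_comp_eq_sup π hπ]
    have hs : Function.Surjective
        ((Ideal.span (Set.range x) • (⊤ : Submodule R M)).mkQ ∘ₗ π) :=
      (Submodule.mkQ_surjective _).comp hπ
    have e := LinearMap.quotKerEquivOfSurjective _ hs
    exact ⟨e.symm.isFiniteLength, e.isFiniteLength⟩
  constructor
  · rintro ⟨h1, h2, h3⟩
    refine ⟨fun z hz => ?_, ?_, ?_⟩
    · obtain ⟨i, -, rfl⟩ := Multiset.mem_map.1 hz
      exact h2 i
    · rw [hset]; exact hfin.1 h3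
    · rw [← hann, Multiset.card_map]
      simpa [moduleDim] using h1
  · rintro ⟨h1, h2, h3⟩
    refine ⟨?_, fun i => h1 _ (Multiset.mem_map_of_mem _ (Finset.mem_univ i)), ?_⟩
    · rw [moduleDim, hann, h3, Multiset.card_map]
      simp
    · rw [hset] at h2; exact hfin.2 h2

theorem mem_bIdeal_iff {a : R} : a ∈ bIdeal R M ↔
    ∀ (s : ℕ) (x : Fin s → R), IsSysParam (LinearMap.ker π) (Finset.univ.val.map x) →
      ∀ i u, x i * u ∈ LinearMap.ker π ⊔ Ideal.span (x '' {j | j < i}) →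
        a * u ∈ LinearMap.ker π ⊔ Ideal.span (x '' {j | j < i}) := by
  simp only [bIdeal, Submodule.mem_iInf, ← isSOP_iff_isSysParam π hπ]
  refine forall_congr' fun s => forall_congr' fun x => forall_congr' fun hx =>
    forall_congr' fun i => ?_
  set q := (Ideal.span (x '' {j | j < i}) • (⊤ : Submodule R M)).mkQ ∘ₗ π with hq
  have hqs : Function.Surjective q := (Submodule.mkQ_surjective _).comp hπ
  have hk : ∀ c u, c * u ∈ LinearMap.ker π ⊔ Ideal.span (x '' {j | j < i}) ↔ c • q u = 0 := by
    intro c u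
    rw [← ker_mkQ_comp_eq_sup π hπ, LinearMap.mem_ker, ← hq, ← smul_eq_mul, map_smul]
  simp only [hk, Module.mem_annihilator, Subtype.forall, Submodule.mem_torsionBy_iff,
    SetLike.mk_smul_mk, Submodule.mk_eq_zero]
  exact hqs.forall (p := fun b => x i • b = 0 → a • b = 0)

theorem bIdeal_eq_paramAnn : bIdeal R M = paramAnn (LinearMap.ker π) := by
  classical
  ext a
  rw [mem_bIdeal_iff π hπ, mem_paramAnn]
  constructor
  · intro h Z z W hZ u hu
    let l := Z.toList ++ z :: W.toList
    have hl : Finset.univ.val.map l.get = Z + z ::ₘ W := by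
      have h1 : Finset.univ.val.map l.get = (l : Multiset R) := by
        rw [Fin.univ_val_map, List.ofFn_get]
      rw [h1]
      change ((Z.toList ++ z :: W.toList : List R) : Multiset R) = _
      rw [← Multiset.coe_add, ← Multiset.cons_coe, Multiset.coe_toList, Multiset.coe_toList]
    have hlen : Z.toList.length < l.length := by simp [l]
    have hset : l.get '' {j | j < ⟨Z.toList.length, hlen⟩} = {w | w ∈ Z} := by
      ext w
      rw [Set.mem_ofPred_eq, ← Multiset.mem_toList, List.mem_iff_getElem]
      constructor
      · rintro ⟨j, hj, rfl⟩
        have hj' : (j : ℕ) < Z.toList.length := hj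
        exact ⟨j, hj', by simp [l, List.getElem_append_left hj']⟩
      · rintro ⟨j, hj, rfl⟩
        exact ⟨⟨j, hj.trans hlen⟩, hj, by simp [l, List.getElem_append_left hj]⟩
    have := h l.length l.get (hl ▸ hZ) ⟨Z.toList.length, hlen⟩ u
    rw [hset] at this
    refine this ?_
    simpa [l] using hu
  · intro h s x hx i u hu
    have hset : x '' {j | j < i} = {w | w ∈ (Finset.univ.filter (· < i)).val.map x} := by
      ext w; simp
    have hsum : Finset.univ.val.map x = (Finset.univ.filter (· < i)).val.map x +
        x i ::ₘ (Finset.univ.filter (i < ·)).val.map x := by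
      have h1 : (Finset.univ.filter (fun j => ¬ j < i)).val =
          i ::ₘ (Finset.univ.filter (i < ·)).val := by
        rw [← Finset.cons_val (by simp)]
        congr 1
        ext j
        simp [le_iff_lt_or_eq, or_comm, eq_comm]
      rw [← Multiset.map_cons, ← h1, ← Multiset.map_add]
      congr 1
      exact (Multiset.filter_add_not _ _).symm
    rw [hset] at hu ⊢
    exact h _ _ _ (hsum ▸ hx) u hu

end CyclicModule

section PowersOfCSystem

variable {R : Type u} [CommRing R]

theorem span_map_pow (x : ℕ → R) (n : ℕ → ℕ) (A : Finset ℕ) :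
    Ideal.span {w | w ∈ A.val.map fun i => x i ^ n i} = powIdeal x n A := by
  unfold powIdeal
  congr 1
  ext w
  simp

theorem powIdeal_union (x : ℕ → R) (n : ℕ → ℕ) (A B : Set ℕ) :
    powIdeal x n (A ∪ B) = powIdeal x n A ⊔ powIdeal x n B := by
  rw [powIdeal, Set.image_union, Ideal.span_union]; rfl

variable [IsLocalRing R] [IsNoetherianRing R]

theorem isCSOP_iff {d : ℕ} (x : ℕ → R) : IsCSOP R R (fun i : Fin d => x i) ↔
    IsSysParam ⊥ ((Finset.range d).val.map x) ∧
      ∀ l < d, x l ∈ paramAnn (powIdeal x (fun _ => 1) (Set.Ioo l d)) ^ 3 := by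
  unfold IsCSOP
  have h1 : Finset.univ.val.map (fun i : Fin d => x i) = (Finset.range d).val.map x := by
    rw [Fin.univ_val_map, Finset.range_val, Multiset.range, Multiset.map_coe, List.ofFn_eq_map,
      ← List.map_coe_finRange_eq_range, List.map_map]
    rfl
  rw [isSOP_iff_isSysParam LinearMap.id Function.surjective_id, LinearMap.ker_id, h1]
  refine and_congr_right fun _ => ?_
  have h2 : ∀ i : Fin d, bIdeal R (R ⧸ (Ideal.span ((fun i : Fin d => x i) '' {j | i < j}) •
      (⊤ : Submodule R R))) = paramAnn (powIdeal x (fun _ => 1) (Set.Ioo (i : ℕ) d)) := by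
    intro i
    rw [bIdeal_eq_paramAnn (Submodule.mkQ _) (Submodule.mkQ_surjective _), Submodule.ker_mkQ,
      smul_eq_mul, Ideal.mul_top, powIdeal]
    congr 2
    ext w
    simp only [Set.mem_image, Set.mem_ofPred_eq, Set.mem_Ioo, pow_one]
    constructor
    · rintro ⟨j, hj, rfl⟩
      exact ⟨j, ⟨hj, j.2⟩, rfl⟩
    · rintro ⟨j, hj, rfl⟩
      exact ⟨⟨j, hj.2⟩, hj.1, rfl⟩
  simp only [h2]
  exact ⟨fun h l hl => h ⟨l, hl⟩, fun h i => h i i.2⟩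

variable {d : ℕ} {x : ℕ → R}

omit [IsNoetherianRing R] in
theorem IsSysParam.map_pow (h : IsSysParam ⊥ ((Finset.range d).val.map x)) {n : ℕ → ℕ}
    (hn : ∀ i, 1 ≤ n i) : IsSysParam ⊥ ((Finset.range d).val.map fun i => x i ^ n i) where
  mem z hz := by
    obtain ⟨i, hi, rfl⟩ := Multiset.mem_map.1 hz
    exact Ideal.pow_mem_of_mem _ (h.mem _ (Multiset.mem_map_of_mem _ hi)) _ (hn i)
  le_radical := by
    refine h.le_radical.trans (Ideal.radical_le_radical_iff.2 ?_)
    refine sup_le bot_le (Ideal.span_le.2 fun z hz => ?_)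
    have hz' : z ∈ (Finset.range d).val.map x := hz
    obtain ⟨i, hi, rfl⟩ := Multiset.mem_map.1 hz'
    exact ⟨n i, Ideal.mem_sup_right (Ideal.subset_span
      (Multiset.mem_map_of_mem (fun i => x i ^ n i) hi))⟩
  dim_eq := by rw [h.dim_eq, Multiset.card_map, Multiset.card_map]

theorem IsSysParam.of_disjoint_union (h : IsSysParam ⊥ ((Finset.range d).val.map x)) {n : ℕ → ℕ}
    (hn : ∀ i, 1 ≤ n i) {A B : Finset ℕ} (hAB : Disjoint A B)
    (hu : A.disjUnion B hAB = Finset.range d) :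
    IsSysParam (powIdeal x n A) (B.val.map fun i => x i ^ n i) := by
  have h1 := h.map_pow hn
  rw [← hu, Finset.disjUnion_val, Multiset.map_add] at h1
  have := h1.of_add
  rwa [bot_sup_eq, span_map_pow] at this

theorem paramAnn_powIdeal_le (h : IsSysParam ⊥ ((Finset.range d).val.map x))
    (hb : ∀ l < d, x l ∈ paramAnn (powIdeal x (fun _ => 1) (Set.Ioo l d))) {n : ℕ → ℕ}
    (hn : ∀ i, 1 ≤ n i) {l : ℕ} (hl : l < d) :
    paramAnn (powIdeal x (fun _ => 1) (Set.Ioo l d)) ≤ paramAnn (powIdeal x n (Set.Ioo l d)) := by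
  induction hs : d - l using Nat.strong_induction_on generalizing l with
  | _ s ih =>
  have key : ∀ j k, k + j = d → l < k → paramAnn (powIdeal x (fun _ => 1) (Set.Ioo l d)) ≤
      paramAnn (powIdeal x (fun i => if k ≤ i then n i else 1) (Set.Ioo l d)) := by
    intro j
    induction j with
    | zero =>
      intro k hk hlk
      rw [powIdeal_congr x (a := fun i => if k ≤ i then n i else 1) (b := fun _ => 1)]
      intro i hi
      have := hi.2
      simp only [ite_eq_right_iff]
      omega
    | succ j ihj =>
      intro k hk hlk
      refine (ihj (k + 1) (by omega) (by omega)).trans ?_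
      set n' : ℕ → ℕ := fun i => if k + 1 ≤ i then n i else 1 with hn'
      have hn'1 : ∀ i, 1 ≤ n' i := fun i => by
        simp only [hn']; split_ifs
        · exact hn i
        · exact le_rfl
      set A := (Finset.Ioo l d).erase k with hA
      have hins : Set.Ioo l d = insert k (A : Set ℕ) := by
        ext i; simp [hA]; omega
      have e1 : powIdeal x n' (Set.Ioo l d) = powIdeal x n' A ⊔ Ideal.span {x k} := by
        rw [hins, powIdeal_insert, sup_comm]
        simp [hn']
      have e2 : powIdeal x (fun i => if k ≤ i then n i else 1) (Set.Ioo l d) =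
          powIdeal x n' A ⊔ Ideal.span {x k ^ n k} := by
        rw [hins, powIdeal_insert, sup_comm]
        simp only [le_refl, if_true]
        congr 1
        refine powIdeal_congr x fun i hi => ?_
        have : i ≠ k := by simp [hA] at hi; omega
        simp only [hn']
        split_ifs <;> first | rfl | omega
      rw [e1, e2]
      have hsop : IsSysParam (powIdeal x n' A)
          ((Finset.cons k (Finset.Iic l) (by simp; omega)).val.map fun i => x i ^ n' i) := by
        refine h.of_disjoint_union hn'1 (A := A) ?_ ?_
        · rw [Finset.disjoint_left]
          intro i; simp [hA]; omega
        · ext i; simp [hA]; omega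
      rw [Finset.cons_val, Multiset.map_cons] at hsop
      have hk1 : x k ^ n' k = x k := by simp [hn']
      rw [hk1] at hsop
      refine paramAnn_sup_le_pow hsop ?_ (Nat.one_le_iff_ne_zero.1 (hn k))
      have h1 := ih (d - k) (by omega) (l := k) (by omega) rfl (hb k (by omega))
      have hsop2 : IsSysParam (powIdeal x n' (Finset.Ioo k d : Finset ℕ))
          ((Finset.Iic k).val.map fun i => x i ^ n' i) := by
        refine h.of_disjoint_union hn'1 ?_ ?_
        · rw [Finset.disjoint_left]
          intro i; simp; omega
        · ext i; simp; omega
      have hdis : Disjoint (Finset.Ioo l k) (insert k (Finset.Iic l)) := by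
        rw [Finset.disjoint_left]
        intro i; simp; omega
      have e3 : (Finset.Iic k).val = (Finset.Ioo l k).val + (insert k (Finset.Iic l)).val := by
        rw [← Finset.disjUnion_val (h := hdis)]
        congr 1
        ext i
        simp only [Finset.mem_disjUnion, Finset.mem_Iic, Finset.mem_Ioo, Finset.mem_insert]
        omega
      rw [e3, Multiset.map_add] at hsop2
      have h2 := paramAnn_le_sup hsop2
      rw [span_map_pow, ← powIdeal_union, ← Finset.coe_union] at h2
      have e4 : Finset.Ioo k d ∪ Finset.Ioo l k = A := by
        ext i; simp [hA]; omega
      rw [e4] at h2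
      refine h2 ?_
      rwa [Finset.coe_Ioo, powIdeal_congr x (a := n') (b := n)]
      intro i hi
      have := hi.1
      simp only [hn']
      rw [if_pos (by omega)]
  refine (key (d - (l + 1)) (l + 1) (by omega) (by omega)).trans (le_of_eq ?_)
  congr 1
  refine powIdeal_congr x fun i hi => if_pos hi.1

end PowersOfCSystem

section ColonProperty

variable {R : Type u} [CommRing R] [IsLocalRing R] [IsNoetherianRing R]

theorem mem_of_forall_mem_sup_pow {K : Ideal R} {w : R}
    (h : ∀ k, w ∈ K ⊔ maximalIdeal R ^ k) : w ∈ K := by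
  have : IsHausdorff (maximalIdeal R) (R ⧸ K) := inferInstance
  rw [← Ideal.Quotient.eq_zero_iff_mem]
  refine this.haus _ fun k => ?_
  rw [SModEq.zero]
  obtain ⟨p, hp, q, hq, rfl⟩ := Submodule.mem_sup.1 (h k)
  rw [map_add, Ideal.Quotient.eq_zero_iff_mem.2 hp, zero_add]
  have : Ideal.Quotient.mk K q = q • (1 : R ⧸ K) := by
    rw [Algebra.smul_def, mul_one]; rfl
  rw [this]
  exact Submodule.smul_mem_smul hq trivial

variable {d : ℕ} {x : ℕ → R}

theorem mul_mem_powIdeal_of_pow_mul_mem (h : IsSysParam ⊥ ((Finset.range d).val.map x))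
    (hb : ∀ l < d, x l ∈ paramAnn (powIdeal x (fun _ => 1) (Set.Ioo l d)))
    {A : Set ℕ} {a : ℕ → ℕ} (hA : A ⊆ Set.Iio d) (ha : ∀ i, 1 ≤ a i) {p l : ℕ} (hpl : p ≤ l)
    (hl : l < d) (hpA : p ∉ A) (hlA : l ∉ A) {N : ℕ} {u : R}
    (hu : x p ^ N * u ∈ powIdeal x a A) : x l * u ∈ powIdeal x a A := by
  classical
  refine mem_of_forall_mem_sup_pow fun M => ?_
  set n : ℕ → ℕ := fun i => if i ∈ A then a i else if i = p then N + 1 else M + 1 with hn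
  have hn1 : ∀ i, 1 ≤ n i := fun i => by
    simp only [hn]
    split_ifs
    · exact ha i
    · omega
    · omega
  have hnA : ∀ i ∈ A, a i = n i := fun i hi => by simp only [hn, if_pos hi]
  set Z : Finset ℕ := (Finset.Iio l).filter (· ∈ A) with hZ
  set W : Finset ℕ := (Finset.Iic l).filter (fun i => i ∉ A ∧ i ≠ p) with hW
  have hsop : IsSysParam (powIdeal x n (Finset.Ioo l d : Finset ℕ))
      ((Finset.Iic l).val.map fun i => x i ^ n i) := by
    refine h.of_disjoint_union hn1 ?_ ?_
    · rw [Finset.disjoint_left]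
      intro i; simp; omega
    · ext i; simp; omega
  have hpW : p ∉ W := by simp [hW]
  have hdis : Disjoint Z (Finset.cons p W hpW) := by
    rw [Finset.disjoint_left]
    intro i hi
    have hiA := (Finset.mem_filter.1 hi).2
    simp only [Finset.mem_cons, not_or]
    exact ⟨fun e => hpA (e ▸ hiA), fun hi' => (Finset.mem_filter.1 hi').2.1 hiA⟩
  have hval : (Finset.Iic l).val = Z.val + p ::ₘ W.val := by
    rw [← Finset.cons_val hpW, ← Finset.disjUnion_val (h := hdis)]
    congr 1
    ext i
    simp only [Finset.mem_disjUnion, Finset.mem_Iic, Finset.mem_cons, hZ, hW, Finset.mem_filter,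
      Finset.mem_Iio]
    by_cases hiA : i ∈ A
    · have h1 : i ≠ l := fun e => hlA (e ▸ hiA)
      have h2 : i ≠ p := fun e => hpA (e ▸ hiA)
      simp only [hiA, not_true, false_and, and_false, or_false, and_true, h2]
      omega
    · simp only [hiA, not_false_eq_true, and_false, true_and, false_or]
      omega
  rw [hval, Multiset.map_add, Multiset.map_cons] at hsop
  have hmem := paramAnn_powIdeal_le h hb hn1 hl (hb l hl)
  rw [← Finset.coe_Ioo] at hmem
  have hnp : n p = N + 1 := by simp only [hn, if_neg hpA, if_true]
  have := hmem _ _ _ hsop u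
  rw [span_map_pow, ← powIdeal_union] at this
  have hsub : A ⊆ ↑(Finset.Ioo l d) ∪ ↑Z := by
    intro i hi
    have h1 : i ≠ l := fun e => hlA (e ▸ hi)
    have h2 : i < d := hA hi
    simp only [Set.mem_union, Finset.mem_coe, Finset.mem_Ioo, hZ, Finset.mem_filter,
      Finset.mem_Iio, hi, and_true]
    omega
  have hle : powIdeal x n (↑(Finset.Ioo l d) ∪ ↑Z) ≤ powIdeal x a A ⊔ maximalIdeal R ^ M := by
    refine Ideal.span_le.2 ?_
    rintro _ ⟨i, hi, rfl⟩
    by_cases hiA : i ∈ A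
    · refine Ideal.mem_sup_left ?_
      have := pow_mem_powIdeal x a hiA
      rwa [hnA i hiA] at this
    · have hi' : l < i ∧ i < d := by
        simpa [hZ, hiA] using hi
      have hni : n i = M + 1 := by
        simp only [hn, if_neg hiA]
        rw [if_neg (by omega)]
      refine Ideal.mem_sup_right ?_
      change x i ^ n i ∈ _
      rw [hni]
      exact Ideal.pow_le_pow_right (Nat.le_succ M) (Ideal.pow_mem_pow
        (h.mem _ (Multiset.mem_map_of_mem _ (Finset.mem_range.2 hi'.2))) _)
  refine hle (this ?_)
  rw [hnp, pow_succ, mul_comm (x p ^ N), mul_assoc]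
  refine Ideal.mul_mem_left _ _ ?_
  rw [powIdeal_congr x hnA] at hu
  exact powIdeal_mono x n hsub hu

theorem isColonSeq_of_isSysParam (h : IsSysParam ⊥ ((Finset.range d).val.map x))
    (hb : ∀ l < d, x l ∈ paramAnn (powIdeal x (fun _ => 1) (Set.Ioo l d)))
    (hnzd : ∀ i < d, ∀ u, x i * u = 0 → u = 0) : IsColonSeq d x where
  mem i hi := h.mem _ (Multiset.mem_map_of_mem _ (Finset.mem_range.2 hi))
  primary a := by
    refine Ideal.exists_pow_le_of_le_radical_of_fg ?_ (IsNoetherian.noetherian _)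
    refine h.le_radical.trans (Ideal.radical_le_radical_iff.2 ?_)
    refine sup_le bot_le (Ideal.span_le.2 fun z hz => ?_)
    have hz' : z ∈ (Finset.range d).val.map x := hz
    obtain ⟨i, hi, rfl⟩ := Multiset.mem_map.1 hz'
    exact ⟨a i, pow_mem_powIdeal x a (Finset.mem_range.1 hi)⟩
  nzd := hnzd
  colon A a hA ha p l hpl hl hpA hlA N u hu :=
    mul_mem_powIdeal_of_pow_mul_mem h hb hA ha hpl hl hpA hlA hu

theorem isCSOP_pow (h : IsCSOP R R (fun i : Fin d => x i)) {n : ℕ} (hn : 1 ≤ n) :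
    IsCSOP R R (fun i : Fin d => x i ^ n) := by
  rw [isCSOP_iff] at h
  have hb : ∀ l < d, x l ∈ paramAnn (powIdeal x (fun _ => 1) (Set.Ioo l d)) := fun l hl =>
    Ideal.pow_le_self three_ne_zero (h.2 l hl)
  refine (isCSOP_iff (fun i => x i ^ n)).2 ⟨h.1.map_pow (n := fun _ => n) fun _ => hn,
    fun l hl => ?_⟩
  have hle := paramAnn_powIdeal_le h.1 hb (n := fun _ => n) (fun _ => hn) hl
  have e : powIdeal (fun i => x i ^ n) (fun _ => 1) (Set.Ioo l d) =
      powIdeal x (fun _ => n) (Set.Ioo l d) := by simp [powIdeal]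
  rw [e]
  exact Ideal.pow_right_mono hle 3 (Ideal.pow_mem_of_mem _ (h.2 l hl) n hn)

end ColonProperty

section Unmixed

variable {R : Type u} [CommRing R] [IsLocalRing R] [IsNoetherianRing R]

theorem ringKrullDim_le_adicCompletion :
    ringKrullDim R ≤ ringKrullDim (AdicCompletion (maximalIdeal R) R) := by
  have := adicCompletion_isNoetherianRing (maximalIdeal R)
  have : (maximalIdeal (AdicCompletion (maximalIdeal R) R)).LiesOver (maximalIdeal R) :=
    ⟨(maximalIdeal_comap (algebraMap R (AdicCompletion (maximalIdeal R) R))).symm⟩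
  have : Module.Flat R (AdicCompletion (maximalIdeal R) R) :=
    AdicCompletion.flat_of_isNoetherian _
  rw [← IsLocalRing.maximalIdeal_height_eq_ringKrullDim,
    ← IsLocalRing.maximalIdeal_height_eq_ringKrullDim,
    Ideal.height_eq_height_add_of_liesOver_of_hasGoingDown (maximalIdeal R)
      (maximalIdeal (AdicCompletion (maximalIdeal R) R))]
  exact_mod_cast le_self_add

theorem IsUnmixedRing.eq_zero_of_mul_eq_zero (hum : IsUnmixedRing R) {d : ℕ} {x : ℕ → R}
    (hdim : ringKrullDim R = d) (h : IsSysParam ⊥ ((Finset.range d).val.map x)) :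
    ∀ k < d, ∀ u, x k * u = 0 → u = 0 := by
  intro k hk u hu
  by_contra hu0
  have := adicCompletion_isNoetherianRing (maximalIdeal R)
  set ι := algebraMap R (AdicCompletion (maximalIdeal R) R) with hι
  have hinj : Function.Injective ι := AdicCompletion.of_injective (maximalIdeal R) R
  have hιu : ι u ≠ 0 := fun h0 => hu0 (hinj (h0.trans (map_zero ι).symm))
  obtain ⟨P, hP, hle⟩ := exists_le_isAssociatedPrime_of_isNoetherianRing
    (AdicCompletion (maximalIdeal R) R) (ι u) hιu
  have hxP : ι (x k) ∈ P := hle (by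
    rw [Submodule.mem_colon_singleton]
    simp [smul_eq_mul, ← map_mul, hu])
  have hxm : ∀ i ∈ Finset.range d, x i ∈ maximalIdeal R := fun i hi =>
    h.mem _ (Multiset.mem_map_of_mem x hi)
  have hlt : ringKrullDim (AdicCompletion (maximalIdeal R) R ⧸ P) ≤
      (((Finset.range d).erase k).val.map (fun i => ι (x i))).card := by
    refine ringKrullDim_quotient_le_card _ ?_ ?_
    · intro z hz
      obtain ⟨i, hi, rfl⟩ := Multiset.mem_map.mp hz
      rw [AdicCompletion.maximalIdeal_eq_map]
      exact Ideal.mem_map_of_mem _ (hxm i (Finset.mem_of_mem_erase hi))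
    · rw [AdicCompletion.maximalIdeal_eq_map]
      refine (Ideal.map_mono h.le_radical).trans ((Ideal.map_radical_le _).trans
        (Ideal.radical_mono ?_))
      rw [bot_sup_eq, Ideal.map_span, Ideal.span_le]
      rintro _ ⟨z, hz, rfl⟩
      have hz' : z ∈ (Finset.range d).val.map x := hz
      obtain ⟨i, hi, rfl⟩ := Multiset.mem_map.mp hz'
      by_cases hik : i = k
      · exact Ideal.mem_sup_left (hik ▸ hxP)
      · have hmem : ι (x i) ∈ ((Finset.range d).erase k).val.map (fun i => ι (x i)) :=
          Multiset.mem_map_of_mem (fun i => ι (x i))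
            (Finset.mem_val.mpr (Finset.mem_erase.mpr ⟨hik, hi⟩))
        exact Ideal.mem_sup_right (Ideal.subset_span hmem)
  rw [hum P hP, Multiset.card_map, Finset.card_val,
    Finset.card_erase_of_mem (Finset.mem_range.mpr hk), Finset.card_range] at hlt
  have h1 := ringKrullDim_le_adicCompletion.trans hlt
  rw [hdim] at h1
  have h2 : d ≤ d - 1 := by exact_mod_cast h1
  omega

end Unmixed

/-- Suppose `R` is unmixed of dimension `d ≥ 2`, `x` is a C-system of parameters
of `R`, `t ≥ 1`, and `Ω = Ω_{x,1}^t(R) = {e_1((x_1^n,...,x_d^n) :_R m, R) : n ≥ t}` is finite.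
With `h = max{|X| : X ∈ Ω} + 𝒩(R)`, one has `m^h ⬝ H^i_m(R) = 0` for all `i ≠ d`;
in particular `R` is generalized Cohen-Macaulay. -/
theorem statement_9 {R : Type u} [CommRing R] [IsLocalRing R] [IsNoetherianRing R]
    (hres : IsHomImageOfCM R)
    (d : ℕ) (hd : 2 ≤ d) (hdim : ringKrullDim R = (d : WithBot ℕ∞))
    (hum : IsUnmixedRing R)
    (x : Fin d → R) (hx : IsCSOP R R x) (t : ℕ) (ht : 1 ≤ t)
    (Ω : Set ℤ)
    (hΩ : Ω = {z : ℤ | ∃ n ≥ t, ∃ e : ℕ → ℤ,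
      IsHilbCoeff R (colonIdeal R (Ideal.span (Set.range fun i => x i ^ n))) d e ∧ z = e 1})
    (hfin : Ω.Finite)
    (NR : ℕ) (hNR : IsStableValue R NR)
    (h : ℕ) (hh : (h : ℤ) = sSup ((fun z => |z|) '' Ω) + NR) :
    (∀ i : ℕ, i ≠ d → ∀ c ∈ maximalIdeal R ^ h, ∀ y : ↥(Hmod R R i), c • y = 0) ∧
      IsGeneralizedCM R := by
  obtain ⟨x, rfl⟩ : ∃ x' : ℕ → R, (fun i : Fin d => x' i) = x :=
    ⟨fun i => if hi : i < d then x ⟨i, hi⟩ else 0, by ext i; simp⟩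
  obtain ⟨hsop, hb⟩ := (isCSOP_iff x).mp hx
  have hcpow : ∀ n, cpow x n d = Ideal.span (Set.range fun i : Fin d => x i ^ n) := by
    intro n
    refine congrArg Ideal.span (Set.ext fun z => ?_)
    constructor
    · rintro ⟨i, hi, rfl⟩
      exact ⟨⟨i, hi⟩, rfl⟩
    · rintro ⟨i, rfl⟩
      exact ⟨i, i.2, rfl⟩
  refine (isColonSeq_of_isSysParam hsop (fun l hl => Ideal.pow_le_self three_ne_zero (hb l hl))
    (hum.eq_zero_of_mul_eq_zero hdim hsop)).annihilates hd hdim (t := t) (N := NR)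
    (fun n hn => hNR _ ⟨d, _, isCSOP_pow hx hn, hcpow n⟩) fun n hn e he => ?_
  rw [hcpow] at he
  have hmem : e 1 ∈ Ω := hΩ ▸ ⟨n, hn, e, he, rfl⟩
  have hle : |e 1| ≤ sSup ((fun z => |z|) '' Ω) :=
    le_csSup (hfin.image _).bddAbove ⟨_, hmem, rfl⟩
  rw [Int.abs_eq_natAbs] at hle
  omega
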